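/- arXiv:2505.22975 — 5 statements merged into one kernel-verified Lean document; each statement's English description precedes it below -/
import Mathlib

section
/- Let U ⊆ ℝⁿ be open and convex, and let f : U → ℝ be locally strongly convex. Then for every ε₀ > 0 and for every continuous function ε : U → (0,1] there exists a locally strongly convex function g of class C² on U such that the Lebesgue measure of {x ∈ U : f(x) ≠ g(x)} is less than ε₀ and |f(x) − g(x)| < ε(x) for all x ∈ U. Moreover, if f is η-strongly convex on U, then for every η̃ ∈ (0, η) such a function g can be found that is η̃-strongly convex on U. -/
open MeasureTheory Set

/-- `f` is `η`-strongly convex on `U`: `x ↦ f x − (η/2)‖x‖²` is convex on `U`. -/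
def StronglyConvexOnSet {n : ℕ} (η : ℝ) (U : Set (EuclideanSpace ℝ (Fin n)))
    (f : EuclideanSpace ℝ (Fin n) → ℝ) : Prop :=
  ConvexOn ℝ U (fun x => f x - (η / 2) * ‖x‖ ^ 2)

/-- `f` is locally strongly convex on the open set `U`: every point has a ball contained in
`U` on which `f` is strongly convex. -/
def LocallyStronglyConvexOn {n : ℕ} (U : Set (EuclideanSpace ℝ (Fin n)))
    (f : EuclideanSpace ℝ (Fin n) → ℝ) : Prop :=
  ∀ x ∈ U, ∃ r : ℝ, 0 < r ∧ Metric.ball x r ⊆ U ∧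
    ∃ η : ℝ, 0 < η ∧ StronglyConvexOnSet η (Metric.ball x r) f

section Auxiliary

open Filter Topology Metric
open scoped Convolution ContDiff

section Alexandrov

variable {E : Type*} [NormedAddCommGroup E] [InnerProductSpace ℝ E] [FiniteDimensional ℝ E]

/-- A convex function on an open set has a subgradient at every point. -/
lemma ConvexOn.exists_subgradient {B : Set E} (hB : IsOpen B) {F : E → ℝ} (hF : ConvexOn ℝ B F)
    {x : E} (hx : x ∈ B) : ∃ q : E, ∀ z ∈ B, F x + inner ℝ q (z - x) ≤ F z := by
  have hcont := hF.continuousOn hB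
  have hopen : IsOpen {p : E × ℝ | p.1 ∈ B ∧ F p.1 < p.2} := by
    rw [isOpen_iff_mem_nhds]
    rintro ⟨z, t⟩ ⟨hz, hzt⟩
    have h1 : ContinuousAt (fun p : E × ℝ => F p.1) (z, t) :=
      (hcont.continuousAt (hB.mem_nhds hz)).comp (f := Prod.fst) continuousAt_fst
    filter_upwards [continuousAt_fst.preimage_mem_nhds (hB.mem_nhds hz),
      h1.eventually_lt continuousAt_snd hzt] with p hp1 hp2
    exact ⟨hp1, hp2⟩
  obtain ⟨L, hL⟩ := geometric_hahn_banach_open_point hF.convex_strict_epigraph hopen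
    (x := (x, F x)) (by simp)
  have hsplit : ∀ (z : E) (t : ℝ), L (z, t) = L (z, 0) + t * L (0, 1) := fun z t => by
    have : (z, t) = (z, (0 : ℝ)) + t • ((0 : E), (1 : ℝ)) := by simp
    rw [this, map_add, map_smul, smul_eq_mul]
  have hc : L (0, 1) < 0 := by
    have := hL (x, F x + 1) ⟨hx, by simp⟩
    rw [hsplit x (F x + 1), hsplit x (F x)] at this
    linarith
  set c := L (0, 1) with hcdef
  let l : E →L[ℝ] ℝ := (-c)⁻¹ • (L.comp (ContinuousLinearMap.inl ℝ E ℝ))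
  refine ⟨(InnerProductSpace.toDual ℝ E).symm l, fun z hz => ?_⟩
  rw [InnerProductSpace.toDual_symm_apply]
  have hle : L (z, 0) + F z * c ≤ L (x, 0) + F x * c := by
    have : ∀ δ > 0, L (z, 0) + F z * c ≤ L (x, 0) + F x * c + δ := fun δ hδ => by
      have := hL (z, F z + δ / (-c)) ⟨hz, by simpa using div_pos hδ (neg_pos.2 hc)⟩
      rw [hsplit z, hsplit x (F x)] at this
      have h2 : δ / (-c) * c = -δ := by rw [div_neg, neg_mul, div_mul_cancel₀ _ hc.ne]
      nlinarith
    exact le_of_forall_pos_le_add this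
  have hl : l (z - x) = (-c)⁻¹ * (L (z, 0) - L (x, 0)) := by
    simp only [l, map_sub, smul_apply, ContinuousLinearMap.comp_apply,
      ContinuousLinearMap.inl_apply, smul_eq_mul, mul_sub]
  rw [hl]
  have hc' : 0 < -c := by linarith
  have : (-c)⁻¹ * (L (z, 0) - L (x, 0)) ≤ F z - F x := by
    rw [inv_mul_le_iff₀ hc']
    nlinarith
  linarith

/-- Integrating a one-dimensional subgradient selection that is close to an affine function. -/
lemma abs_sub_quadratic_le_of_subgradient {h w : ℝ → ℝ} {a b e : ℝ}
    (hw : ∀ s ∈ Icc (0 : ℝ) 1, ∀ t ∈ Icc (0 : ℝ) 1, h s + (t - s) * w s ≤ h t)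
    (he : ∀ t ∈ Icc (0 : ℝ) 1, |w t - a - t * b| ≤ e) : |h 1 - h 0 - a - b / 2| ≤ e := by
  set ψ : ℝ → ℝ := fun t => h t - a * t - b * t ^ 2 / 2 with hψ
  have step : ∀ s ∈ Icc (0 : ℝ) 1, ∀ t ∈ Icc (0 : ℝ) 1, s ≤ t →
      |ψ t - ψ s| ≤ (t - s) * e + (t - s) ^ 2 * (|b| / 2) := by
    intro s hs t ht hst
    have h1 := hw s hs t ht
    have h2 := hw t ht s hs
    have h3 := abs_le.1 (he s hs)
    have h4 := abs_le.1 (he t ht)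
    have hts : 0 ≤ t - s := sub_nonneg.2 hst
    have h5 : (t - s) * w t ≤ (t - s) * (a + t * b + e) :=
      mul_le_mul_of_nonneg_left (by linarith) hts
    have h6 : (t - s) * (a + s * b - e) ≤ (t - s) * w s :=
      mul_le_mul_of_nonneg_left (by linarith) hts
    have h7 : (t - s) ^ 2 * b ≤ (t - s) ^ 2 * |b| :=
      mul_le_mul_of_nonneg_left (le_abs_self b) (sq_nonneg _)
    rw [abs_le]
    simp only [hψ]
    constructor <;> nlinarith
  have main : ∀ N : ℕ, 0 < N → |ψ 1 - ψ 0| ≤ e + |b| / 2 * (1 / (N : ℝ)) := by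
    intro N hN
    have hN' : (0 : ℝ) < N := by exact_mod_cast hN
    have ind : ∀ k : ℕ, k ≤ N → |ψ (k / N) - ψ 0| ≤
        k * ((1 / N) * e + (1 / N) ^ 2 * (|b| / 2)) := by
      intro k
      induction k with
      | zero => intro _; simp
      | succ k ih =>
        intro hk
        have hk' : ((k + 1 : ℕ) : ℝ) ≤ N := by exact_mod_cast hk
        push_cast at hk'
        have hs := step (k / N) ⟨by positivity, by rw [div_le_one hN']; linarith⟩
          ((k + 1 : ℕ) / N) ⟨by positivity, by rw [div_le_one hN']; push_cast; linarith⟩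
          (by push_cast; gcongr; linarith)
        have hd : (((k + 1 : ℕ) : ℝ) / N - k / N) = 1 / N := by push_cast; ring
        rw [hd] at hs
        calc _ = |(ψ ((k + 1 : ℕ) / N) - ψ (k / N)) + (ψ (k / N) - ψ 0)| := by ring_nf
          _ ≤ _ := abs_add_le _ _
          _ ≤ _ := add_le_add hs (ih (by omega))
          _ = _ := by push_cast; ring
    have := ind N le_rfl
    rw [div_self hN'.ne'] at this
    calc _ ≤ _ := this
      _ = _ := by field_simp
  have hlim : Tendsto (fun N : ℕ => e + |b| / 2 * (1 / (N : ℝ))) atTop (𝓝 (e + |b| / 2 * 0)) :=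
    (tendsto_one_div_atTop_nhds_zero_nat.const_mul _).const_add _
  have hfin : |ψ 1 - ψ 0| ≤ e + |b| / 2 * 0 :=
    ge_of_tendsto hlim (by filter_upwards [eventually_gt_atTop 0] with N hN using main N hN)
  have heq : ψ 1 - ψ 0 = h 1 - h 0 - a - b / 2 := by simp only [hψ]; ring
  rw [← heq]
  simpa using hfin

omit [FiniteDimensional ℝ E] in
/-- A differentiable selection of subgradients yields a second-order expansion. -/
lemma second_order_of_hasFDerivAt_subgradient {B : Set E} (hB : IsOpen B) {F : E → ℝ}
    {q : E → E} (hq : ∀ y ∈ B, ∀ z ∈ B, F y + inner ℝ (q y) (z - y) ≤ F z) {x : E} (hx : x ∈ B)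
    {D : E →L[ℝ] E} (hD : HasFDerivAt q D x) :
    (fun v => F (x + v) - F x - innerSL ℝ (q x) v - 1 / 2 * ((innerSL ℝ).comp D) v v)
      =o[𝓝 0] fun v => ‖v‖ ^ 2 := by
  rw [Asymptotics.isLittleO_iff]
  intro c hc
  rw [hasFDerivAt_iff_isLittleO_nhds_zero, Asymptotics.isLittleO_iff] at hD
  have hev := hD hc
  have hBx : ∀ᶠ v in 𝓝 (0 : E), x + v ∈ B := by
    have : Tendsto (fun v : E => x + v) (𝓝 0) (𝓝 x) := by
      simpa using (continuous_const_add x).tendsto (0 : E)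
    exact this (hB.mem_nhds hx)
  obtain ⟨δ, hδ, hball⟩ := Metric.eventually_nhds_iff_ball.1 (hev.and hBx)
  filter_upwards [Metric.ball_mem_nhds (0 : E) hδ] with v hv
  have hmem : ∀ t ∈ Icc (0 : ℝ) 1, t • v ∈ ball (0 : E) δ := by
    intro t ht
    rw [mem_ball_zero_iff] at hv ⊢
    rw [norm_smul, Real.norm_of_nonneg ht.1]
    exact lt_of_le_of_lt (mul_le_of_le_one_left (norm_nonneg _) ht.2) hv
  have key := abs_sub_quadratic_le_of_subgradient (h := fun t => F (x + t • v))
    (w := fun t => inner ℝ (q (x + t • v)) v) (a := inner ℝ (q x) v) (b := inner ℝ (D v) v)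
    (e := c * ‖v‖ ^ 2) ?_ ?_
  · simp only [one_smul, zero_smul, add_zero] at key
    rw [Real.norm_eq_abs, Real.norm_of_nonneg (by positivity)]
    refine le_of_eq_of_le ?_ key
    congr 1
    simp only [innerSL_apply_apply, ContinuousLinearMap.comp_apply]
    ring
  · intro s hs t ht
    have := hq _ (hball _ (hmem s hs)).2 _ (hball _ (hmem t ht)).2
    have h2 : x + t • v - (x + s • v) = (t - s) • v := by rw [sub_smul]; abel
    rwa [h2, inner_smul_right] at this
  · intro t ht
    have h1 := (hball _ (hmem t ht)).1
    have h2 : inner ℝ (q (x + t • v)) v - inner ℝ (q x) v - t * inner ℝ (D v) v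
        = inner ℝ (q (x + t • v) - q x - D (t • v)) v := by
      rw [inner_sub_left, inner_sub_left, map_smul, inner_smul_left]; simp
    rw [h2]
    refine (abs_real_inner_le_norm _ _).trans ?_
    have h3 : ‖t • v‖ ≤ ‖v‖ := by
      rw [norm_smul, Real.norm_of_nonneg ht.1]
      exact mul_le_of_le_one_left (norm_nonneg _) ht.2
    calc _ ≤ (c * ‖t • v‖) * ‖v‖ := by gcongr
      _ ≤ (c * ‖v‖) * ‖v‖ := by gcongr
      _ = _ := by ring

variable [MeasurableSpace E] [BorelSpace E] (μ : Measure E) [μ.IsAddHaarMeasure]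

lemma LipschitzWith.addHaar_image_eq_zero {C : NNReal} {g : E → E} (hg : LipschitzWith C g)
    {s : Set E} (hs : μ s = 0) : μ (g '' s) = 0 := by
  have h1 : μ.restrict univ ≪ Measure.hausdorffMeasure (X := E) (Module.finrank ℝ E) := by
    rw [Measure.restrict_univ]
    exact Measure.absolutelyContinuous_isAddHaarMeasure _ _
  have h2 : Measure.hausdorffMeasure (X := E) (Module.finrank ℝ E) ≪ μ :=
    Measure.absolutelyContinuous_isAddHaarMeasure _ _
  rw [Measure.restrict_univ] at h1
  apply h1
  have := hg.hausdorffMeasure_image_le (d := Module.finrank ℝ E) (by positivity) s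
  rw [h2 hs, mul_zero] at this
  exact le_antisymm this bot_le

/-- The values of a Lipschitz self-map at points where it fails to have an invertible derivative
form a null set. -/
lemma LipschitzWith.addHaar_image_not_invertible_eq_zero {C : NNReal} {g : E → E}
    (hg : LipschitzWith C g) :
    μ (g '' {p | ¬ ∃ D : E ≃L[ℝ] E, HasFDerivAt g (D : E →L[ℝ] E) p}) = 0 := by
  have hsub : {p | ¬ ∃ D : E ≃L[ℝ] E, HasFDerivAt g (D : E →L[ℝ] E) p} ⊆
      {p | ¬ DifferentiableAt ℝ g p} ∪
        {p | DifferentiableAt ℝ g p ∧ (fderiv ℝ g p).det = 0} := by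
    intro p hp
    by_contra hcon
    simp only [mem_union, mem_ofPred_eq, not_or, not_not, not_and] at hcon
    refine hp ⟨(fderiv ℝ g p).toContinuousLinearEquivOfDetNeZero (hcon.2 hcon.1), ?_⟩
    rw [ContinuousLinearMap.coe_toContinuousLinearEquivOfDetNeZero]
    exact hcon.1.hasFDerivAt
  refine measure_mono_null (image_mono hsub) ?_
  rw [image_union]
  refine measure_union_null (hg.addHaar_image_eq_zero μ ?_) ?_
  · exact hg.ae_differentiableAt (μ := μ)
  · exact addHaar_image_eq_zero_of_det_fderivWithin_eq_zero μ
      (fun p hp => hp.1.hasFDerivAt.hasFDerivWithinAt) (fun p hp => hp.2)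

/-- **Alexandrov's theorem**: a convex function on an open set has a second-order expansion at
almost every point. -/
theorem ConvexOn.ae_second_order {B : Set E} (hB : IsOpen B) {F : E → ℝ} (hF : ConvexOn ℝ B F) :
    ∀ᵐ x ∂μ, x ∈ B → ∃ (p : E →L[ℝ] ℝ) (A : E →L[ℝ] E →L[ℝ] ℝ),
      (fun v => F (x + v) - F x - p v - 1 / 2 * A v v) =o[𝓝 0] fun v => ‖v‖ ^ 2 := by
  classical
  let S : E → Set E := fun y => {q | ∀ z ∈ B, F y + inner ℝ q (z - y) ≤ F z}
  have hSne : ∀ y ∈ B, (S y).Nonempty := fun y hy => hF.exists_subgradient hB hy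
  have hmono : ∀ y ∈ B, ∀ z ∈ B, ∀ q ∈ S y, ∀ q' ∈ S z,
      ‖y - z‖ ≤ ‖(q + y) - (q' + z)‖ := by
    intro y hy z hz q hq q' hq'
    have h1 := hq z hz
    have h2 := hq' y hy
    have h3 : 0 ≤ inner ℝ (q - q') (y - z) := by
      have : inner ℝ q (z - y) = - inner ℝ q (y - z) := by rw [← inner_neg_right, neg_sub]
      rw [inner_sub_left]
      linarith
    have h4 : (q + y) - (q' + z) = (q - q') + (y - z) := by abel
    rw [h4]
    refine abs_le_of_sq_le_sq' ?_ (norm_nonneg _) |>.2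
    rw [norm_add_sq_real]
    nlinarith [sq_nonneg ‖q - q'‖]
  let P : Set E := {p | ∃ y ∈ B, p - y ∈ S y}
  choose! G hGB hGS using (fun p (hp : p ∈ P) => hp : ∀ p ∈ P, ∃ y ∈ B, p - y ∈ S y)
  have hGlip : LipschitzOnWith 1 G P := by
    refine LipschitzOnWith.of_dist_le_mul fun p hp p' hp' => ?_
    have := hmono _ (hGB p hp) _ (hGB p' hp') _ (hGS p hp) _ (hGS p' hp')
    simpa [dist_eq_norm] using this
  have hGeq : ∀ y ∈ B, ∀ q ∈ S y, G (q + y) = y := by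
    intro y hy q hq
    have hP : q + y ∈ P := ⟨y, hy, by simpa using hq⟩
    have := hmono _ (hGB _ hP) _ hy _ (hGS _ hP) _ hq
    simpa [sub_eq_zero] using this
  obtain ⟨Ge, hGe, hEq⟩ := hGlip.extend_finite_dimension
  have hGe' : ∀ y ∈ B, ∀ q ∈ S y, Ge (q + y) = y := fun y hy q hq => by
    rw [← hEq ⟨y, hy, by simpa using hq⟩, hGeq y hy q hq]
  choose! q hq using hSne
  have hnull := hGe.addHaar_image_not_invertible_eq_zero μ
  filter_upwards [measure_eq_zero_iff_ae_notMem.1 hnull] with x hxnull hx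
  have hinv : ∀ p, Ge p = x → ∃ D : E ≃L[ℝ] E, HasFDerivAt Ge (D : E →L[ℝ] E) p := by
    intro p hp
    by_contra hcon
    exact hxnull ⟨p, hcon, hp⟩
  obtain ⟨D, hD⟩ := hinv (q x + x) (hGe' x hx _ (hq x hx))
  have hsing : ∀ q' ∈ S x, q' = q x := by
    intro q' hq'
    by_contra hne
    have hline : ∀ t ∈ Icc (0 : ℝ) 1, Ge (q x + x + t • (q' - q x)) = x := by
      intro t ht
      have : q x + t • (q' - q x) ∈ S x := by
        intro z hz
        have h1 := hq x hx z hz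
        have h2 := hq' z hz
        have h3 : inner ℝ (q x + t • (q' - q x)) (z - x) =
            (1 - t) * inner ℝ (q x) (z - x) + t * inner ℝ q' (z - x) := by
          rw [inner_add_left, inner_smul_left, inner_sub_left]; simp; ring
        rw [h3]
        nlinarith [mul_le_mul_of_nonneg_left h1 (sub_nonneg.2 ht.2),
          mul_le_mul_of_nonneg_left h2 ht.1]
      convert hGe' x hx _ this using 2
      abel
    have hder : HasDerivWithinAt (fun t : ℝ => Ge (q x + x + t • (q' - q x)))
        (D (q' - q x)) (Icc 0 1) 0 := by
      have hl : HasDerivAt (fun t : ℝ => q x + x + t • (q' - q x)) (q' - q x) 0 := by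
        simpa using ((hasDerivAt_id (0 : ℝ)).smul_const (q' - q x)).const_add (q x + x)
      have hD0 : HasFDerivAt Ge (D : E →L[ℝ] E) (q x + x + (0 : ℝ) • (q' - q x)) := by
        simpa using hD
      exact (hD0.comp_hasDerivAt (0 : ℝ) hl).hasDerivWithinAt
    have hder0 : HasDerivWithinAt (fun t : ℝ => Ge (q x + x + t • (q' - q x)))
        0 (Icc 0 1) 0 :=
      (hasDerivWithinAt_const (0 : ℝ) (Icc 0 1) x).congr hline (hline 0 (by simp))
    have hu : UniqueDiffWithinAt ℝ (Icc (0 : ℝ) 1) 0 :=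
      uniqueDiffOn_Icc zero_lt_one 0 (by simp)
    have h0 := hu.eq_deriv _ hder hder0
    rw [← map_zero D] at h0
    exact hne (sub_eq_zero.1 (D.injective h0))
  have hcontF := hF.continuousOn hB
  -- local boundedness and closedness of the subgradients give continuity at `x`
  have hcontq : ContinuousAt q x := by
    obtain ⟨C, t, ht, hLip⟩ := (hF.locallyLipschitzOn hB) hx
    rw [hB.nhdsWithin_eq hx] at ht
    have hbd : ∀ᶠ y in 𝓝 x, q y ∈ closedBall (0 : E) C := by
      obtain ⟨ρ, hρ, hsub⟩ := Metric.mem_nhds_iff.1 (inter_mem ht (hB.mem_nhds hx))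
      filter_upwards [ball_mem_nhds x hρ] with y hy
      have hev : ∀ᶠ s in 𝓝[>] (0 : ℝ), y + s • q y ∈ ball x ρ := by
        have : Tendsto (fun s : ℝ => y + s • q y) (𝓝 0) (𝓝 y) := by
          have h : Continuous fun s : ℝ => y + s • q y := by fun_prop
          exact h.tendsto' 0 y (by simp)
        exact (this.mono_left nhdsWithin_le_nhds) (isOpen_ball.mem_nhds hy)
      obtain ⟨s, hs, hs0⟩ := (hev.and self_mem_nhdsWithin).exists
      have h1 := hq y (hsub hy).2 _ (hsub hs).2
      have h2 := hLip.dist_le_mul _ (hsub hs).1 _ (hsub hy).1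
      rw [Real.dist_eq, dist_eq_norm, add_sub_cancel_left, norm_smul,
        Real.norm_of_nonneg hs0.le] at h2
      rw [add_sub_cancel_left, inner_smul_right, real_inner_self_eq_norm_sq] at h1
      have h3 := (le_abs_self _).trans h2
      rw [mem_closedBall_zero_iff]
      by_contra! hcon
      have hqpos : 0 < ‖q y‖ := lt_of_le_of_lt C.2 hcon
      nlinarith [mul_pos hs0 hqpos, mul_pos (mul_pos hs0 hqpos) (sub_pos.2 hcon)]
    refine (isCompact_closedBall (0 : E) (C : ℝ)).tendsto_nhds_of_unique_mapClusterPt hbd ?_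
    intro p _ hp
    obtain ⟨W, hW, hWt⟩ := mapClusterPt_iff_ultrafilter.1 hp
    refine hsing p fun z hz => ?_
    have hFx : Tendsto F W (𝓝 (F x)) := (hcontF.continuousAt (hB.mem_nhds hx)).tendsto.mono_left hW
    have hid : Tendsto (fun y : E => z - y) W (𝓝 (z - x)) :=
      ((continuous_const.sub continuous_id : Continuous fun y : E => z - y).tendsto x).mono_left hW
    refine le_of_tendsto (hFx.add (hWt.inner hid)) ?_
    filter_upwards [hW (hB.mem_nhds hx)] with y hy using hq y hy z hz
  have hσ : HasFDerivAt (fun y => q y + y) (D.symm : E →L[ℝ] E) x := by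
    refine HasFDerivAt.of_local_left_inverse (hcontq.add continuousAt_id) hD ?_
    filter_upwards [hB.mem_nhds hx] with y hy using hGe' y hy _ (hq y hy)
  have hqd : HasFDerivAt q ((D.symm : E →L[ℝ] E) - ContinuousLinearMap.id ℝ E) x := by
    have := hσ.sub (hasFDerivAt_id x)
    refine this.congr_of_eventuallyEq (Eventually.of_forall fun y => ?_)
    simp
  exact ⟨_, _, second_order_of_hasFDerivAt_subgradient hB hq hx hqd⟩

end Alexandrov

section Uniformization

lemma exists_nat_measure_diff_lt {α : Type*} [MeasurableSpace α] {μ : Measure α} {D : Set α}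
    (hD : MeasurableSet D) (hfin : μ D ≠ ⊤) {A : ℕ → Set α} (hA : ∀ m, MeasurableSet (A m))
    (hmono : Monotone A) (h0 : μ (D \ ⋃ m, A m) = 0) {ε : ENNReal} (hε : 0 < ε) :
    ∃ m, μ (D \ A m) < ε := by
  have hanti : Antitone fun m => D \ A m := fun i j hij => sdiff_subset_sdiff_right (hmono hij)
  have := tendsto_measure_iInter_atTop (μ := μ) (s := fun m => D \ A m)
    (fun m => (hD.diff (hA m)).nullMeasurableSet) hanti
    ⟨0, ne_top_of_le_ne_top hfin (measure_mono sdiff_subset)⟩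
  rw [← sdiff_iUnion, h0] at this
  exact (this.eventually_lt_const hε).exists

lemma eq_zero_and_abs_le_of_eventually_abs_le {a b c : ℝ}
    (h : ∀ᶠ t in 𝓝[>] (0 : ℝ), |t * a + t ^ 2 * b| ≤ c * t ^ 2) : a = 0 ∧ |b| ≤ c := by
  have h1 : ∀ᶠ t in 𝓝[>] (0 : ℝ), |a + t * b| ≤ c * t := by
    filter_upwards [h, self_mem_nhdsWithin] with t ht (ht0 : 0 < t)
    have : t * a + t ^ 2 * b = t * (a + t * b) := by ring
    rw [this, abs_mul, abs_of_pos ht0] at ht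
    exact le_of_mul_le_mul_left (by linarith) ht0
  have ha : a = 0 := by
    have hl : Tendsto (fun t : ℝ => |a + t * b|) (𝓝[>] 0) (𝓝 |a|) := by
      have h : Continuous fun t : ℝ => |a + t * b| := by fun_prop
      exact (h.tendsto' 0 _ (by simp)).mono_left nhdsWithin_le_nhds
    have hr : Tendsto (fun t : ℝ => c * t) (𝓝[>] 0) (𝓝 0) := by
      have h : Continuous fun t : ℝ => c * t := by fun_prop
      exact (h.tendsto' 0 _ (by simp)).mono_left nhdsWithin_le_nhds
    exact abs_nonpos_iff.1 (le_of_tendsto_of_tendsto hl hr h1)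
  refine ⟨ha, ?_⟩
  obtain ⟨t, ht, ht0 : 0 < t⟩ := (h1.and self_mem_nhdsWithin).exists
  rw [ha, zero_add, abs_mul, abs_of_pos ht0] at ht
  exact le_of_mul_le_mul_left (by linarith) ht0

variable {E : Type*} [NormedAddCommGroup E] [InnerProductSpace ℝ E] [FiniteDimensional ℝ E]

/-- The set of points of `C` where `f` is within `e ‖v‖ ^ 2` of some second-order polynomial with
coefficients bounded by `R`, for all increments `v` of norm at most `δ`. -/
def approxJetSet (f : E → ℝ) (C : Set E) (δ e R : ℝ) : Set E :=
  {x | x ∈ C ∧ ∃ (p : E →L[ℝ] ℝ) (A : E →L[ℝ] E →L[ℝ] ℝ), ‖p‖ ≤ R ∧ ‖A‖ ≤ R ∧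
    ∀ v, ‖v‖ ≤ δ → |f (x + v) - f x - p v - 1 / 2 * A v v| ≤ e * ‖v‖ ^ 2}

lemma isCompact_approxJetSet {f : E → ℝ} (hf : Continuous f) {C : Set E} (hC : IsCompact C)
    (δ e R : ℝ) : IsCompact (approxJetSet f C δ e R) := by
  have hcl : IsClosed {z : E × (E →L[ℝ] ℝ) × (E →L[ℝ] E →L[ℝ] ℝ) |
      ∀ v, ‖v‖ ≤ δ → |f (z.1 + v) - f z.1 - z.2.1 v - 1 / 2 * z.2.2 v v| ≤ e * ‖v‖ ^ 2} := by
    simp only [ofPred_forall]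
    refine isClosed_iInter fun v => isClosed_iInter fun _ => isClosed_le ?_ continuous_const
    have h1 : Continuous fun z : E × (E →L[ℝ] ℝ) × (E →L[ℝ] E →L[ℝ] ℝ) => z.2.1 v :=
      (continuous_fst.comp continuous_snd).clm_apply continuous_const
    have h2 : Continuous fun z : E × (E →L[ℝ] ℝ) × (E →L[ℝ] E →L[ℝ] ℝ) => z.2.2 v v :=
      ((continuous_snd.comp continuous_snd).clm_apply continuous_const).clm_apply continuous_const
    exact ((((hf.comp (continuous_fst.add continuous_const)).sub
      (hf.comp continuous_fst)).sub h1).sub (h2.const_mul _)).abs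
  have : ProperSpace (E →L[ℝ] E →L[ℝ] ℝ) :=
    FiniteDimensional.proper ℝ (E →L[ℝ] E →L[ℝ] ℝ)
  have hb1 := isCompact_closedBall (0 : E →L[ℝ] ℝ) R
  have hb2 : IsCompact (closedBall (0 : E →L[ℝ] E →L[ℝ] ℝ) R) :=
    ProperSpace.isCompact_closedBall _ _
  have hb3 := (hC.prod (hb1.prod hb2)).inter_right hcl
  have hcp := hb3.image continuous_fst
  convert hcp using 1
  ext x
  constructor
  · rintro ⟨hx, p, A, hp, hA, h⟩
    exact ⟨(x, p, A), ⟨⟨hx, by simpa using hp, (dist_zero_right A).trans_le hA⟩, h⟩, rfl⟩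
  · rintro ⟨⟨x', p, A⟩, ⟨⟨hx, hp, hA⟩, h⟩, rfl⟩
    exact ⟨hx, p, A, by simpa using hp, (dist_zero_right A).symm.trans_le hA, h⟩

variable [MeasurableSpace E] [BorelSpace E] (μ : Measure E) [μ.IsAddHaarMeasure]

/-- An Egorov-type statement: almost everywhere second-order expansions are uniform on compact sets
of almost full measure. -/
theorem exists_isCompact_uniform_second_order {f : E → ℝ} (hf : Continuous f) {C D : Set E}
    (hC : IsCompact C) (hDC : D ⊆ C) (hD : MeasurableSet D)
    (hae : ∀ᵐ x ∂μ, x ∈ D → ∃ (p : E →L[ℝ] ℝ) (A : E →L[ℝ] E →L[ℝ] ℝ),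
      (fun v => f (x + v) - f x - p v - 1 / 2 * A v v) =o[𝓝 0] fun v => ‖v‖ ^ 2)
    {ε : ENNReal} (hε : ε ≠ 0) :
    ∃ K ⊆ D, IsCompact K ∧ μ (D \ K) < ε ∧ ∃ (R : ℝ) (p : E → E →L[ℝ] ℝ)
      (A : E → E →L[ℝ] E →L[ℝ] ℝ), (∀ x ∈ K, ∀ v, |A x v v| ≤ R * ‖v‖ ^ 2) ∧
      ∀ e > 0, ∃ δ > 0, ∀ x ∈ K, ∀ v, ‖v‖ < δ →
        |f (x + v) - f x - p x v - 1 / 2 * A x v v| ≤ e * ‖v‖ ^ 2 := by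
  classical
  have hDfin : μ D ≠ ⊤ := ne_top_of_le_ne_top hC.measure_lt_top.ne (measure_mono hDC)
  set T : ℕ → ℕ → ℕ → Set E := fun R j m =>
    approxJetSet f C (1 / ((m : ℝ) + 1)) (1 / ((j : ℝ) + 1)) R with hT
  have hTm : ∀ R j m, MeasurableSet (T R j m) := fun R j m =>
    (isCompact_approxJetSet hf hC _ _ _).measurableSet
  have hTmono : ∀ R j, Monotone (T R j) := by
    rintro R j m m' hm x ⟨hx, p, A, hp, hA, h⟩
    refine ⟨hx, p, A, hp, hA, fun v hv => h v (hv.trans ?_)⟩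
    gcongr
  have hTmonoR : ∀ R R' j m, R ≤ R' → T R j m ⊆ T R' j m := by
    rintro R R' j m hR x ⟨hx, p, A, hp, hA, h⟩
    have : (R : ℝ) ≤ R' := by exact_mod_cast hR
    exact ⟨hx, p, A, hp.trans this, hA.trans this, h⟩
  obtain ⟨N, hN0, hNm, hN⟩ : ∃ N : Set E, μ N = 0 ∧ MeasurableSet N ∧ ∀ x ∈ D, x ∉ N →
      ∃ (p : E →L[ℝ] ℝ) (A : E →L[ℝ] E →L[ℝ] ℝ),
      (fun v => f (x + v) - f x - p v - 1 / 2 * A v v) =o[𝓝 0] fun v => ‖v‖ ^ 2 := by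
    obtain ⟨N, hN, hNm, hN0⟩ := exists_measurable_superset_of_null (ae_iff.1 hae)
    refine ⟨N, hN0, hNm, fun x hx hxN => ?_⟩
    by_contra hcon
    exact hxN (hN fun h => hcon (h hx))
  set H : ℕ → Set E := fun R => ⋂ j, ⋃ m, T R j m with hH
  have hHm : ∀ R, MeasurableSet (H R) := fun R =>
    MeasurableSet.iInter fun j => MeasurableSet.iUnion fun m => hTm R j m
  have hHmono : Monotone H := fun R R' hR =>
    iInter_mono fun j => iUnion_mono fun m => hTmonoR R R' j m hR
  have hcov : D \ ⋃ R, H R ⊆ N := by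
    rintro x ⟨hxD, hxH⟩
    by_contra hxN
    obtain ⟨p, A, hpA⟩ := hN x hxD hxN
    obtain ⟨R, hR⟩ := exists_nat_ge (max ‖p‖ ‖A‖)
    refine hxH (mem_iUnion.2 ⟨R, mem_iInter.2 fun j => mem_iUnion.2 ?_⟩)
    have hj : (0 : ℝ) < 1 / ((j : ℝ) + 1) := by positivity
    obtain ⟨δ, hδ, hball⟩ := Metric.eventually_nhds_iff_ball.1
      (Asymptotics.isLittleO_iff.1 hpA hj)
    obtain ⟨m, hm⟩ := exists_nat_one_div_lt hδ
    refine ⟨m, hDC hxD, p, A, (le_max_left _ _).trans hR, (le_max_right _ _).trans hR,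
      fun v hv => ?_⟩
    simpa using hball v (by rw [mem_ball_zero_iff]; exact lt_of_le_of_lt hv hm)
  have hε4 : 0 < ε / 3 := ENNReal.div_pos hε (by simp)
  obtain ⟨R, hR⟩ := exists_nat_measure_diff_lt hD hDfin hHm hHmono (measure_mono_null hcov hN0) hε4
  obtain ⟨δ, hδ0, hδsum⟩ := ENNReal.exists_pos_sum_of_countable hε4.ne' ℕ
  have hm : ∀ j, ∃ m, μ ((D ∩ ⋃ m, T R j m) \ T R j m) < δ j := fun j => by
    refine exists_nat_measure_diff_lt (hD.inter (MeasurableSet.iUnion fun m => hTm R j m))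
      (ne_top_of_le_ne_top hDfin (measure_mono inter_subset_left)) (hTm R j) (hTmono R j) ?_
      (by exact_mod_cast hδ0 j)
    rw [sdiff_eq_empty.2 inter_subset_right, measure_empty]
  choose m hm using hm
  set K₀ : Set E := (D ∩ ⋂ j, T R j (m j)) \ N with hK₀
  have hK₀m : MeasurableSet K₀ := (hD.inter (MeasurableSet.iInter fun j => hTm _ _ _)).diff hNm
  have hK₀D : K₀ ⊆ D := fun x hx => hx.1.1
  obtain ⟨K, hKK, hKc, hKμ⟩ := hK₀m.exists_isCompact_sdiff_lt (μ := μ)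
    (ne_top_of_le_ne_top hDfin (measure_mono hK₀D)) hε4.ne'
  refine ⟨K, hKK.trans hK₀D, hKc, ?_, ?_⟩
  · have hsub : D \ K ⊆ (D \ H R) ∪ (⋃ j, ((D ∩ ⋃ m, T R j m) \ T R j (m j))) ∪ N ∪ (K₀ \ K) := by
      rintro x ⟨hxD, hxK⟩
      by_contra hcon
      simp only [mem_union, not_or] at hcon
      obtain ⟨⟨⟨h1, h2⟩, h3⟩, h4⟩ := hcon
      have hxH : x ∈ H R := by
        by_contra h; exact h1 ⟨hxD, h⟩
      refine h4 ⟨⟨⟨hxD, mem_iInter.2 fun j => ?_⟩, h3⟩, hxK⟩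
      by_contra h
      exact h2 (mem_iUnion.2 ⟨j, ⟨hxD, mem_iInter.1 hxH j⟩, h⟩)
    have h2 : μ (⋃ j, ((D ∩ ⋃ m, T R j m) \ T R j (m j))) < ε / 3 :=
      lt_of_le_of_lt ((measure_iUnion_le _).trans (ENNReal.tsum_le_tsum fun j => (hm j).le)) hδsum
    calc μ (D \ K) ≤ _ := measure_mono hsub
      _ ≤ μ (D \ H R) + μ (⋃ j, ((D ∩ ⋃ m, T R j m) \ T R j (m j))) + μ N + μ (K₀ \ K) := by
        refine (measure_union_le _ _).trans (add_le_add_left ?_ _)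
        refine (measure_union_le _ _).trans (add_le_add_left ?_ _)
        exact measure_union_le _ _
      _ < ε / 3 + ε / 3 + ε / 3 := by
        rw [hN0, add_zero]
        exact ENNReal.add_lt_add (ENNReal.add_lt_add hR h2) hKμ
      _ = ε := ENNReal.add_thirds ε
  · choose! p A hpA using hN
    have hcmp : ∀ x ∈ K, ∀ j : ℕ, ∀ v, ∃ B : E →L[ℝ] E →L[ℝ] ℝ, ‖B‖ ≤ R ∧
        |1 / 2 * B v v - 1 / 2 * A x v v| ≤ 1 / ((j : ℝ) + 1) * ‖v‖ ^ 2 ∧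
        (‖v‖ ≤ 1 / ((m j : ℝ) + 1) →
          |f (x + v) - f x - p x v - 1 / 2 * B v v| ≤ 1 / ((j : ℝ) + 1) * ‖v‖ ^ 2) := by
      intro x hx j v
      obtain ⟨-, q, B, hq, hB, hqB⟩ := mem_iInter.1 (hKK hx).1.2 j
      have hj : (0 : ℝ) < 1 / ((j : ℝ) + 1) := by positivity
      have key : ∀ e > 0, (q v - p x v = 0 ∧ |1 / 2 * B v v - 1 / 2 * A x v v| ≤
          (1 / ((j : ℝ) + 1) + e) * ‖v‖ ^ 2) := by
        intro e he
        refine eq_zero_and_abs_le_of_eventually_abs_le ?_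
        have h0 : Tendsto (fun t : ℝ => t • v) (𝓝[>] 0) (𝓝 0) := by
          have h : Continuous fun t : ℝ => t • v := by fun_prop
          exact (h.tendsto' 0 _ (by simp)).mono_left nhdsWithin_le_nhds
        have h1 := h0.eventually (Asymptotics.isLittleO_iff.1
          (hpA x (hK₀D (hKK hx)) (hKK hx).2) he)
        have h2 := h0.eventually (closedBall_mem_nhds (0 : E)
          (show (0 : ℝ) < 1 / ((m j : ℝ) + 1) by positivity))
        filter_upwards [h1, h2] with t ht1 ht2
        have h3 := hqB (t • v) (by simpa using ht2)
        rw [Real.norm_eq_abs, Real.norm_of_nonneg (by positivity)] at ht1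
        have h4 := abs_sub_le (f (x + t • v) - f x - p x (t • v) - 1 / 2 * A x (t • v) (t • v)) 0
          (f (x + t • v) - f x - q (t • v) - 1 / 2 * B (t • v) (t • v))
        rw [sub_zero, zero_sub, abs_neg] at h4
        have h5 : ‖t • v‖ ^ 2 = t ^ 2 * ‖v‖ ^ 2 := by
          rw [norm_smul, mul_pow, Real.norm_eq_abs, sq_abs]
        rw [h5] at h3 ht1
        calc _ = |f (x + t • v) - f x - p x (t • v) - 1 / 2 * A x (t • v) (t • v) -
          (f (x + t • v) - f x - q (t • v) - 1 / 2 * B (t • v) (t • v))| := by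
              simp only [map_smul, smul_apply, smul_eq_mul]; ring_nf
          _ ≤ _ := h4
          _ ≤ _ := add_le_add ht1 h3
          _ = _ := by ring
      have hpq : q v = p x v := sub_eq_zero.1 (key 1 one_pos).1
      refine ⟨B, hB, ?_, fun hv => by rw [← hpq]; exact hqB v hv⟩
      refine le_of_forall_pos_le_add fun e he => ?_
      rcases eq_or_ne v 0 with rfl | hv
      · simpa using he.le
      · have hv' : 0 < ‖v‖ ^ 2 := by positivity
        have := (key (e / ‖v‖ ^ 2) (by positivity)).2
        rwa [add_mul, div_mul_cancel₀ _ hv'.ne'] at this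
    refine ⟨R + 2, p, A, fun x hx v => ?_, fun e he => ?_⟩
    · obtain ⟨B, hB, h1, -⟩ := hcmp x hx 0 v
      have h2 : |B v v| ≤ R * ‖v‖ ^ 2 := by
        calc |B v v| ≤ ‖B‖ * ‖v‖ * ‖v‖ := B.le_opNorm₂ v v
          _ ≤ R * ‖v‖ * ‖v‖ := by gcongr
          _ = _ := by ring
      rw [abs_le] at *
      norm_num at h1
      constructor <;> linarith
    · obtain ⟨j, hj⟩ := exists_nat_one_div_lt (half_pos he)
      refine ⟨1 / ((m j : ℝ) + 1), by positivity, fun x hx v hv => ?_⟩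
      obtain ⟨B, -, h1, h2⟩ := hcmp x hx j v
      have h3 := h2 hv.le
      have h4 : 1 / ((j : ℝ) + 1) * ‖v‖ ^ 2 ≤ e / 2 * ‖v‖ ^ 2 := by gcongr
      rw [abs_le] at *
      constructor <;> linarith

end Uniformization

section Mollifier

variable {E : Type} [NormedAddCommGroup E] [InnerProductSpace ℝ E] [FiniteDimensional ℝ E]
variable [MeasurableSpace E] [BorelSpace E] (μ : Measure E) [μ.IsAddHaarMeasure]

/-- Derivatives of the convolution of a bounded function with a test function. -/
lemma norm_iteratedFDeriv_convolution_le {u : E → ℝ} {B : ℝ} (hB : ∀ x, |u x| ≤ B)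
    (hu : LocallyIntegrable u μ) (k : ℕ) : ∀ {F G : Type} [NormedAddCommGroup F] [NormedSpace ℝ F]
    [NormedAddCommGroup G] [NormedSpace ℝ G] [CompleteSpace G] (L : ℝ →L[ℝ] F →L[ℝ] G)
    (_ : ∀ a w, ‖L a w‖ ≤ |a| * ‖w‖) {ψ : E → F} (_ : ContDiff ℝ ∞ ψ) (_ : HasCompactSupport ψ)
    (x : E), ‖iteratedFDeriv ℝ k (u ⋆[L, μ] ψ) x‖ ≤ B * ∫ z, ‖iteratedFDeriv ℝ k ψ z‖ ∂μ := by
  induction k with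
  | zero =>
    intro F G _ _ _ _ _ L hL ψ hψ hc x
    simp only [norm_iteratedFDeriv_zero]
    have hbound : Integrable (fun t => B * ‖ψ (x - t)‖) μ := by
      have : Integrable ψ μ := hψ.continuous.integrable_of_hasCompactSupport hc
      exact ((this.norm).comp_sub_left x).const_mul B
    calc _ ≤ ∫ t, B * ‖ψ (x - t)‖ ∂μ := by
          refine norm_integral_le_of_norm_le hbound (Eventually.of_forall fun t => ?_)
          refine (hL _ _).trans ?_
          gcongr
          exact hB t
      _ = _ := by rw [integral_const_mul, integral_sub_left_eq_self (fun z => ‖ψ z‖)]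
  | succ k ih =>
    intro F G _ _ _ _ _ L hL ψ hψ hc x
    have hder : fderiv ℝ (u ⋆[L, μ] ψ) = (u ⋆[L.precompR E, μ] fderiv ℝ ψ) := by
      ext1 y
      exact (hc.hasFDerivAt_convolution_right L hu (hψ.of_le (by simp)) y).fderiv
    rw [← norm_iteratedFDeriv_fderiv, hder]
    refine (ih (L.precompR E) ?_ (hψ.fderiv_right (by simp)) (hc.fderiv ℝ) x).trans_eq ?_
    · intro a w
      refine ContinuousLinearMap.opNorm_le_bound _ (by positivity) fun v => ?_
      calc _ ≤ |a| * ‖w v‖ := hL a (w v)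
        _ ≤ |a| * (‖w‖ * ‖v‖) := by gcongr; exact w.le_opNorm v
        _ = _ := by ring
    · simp only [norm_iteratedFDeriv_fderiv]

/-- A smooth, even, nonnegative kernel of integral one, supported in the ball of radius `1/2`. -/
noncomputable def mollKernel : E → ℝ :=
  (⟨1 / 4, 1 / 2, by norm_num, by norm_num⟩ : ContDiffBump (0 : E)).normed μ

omit [BorelSpace E] [μ.IsAddHaarMeasure] in
lemma contDiff_mollKernel : ContDiff ℝ ∞ (mollKernel μ) := ContDiffBump.contDiff_normed _

omit [BorelSpace E] [μ.IsAddHaarMeasure] in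
lemma mollKernel_nonneg (z : E) : 0 ≤ mollKernel μ z := ContDiffBump.nonneg_normed _ _

lemma integral_mollKernel : ∫ z, mollKernel μ z ∂μ = 1 := ContDiffBump.integral_normed _

omit [BorelSpace E] [μ.IsAddHaarMeasure] in
lemma mollKernel_neg (z : E) : mollKernel μ (-z) = mollKernel μ z := ContDiffBump.normed_neg _ _

lemma hasCompactSupport_mollKernel : HasCompactSupport (mollKernel μ) :=
  ContDiffBump.hasCompactSupport_normed _

lemma norm_lt_of_mollKernel_ne_zero {z : E} (hz : mollKernel μ z ≠ 0) : ‖z‖ < 1 / 2 := by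
  have : z ∈ Function.support (mollKernel μ) := hz
  rw [mollKernel, ContDiffBump.support_normed_eq] at this
  simpa using this

lemma integrable_mollKernel_mul {u : E → ℝ} (hu : Continuous u) :
    Integrable (fun z => mollKernel μ z * u z) μ :=
  ((contDiff_mollKernel μ).continuous.mul hu).integrable_of_hasCompactSupport
    (hasCompactSupport_mollKernel μ).mul_right

lemma integrable_mollKernel : Integrable (mollKernel μ) μ :=
  (contDiff_mollKernel μ).continuous.integrable_of_hasCompactSupport
    (hasCompactSupport_mollKernel μ)

/-- The mollification of `u` at scale `s`. -/
noncomputable def moll (s : ℝ) (u : E → ℝ) (y : E) : ℝ :=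
  ∫ z, mollKernel μ z * u (y - s • z) ∂μ

lemma integrable_moll {u : E → ℝ} (hu : Continuous u) (s : ℝ) (y : E) :
    Integrable (fun z => mollKernel μ z * u (y - s • z)) μ :=
  integrable_mollKernel_mul μ (hu.comp (continuous_const.sub (continuous_id.const_smul s)))

lemma moll_sub {u v : E → ℝ} (hu : Continuous u) (hv : Continuous v) (s : ℝ) (y : E) :
    moll μ s (fun x => u x - v x) y = moll μ s u y - moll μ s v y := by
  simp only [moll, mul_sub]
  exact integral_sub (integrable_moll μ hu s y) (integrable_moll μ hv s y)

lemma moll_congr {u v : E → ℝ} {s : ℝ} (hs : 0 < s) {y : E}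
    (h : ∀ y', ‖y' - y‖ < s / 2 → u y' = v y') : moll μ s u y = moll μ s v y := by
  refine integral_congr_ae (Eventually.of_forall fun z => ?_)
  by_cases hz : mollKernel μ z = 0
  · simp [hz]
  · have hz := norm_lt_of_mollKernel_ne_zero μ hz
    simp only
    rw [h]
    rw [sub_sub_cancel_left, norm_neg, norm_smul, Real.norm_of_nonneg hs.le]
    nlinarith

lemma abs_moll_sub_le {u : E → ℝ} (hu : Continuous u) {s : ℝ} (hs : 0 < s) {y : E} {c e : ℝ}
    (h : ∀ y', ‖y' - y‖ < s / 2 → |u y' - c| ≤ e) : |moll μ s u y - c| ≤ e := by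
  have h1 : moll μ s u y - c = ∫ z, mollKernel μ z * (u (y - s • z) - c) ∂μ := by
    have : c = ∫ z, mollKernel μ z * c ∂μ := by
      rw [integral_mul_const, integral_mollKernel, one_mul]
    simp only [moll, mul_sub]
    rw [integral_sub (integrable_moll μ hu s y) ((integrable_mollKernel μ).mul_const c), ← this]
  rw [h1]
  have h2 : ∫ z, mollKernel μ z * e ∂μ = e := by
    rw [integral_mul_const, integral_mollKernel, one_mul]
  rw [← h2, ← Real.norm_eq_abs]
  refine norm_integral_le_of_norm_le ((integrable_mollKernel μ).mul_const e)
    (Eventually.of_forall fun z => ?_)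
  rw [norm_mul, Real.norm_of_nonneg (mollKernel_nonneg μ z)]
  by_cases hz : mollKernel μ z = 0
  · simp [hz]
  · have hz := norm_lt_of_mollKernel_ne_zero μ hz
    refine mul_le_mul_of_nonneg_left (h _ ?_) (mollKernel_nonneg μ z)
    rw [sub_sub_cancel_left, norm_neg, norm_smul, Real.norm_of_nonneg hs.le]
    nlinarith

/-- The rescaled kernel. -/
noncomputable def scaledKernel (s : ℝ) (z : E) : ℝ :=
  (s ^ Module.finrank ℝ E)⁻¹ * mollKernel μ (s⁻¹ • z)

lemma moll_eq_convolution {s : ℝ} (hs : 0 < s) (u : E → ℝ) :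
    moll μ s u = u ⋆[ContinuousLinearMap.lsmul ℝ ℝ, μ] scaledKernel μ s := by
  ext y
  have h1 := Measure.integral_comp_smul_of_nonneg μ
    (fun w => mollKernel μ (s⁻¹ • w) * u (y - w)) s (hR := hs.le)
  simp only [inv_smul_smul₀ hs.ne'] at h1
  rw [moll, h1, convolution_def, ← integral_sub_left_eq_self _ μ y, smul_eq_mul,
    ← integral_const_mul]
  congr 1 with w
  simp only [scaledKernel, ContinuousLinearMap.lsmul_apply, smul_eq_mul, sub_sub_cancel]
  ring

omit [BorelSpace E] [μ.IsAddHaarMeasure] in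
lemma contDiff_scaledKernel (s : ℝ) : ContDiff ℝ ∞ (scaledKernel μ s) :=
  contDiff_const.mul ((contDiff_mollKernel μ).comp (contDiff_const_smul _))

lemma hasCompactSupport_scaledKernel {s : ℝ} (hs : 0 < s) :
    HasCompactSupport (scaledKernel μ s) :=
  HasCompactSupport.mul_left
    ((hasCompactSupport_mollKernel μ).comp_smul (inv_ne_zero hs.ne'))

lemma contDiff_moll {u : E → ℝ} (hu : Continuous u) {s : ℝ} (hs : 0 < s) :
    ContDiff ℝ ∞ (moll μ s u) := by
  rw [moll_eq_convolution μ hs]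
  exact (hasCompactSupport_scaledKernel μ hs).contDiff_convolution_right _
    hu.locallyIntegrable (contDiff_scaledKernel μ s)

lemma integral_norm_iteratedFDeriv_scaledKernel {s : ℝ} (hs : 0 < s) (k : ℕ) :
    ∫ z, ‖iteratedFDeriv ℝ k (scaledKernel μ s) z‖ ∂μ =
      (s ^ k)⁻¹ * ∫ z, ‖iteratedFDeriv ℝ k (mollKernel μ) z‖ ∂μ := by
  have h : ∀ z, ‖iteratedFDeriv ℝ k (scaledKernel μ s) z‖ =
      (s ^ Module.finrank ℝ E)⁻¹ * ((s ^ k)⁻¹ * ‖iteratedFDeriv ℝ k (mollKernel μ) (s⁻¹ • z)‖) := by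
    intro z
    have h1 : ContDiff ℝ k fun z : E => mollKernel μ (s⁻¹ • z) :=
      ((contDiff_mollKernel μ).comp (contDiff_const_smul _)).of_le (by exact_mod_cast le_top)
    have h2 := iteratedFDeriv_const_smul_apply' (a := (s ^ Module.finrank ℝ E)⁻¹)
      (h1.contDiffAt (x := z))
    simp only [smul_eq_mul] at h2
    have h3 := iteratedFDeriv_comp_const_smul (𝕜 := ℝ) (i := k) s⁻¹
      ((contDiff_mollKernel μ).of_le (by exact_mod_cast le_top))
    unfold scaledKernel
    rw [h2, h3]
    simp only [norm_smul]
    rw [Real.norm_of_nonneg (by positivity), Real.norm_of_nonneg (by positivity), inv_pow]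
  simp only [h]
  rw [integral_const_mul, integral_const_mul,
    Measure.integral_comp_inv_smul_of_nonneg μ (fun z => ‖iteratedFDeriv ℝ k (mollKernel μ) z‖)
      hs.le, smul_eq_mul]
  field_simp

/-- Derivative bounds for mollifications. -/
lemma exists_norm_iteratedFDeriv_moll_le (k : ℕ) : ∃ C : ℝ, 0 ≤ C ∧ ∀ (u : E → ℝ), Continuous u →
    ∀ s > 0, ∀ y B, (∀ y', ‖y' - y‖ < s → |u y'| ≤ B) →
      ‖iteratedFDeriv ℝ k (moll μ s u) y‖ ≤ C * B * (s ^ k)⁻¹ := by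
  refine ⟨∫ z, ‖iteratedFDeriv ℝ k (mollKernel μ) z‖ ∂μ,
    integral_nonneg fun _ => norm_nonneg _, fun u hu s hs y B hB => ?_⟩
  have hB0 : 0 ≤ B := (abs_nonneg _).trans (hB y (by simpa using hs))
  set u' : E → ℝ := (ball y s).indicator u with hu'
  have hu'B : ∀ x, |u' x| ≤ B := by
    intro x
    by_cases hx : x ∈ ball y s
    · rw [hu', indicator_of_mem hx]; exact hB x (by rwa [mem_ball, dist_eq_norm] at hx)
    · rw [hu', indicator_of_notMem hx]; simpa
  have hu'L : LocallyIntegrable u' μ := (hu.locallyIntegrable).indicator measurableSet_ball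
  have heq : moll μ s u =ᶠ[𝓝 y] u' ⋆[ContinuousLinearMap.lsmul ℝ ℝ, μ] scaledKernel μ s := by
    rw [← moll_eq_convolution μ hs]
    filter_upwards [ball_mem_nhds y (half_pos hs)] with x hx
    refine moll_congr μ hs fun y' hy' => ?_
    rw [hu', indicator_of_mem]
    rw [mem_ball] at *
    rw [← dist_eq_norm] at hy'
    linarith [dist_triangle y' x y]
  rw [(heq.iteratedFDeriv ℝ k).eq_of_nhds]
  refine (norm_iteratedFDeriv_convolution_le μ hu'B hu'L k _ ?_ (contDiff_scaledKernel μ s)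
    (hasCompactSupport_scaledKernel μ hs) y).trans_eq ?_
  · intro a w
    simp
  · rw [integral_norm_iteratedFDeriv_scaledKernel μ hs]; ring

/-- Mollification shifts quadratic polynomials by a small constant. -/
lemma exists_moll_quadratic_eq (a : ℝ) (p : E →L[ℝ] ℝ) (A : E →L[ℝ] E →L[ℝ] ℝ) {R : ℝ}
    (hR0 : 0 ≤ R) (hR : ∀ v, |A v v| ≤ R * ‖v‖ ^ 2) (x : E) (s : ℝ) : ∃ c, |c| ≤ s ^ 2 * R ∧ ∀ y,
      moll μ s (fun y => a + p (y - x) + 1 / 2 * A (y - x) (y - x)) y =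
        a + p (y - x) + 1 / 2 * A (y - x) (y - x) + c := by
  have hAc : Continuous fun z => 1 / 2 * A z z := by fun_prop
  refine ⟨s ^ 2 * ∫ z, mollKernel μ z * (1 / 2 * A z z) ∂μ, ?_, fun y => ?_⟩
  · rw [abs_mul, abs_of_nonneg (sq_nonneg s)]
    refine mul_le_mul_of_nonneg_left ?_ (sq_nonneg s)
    have h2 : ∫ z, mollKernel μ z * R ∂μ = R := by
      rw [integral_mul_const, integral_mollKernel, one_mul]
    rw [← h2, ← Real.norm_eq_abs]
    refine norm_integral_le_of_norm_le ((integrable_mollKernel μ).mul_const R)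
      (Eventually.of_forall fun z => ?_)
    rw [norm_mul, Real.norm_of_nonneg (mollKernel_nonneg μ z)]
    by_cases hz : mollKernel μ z = 0
    · simp [hz]
    · have hz := norm_lt_of_mollKernel_ne_zero μ hz
      refine mul_le_mul_of_nonneg_left ?_ (mollKernel_nonneg μ z)
      rw [norm_mul, Real.norm_eq_abs, Real.norm_eq_abs]
      norm_num
      have h4 : ‖z‖ ^ 2 ≤ 1 := by nlinarith [norm_nonneg z]
      nlinarith [hR z]
  · set l : E →L[ℝ] ℝ := p + (1 / 2 : ℝ) • A (y - x) + (1 / 2 : ℝ) • A.flip (y - x) with hl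
    have hlc : Continuous fun z => l z := l.continuous
    have hodd : ∫ z, mollKernel μ z * l z ∂μ = 0 := by
      have h := integral_neg_eq_self (fun z => mollKernel μ z * l z) μ
      simp only [mollKernel_neg, map_neg, mul_neg, integral_neg] at h
      linarith
    have hpt : ∀ z, mollKernel μ z * (a + p (y - s • z - x) +
        1 / 2 * A (y - s • z - x) (y - s • z - x)) =
        mollKernel μ z * (a + p (y - x) + 1 / 2 * A (y - x) (y - x)) -
          s * (mollKernel μ z * l z) + s ^ 2 * (mollKernel μ z * (1 / 2 * A z z)) := by
      intro z
      have : y - s • z - x = (y - x) - s • z := by abel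
      rw [this, hl]
      simp only [map_sub, map_smul, add_apply, sub_apply, smul_apply, smul_eq_mul,
        ContinuousLinearMap.flip_apply]
      ring
    have i1 := integrable_mollKernel_mul μ hlc
    have i2 := integrable_mollKernel_mul μ hAc
    have i3 := (integrable_mollKernel μ).mul_const
      (a + p (y - x) + 1 / 2 * A (y - x) (y - x))
    simp only [moll, hpt]
    refine (integral_add (i3.sub (i1.const_mul s)) (i2.const_mul (s ^ 2))).trans ?_
    rw [integral_sub' i3 (i1.const_mul s), integral_const_mul, integral_const_mul, hodd, integral_mul_const, integral_mollKernel]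
    ring

/-- Joint smoothness of mollifications in the scale and the point. -/
lemma contDiffOn_moll_uncurry {u : E → ℝ} (hu : Continuous u) :
    ContDiffOn ℝ ∞ (fun q : ℝ × E => moll μ q.1 u q.2) (Ioi 0 ×ˢ univ) := by
  rintro ⟨s, y⟩ ⟨hs, -⟩
  rw [mem_Ioi] at hs
  have hopen : IsOpen (Ioo (0 : ℝ) (2 * s)) := isOpen_Ioo
  have hk : IsCompact (closedBall (0 : E) (2 * s)) := isCompact_closedBall _ _
  have h := contDiffOn_convolution_right_with_param (μ := μ) (n := ⊤) (f := u)
    (ContinuousLinearMap.lsmul ℝ ℝ) (g := scaledKernel μ) hopen hk ?_ hu.locallyIntegrable ?_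
  · have h2 : ContDiffOn ℝ ∞ (fun q : ℝ × E => moll μ q.1 u q.2) (Ioo 0 (2 * s) ×ˢ univ) :=
      h.congr fun q hq => by rw [moll_eq_convolution μ hq.1.1]
    refine (h2.contDiffAt ((hopen.prod isOpen_univ).mem_nhds ?_)).contDiffWithinAt
    exact ⟨⟨hs, by simp only; linarith⟩, mem_univ _⟩
  · intro t z ht hz
    rw [scaledKernel]
    by_contra hne
    have := norm_lt_of_mollKernel_ne_zero μ (right_ne_zero_of_mul hne)
    rw [norm_smul, norm_inv, Real.norm_of_nonneg ht.1.le, inv_mul_lt_iff₀ ht.1] at this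
    rw [mem_closedBall_zero_iff] at hz
    linarith [ht.2, ht.1]
  · have h1 : ContDiffOn ℝ ∞ (fun q : ℝ × E => q.1⁻¹) (Ioo 0 (2 * s) ×ˢ univ) :=
      contDiff_fst.contDiffOn.inv fun q hq => hq.1.1.ne'
    have h2 : ContDiffOn ℝ ∞ (fun q : ℝ × E => (q.1 ^ Module.finrank ℝ E)⁻¹)
        (Ioo 0 (2 * s) ×ˢ univ) :=
      (contDiff_fst.pow _).contDiffOn.inv fun q hq => (pow_pos hq.1.1 _).ne'
    exact h2.mul ((contDiff_mollKernel μ).comp_contDiffOn (h1.smul contDiff_snd.contDiffOn))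

end Mollifier

section JetBound

variable {E : Type} [NormedAddCommGroup E] [NormedSpace ℝ E]

/-- The derivatives of `u` at `y` up to order two are bounded by `b` at scale `r`. -/
def JetBound (u : E → ℝ) (y : E) (r b : ℝ) : Prop :=
  ∀ k ≤ 2, ‖iteratedFDeriv ℝ k u y‖ * r ^ k ≤ b

lemma JetBound.nonneg {u : E → ℝ} {y : E} {r b : ℝ} (h : JetBound u y r b) : 0 ≤ b :=
  le_trans (by simp) (h 0 (by norm_num))

lemma JetBound.mono {u : E → ℝ} {y : E} {r b b' : ℝ} (h : JetBound u y r b) (hb : b ≤ b') :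
    JetBound u y r b' := fun k hk => (h k hk).trans hb

lemma JetBound.congr {u v : E → ℝ} {y : E} {r b : ℝ} (h : JetBound u y r b) (huv : v =ᶠ[𝓝 y] u) :
    JetBound v y r b := fun k hk => by
  rw [(huv.iteratedFDeriv ℝ k).eq_of_nhds]; exact h k hk

lemma JetBound.add {u v : E → ℝ} {y : E} {r a b : ℝ} (hr : 0 ≤ r) (hu : ContDiff ℝ 2 u)
    (hv : ContDiff ℝ 2 v) (h : JetBound u y r a) (h' : JetBound v y r b) :
    JetBound (fun x => u x + v x) y r (a + b) := fun k hk => by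
  have hk' : (k : ℕ∞ω) ≤ 2 := by exact_mod_cast hk
  rw [fun_iteratedFDeriv_add_apply (hu.contDiffAt.of_le hk') (hv.contDiffAt.of_le hk')]
  calc _ ≤ (‖iteratedFDeriv ℝ k u y‖ + ‖iteratedFDeriv ℝ k v y‖) * r ^ k := by
        gcongr; exact norm_add_le _ _
    _ = _ := add_mul _ _ _
    _ ≤ _ := add_le_add (h k hk) (h' k hk)

lemma JetBound.sub {u v : E → ℝ} {y : E} {r a b : ℝ} (hr : 0 ≤ r) (hu : ContDiff ℝ 2 u)
    (hv : ContDiff ℝ 2 v) (h : JetBound u y r a) (h' : JetBound v y r b) :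
    JetBound (fun x => u x - v x) y r (a + b) := fun k hk => by
  have hk' : (k : ℕ∞ω) ≤ 2 := by exact_mod_cast hk
  rw [fun_iteratedFDeriv_sub_apply (hu.contDiffAt.of_le hk') (hv.contDiffAt.of_le hk')]
  calc _ ≤ (‖iteratedFDeriv ℝ k u y‖ + ‖iteratedFDeriv ℝ k v y‖) * r ^ k := by
        gcongr; exact norm_sub_le _ _
    _ = _ := add_mul _ _ _
    _ ≤ _ := add_le_add (h k hk) (h' k hk)

lemma JetBound.mul {u v : E → ℝ} {y : E} {r a b : ℝ} (hr : 0 ≤ r) (hu : ContDiff ℝ 2 u)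
    (hv : ContDiff ℝ 2 v) (h : JetBound u y r a) (h' : JetBound v y r b) :
    JetBound (fun x => u x * v x) y r (4 * (a * b)) := fun k hk => by
  have hk' : (k : ℕ∞ω) ≤ 2 := by exact_mod_cast hk
  have ha := h.nonneg
  have hb := h'.nonneg
  have h0 := norm_iteratedFDeriv_mul_le hu hv y hk'
  calc _ ≤ (∑ i ∈ Finset.range (k + 1), (k.choose i : ℝ) * ‖iteratedFDeriv ℝ i u y‖ *
        ‖iteratedFDeriv ℝ (k - i) v y‖) * r ^ k := by gcongr
    _ = ∑ i ∈ Finset.range (k + 1), (k.choose i : ℝ) * ((‖iteratedFDeriv ℝ i u y‖ * r ^ i) *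
        (‖iteratedFDeriv ℝ (k - i) v y‖ * r ^ (k - i))) := by
      rw [Finset.sum_mul]
      refine Finset.sum_congr rfl fun i hi => ?_
      have hi' : i ≤ k := by simpa [Nat.lt_succ_iff] using hi
      rw [show r ^ k = r ^ i * r ^ (k - i) by rw [← pow_add]; congr 1; omega]
      ring
    _ ≤ ∑ i ∈ Finset.range (k + 1), (k.choose i : ℝ) * (a * b) := by
      refine Finset.sum_le_sum fun i hi => ?_
      have hi' : i ≤ k := by simpa [Nat.lt_succ_iff] using hi
      gcongr
      · exact h i (by omega)
      · exact h' (k - i) (by omega)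
    _ = 2 ^ k * (a * b) := by
      rw [← Finset.sum_mul, ← Nat.cast_sum, Nat.sum_range_choose]; push_cast; ring
    _ ≤ _ := by
      have : (2 : ℝ) ^ k ≤ 2 ^ 2 := pow_le_pow_right₀ (by norm_num) hk
      nlinarith [mul_nonneg ha hb]

/-- Change of scale in a jet bound, from a half scale. -/
lemma JetBound.of_half {u : E → ℝ} {y : E} {r b : ℝ} (h : JetBound u y (r / 2) b) :
    JetBound u y r (4 * b) := fun k hk => by
  have := h k hk
  have hb := h.nonneg
  have h2 : (2 : ℝ) ^ k ≤ 2 ^ 2 := pow_le_pow_right₀ (by norm_num) hk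
  rw [div_pow, mul_div_assoc', div_le_iff₀ (by positivity)] at this
  nlinarith

lemma JetBound.norm_le {u : E → ℝ} {y : E} {r b : ℝ} (hr : 0 < r) (hr1 : r ≤ 1)
    (h : JetBound u y r (b * r ^ 2)) (hb : 0 ≤ b) {k : ℕ} (hk : k ≤ 2) :
    ‖iteratedFDeriv ℝ k u y‖ ≤ b := by
  have h1 := h k hk
  have h2 : r ^ 2 ≤ r ^ k := pow_le_pow_of_le_one hr.le hr1 hk
  have h3 : b * r ^ 2 ≤ b * r ^ k := by gcongr
  exact le_of_mul_le_mul_right (h1.trans h3) (by positivity)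

/-- A sequence which is Cauchy in `C²` converges in `C²`. -/
lemma exists_contDiff_two_limit {G : ℕ → E → ℝ} (hG : ∀ n, ContDiff ℝ 2 (G n)) {κ : ℕ → ℝ}
    (hκ : Tendsto κ atTop (𝓝 0))
    (hbd : ∀ N M, N ≤ M → ∀ k ≤ 2, ∀ y,
      ‖iteratedFDeriv ℝ k (fun x => G M x - G N x) y‖ ≤ κ N) :
    ∃ h : E → ℝ, ContDiff ℝ 2 h ∧ (∀ y, Tendsto (fun n => G n y) atTop (𝓝 (h y))) ∧
      ∀ k ≤ 2, ∀ y, ‖iteratedFDeriv ℝ k (fun x => h x - G 0 x) y‖ ≤ κ 0 := by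
  have hev : ∀ j : ℕ, ∀ᶠ n in atTop, κ n ≤ (1 / 2 : ℝ) ^ j := fun j =>
    (hκ.eventually_lt_const (by positivity)).mono fun n hn => hn.le
  obtain ⟨φ, hφ, hφκ⟩ := extraction_forall_of_eventually hev
  let ψ : ℕ → ℕ := fun j => Nat.casesOn j 0 φ
  have hψ0 : ψ 0 = 0 := rfl
  have hψs : ∀ j, ψ (j + 1) = φ j := fun j => rfl
  have hψm : ∀ j, ψ j ≤ ψ (j + 1) := by
    intro j
    cases j with
    | zero => exact Nat.zero_le _
    | succ j => exact (hφ (Nat.lt_succ_self j)).le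
  have hψmono : Monotone ψ := monotone_nat_of_le_succ hψm
  have hψt : Tendsto ψ atTop atTop := by
    rw [← tendsto_add_atTop_iff_nat 1]
    exact hφ.tendsto_atTop
  set u : ℕ → E → ℝ := fun j x => G (ψ (j + 1)) x - G (ψ j) x with hu
  have hu2 : ∀ j, ContDiff ℝ 2 (u j) := fun j => (hG _).sub (hG _)
  have hubd : ∀ (k j : ℕ) (x : E), ((k : ℕ∞)) ≤ (2 : ℕ∞) →
      ‖iteratedFDeriv ℝ k (u j) x‖ ≤ (fun (_ : ℕ) j => κ (ψ j)) k j := fun k j x hk =>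
    hbd _ _ (hψm j) k (by exact_mod_cast hk) x
  have hsum : Summable fun j => κ (ψ j) := by
    rw [← summable_nat_add_iff 1]
    refine Summable.of_norm_bounded (g := fun j : ℕ => (1 / 2 : ℝ) ^ j)
      (summable_geometric_of_lt_one (by norm_num) (by norm_num)) fun j => ?_
    rw [hψs, Real.norm_of_nonneg ((norm_nonneg _).trans (hbd _ _ le_rfl 0 (by norm_num) 0))]
    exact hφκ j
  have hv : ∀ k : ℕ, ((k : ℕ∞)) ≤ (2 : ℕ∞) → Summable ((fun (_ : ℕ) j => κ (ψ j)) k) :=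
    fun _ _ => hsum
  have htele : ∀ m x, ∑ j ∈ Finset.range m, u j x = G (ψ m) x - G 0 x := fun m x => by
    rw [Finset.sum_range_sub (fun j => G (ψ j) x), hψ0]
  have hw2 : ContDiff ℝ 2 fun x => ∑' j, u j x := contDiff_tsum (N := 2) hu2 hv hubd
  refine ⟨fun x => G 0 x + ∑' j, u j x, (hG 0).add hw2, fun y => ?_, fun k hk y => ?_⟩
  · have hsy : Summable fun j => u j y := by
      refine Summable.of_norm_bounded hsum fun j => ?_
      have := hubd 0 j y (by simp)
      rwa [norm_iteratedFDeriv_zero] at this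
    have h1 : Tendsto (fun m => G (ψ m) y) atTop (𝓝 (G 0 y + ∑' j, u j y)) := by
      have := (hsy.hasSum.tendsto_sum_nat).const_add (G 0 y)
      simpa only [htele, add_sub_cancel] using this
    have h2 : Tendsto (fun m => κ (ψ m)) atTop (𝓝 0) := hκ.comp hψt
    rw [Metric.tendsto_atTop] at h1 ⊢
    intro e he
    obtain ⟨m₁, hm₁⟩ := h1 (e / 3) (by positivity)
    obtain ⟨m₂, hm₂⟩ := (h2.eventually_lt_const (show (0 : ℝ) < e / 3 by positivity)).exists_forall_of_atTop
    set m := max m₁ m₂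
    refine ⟨ψ m, fun n hn => ?_⟩
    have h3 := hbd _ _ hn 0 (by norm_num) y
    rw [norm_iteratedFDeriv_zero] at h3
    have h4 := hm₁ m (le_max_left _ _)
    have h5 := hm₂ m (le_max_right _ _)
    calc _ ≤ dist (G n y) (G (ψ m) y) + dist (G (ψ m) y) _ := dist_triangle _ _ _
      _ < e / 3 + e / 3 := by
        gcongr
        exact lt_of_le_of_lt (by rwa [dist_eq_norm]) h5
      _ ≤ e := by linarith
  · simp only [add_sub_cancel_left]
    have hk' : ((k : ℕ∞)) ≤ (2 : ℕ∞) := by exact_mod_cast hk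
    rw [iteratedFDeriv_tsum_apply (N := 2) hu2 hv hubd hk']
    have hsk : Summable fun j => iteratedFDeriv ℝ k (u j) y :=
      Summable.of_norm_bounded hsum fun j => hubd k j y hk'
    refine le_of_tendsto (hsk.hasSum.tendsto_sum_nat.norm) (Eventually.of_forall fun m => ?_)
    have h1 : ∑ j ∈ Finset.range m, iteratedFDeriv ℝ k (u j) y =
        iteratedFDeriv ℝ k (fun x => G (ψ m) x - G 0 x) y := by
      have : (fun x => G (ψ m) x - G 0 x) = ∑ j ∈ Finset.range m, u j := by
        ext x; rw [Finset.sum_apply, htele]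
      rw [this, iteratedFDeriv_sum_apply fun j _ =>
        (hu2 j).contDiffAt.of_le (by exact_mod_cast hk)]
    rw [h1]
    exact hbd 0 _ (Nat.zero_le _) k hk y

end JetBound

lemma exists_antitone_scale {P : ℝ → ℝ → Prop}
    (hP : ∀ κ r κ' r', 0 < κ → κ ≤ κ' → r' ≤ r → P κ r → P κ' r')
    (hex : ∀ κ > 0, ∃ δ > 0, P κ δ) {σ ρ : ℝ} (hσ : 0 < σ) (hρ : 0 < ρ) :
    ∃ r, 0 < r ∧ r < ρ ∧ ∃ κ : ℕ → ℝ, Antitone κ ∧ Tendsto κ atTop (𝓝 0) ∧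
      (∀ N, 0 < κ N) ∧ (∀ N, κ N ≤ σ) ∧ ∀ N, P (κ N) (r * (1 / 2) ^ N) := by
  obtain ⟨δ, hδ, hPδ⟩ := hex (σ / 2) (by positivity)
  set r := min δ (ρ / 2) with hr
  have hr0 : 0 < r := lt_min hδ (by positivity)
  have hrN : Antitone fun N : ℕ => r * (1 / 2 : ℝ) ^ N := fun N M h => by
    have := pow_le_pow_of_le_one (by norm_num : (0 : ℝ) ≤ 1 / 2) (by norm_num) h
    simp only; gcongr
  have hrt : Tendsto (fun N : ℕ => r * (1 / 2 : ℝ) ^ N) atTop (𝓝 0) := by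
    simpa using (tendsto_pow_atTop_nhds_zero_of_lt_one (by norm_num : (0 : ℝ) ≤ 1 / 2)
      (by norm_num)).const_mul r
  let S : ℕ → Set ℝ := fun N => {κ | 0 < κ ∧ P κ (r * (1 / 2) ^ N)}
  have hSb : ∀ N, BddBelow (S N) := fun N => ⟨0, fun κ hκ => hκ.1.le⟩
  have hS0 : σ / 2 ∈ S 0 := ⟨by positivity, hP _ _ _ _ (by positivity) le_rfl
    (by simp [hr]) hPδ⟩
  have hSm : ∀ N M, N ≤ M → S N ⊆ S M := fun N M h κ hκ =>
    ⟨hκ.1, hP _ _ _ _ hκ.1 le_rfl (hrN h) hκ.2⟩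
  have hSn : ∀ N, σ / 2 ∈ S N := fun N => hSm 0 N (Nat.zero_le _) hS0
  have hinf0 : ∀ N, 0 ≤ sInf (S N) := fun N => le_csInf ⟨_, hSn N⟩ fun κ hκ => hκ.1.le
  have hinft : Tendsto (fun N => sInf (S N)) atTop (𝓝 0) := by
    rw [Metric.tendsto_atTop]
    intro e he
    obtain ⟨d, hd, hPd⟩ := hex (e / 2) (by positivity)
    obtain ⟨N, hN⟩ := (hrt.eventually_lt_const hd).exists
    refine ⟨N, fun M hM => ?_⟩
    have h1 : e / 2 ∈ S M := ⟨by positivity, hP _ _ _ _ (by positivity) le_rfl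
      ((hrN hM).trans hN.le) hPd⟩
    rw [Real.dist_eq, sub_zero, abs_of_nonneg (hinf0 M)]
    linarith [csInf_le (hSb M) h1]
  have hpt : Tendsto (fun N : ℕ => σ / 2 * (1 / 2 : ℝ) ^ N) atTop (𝓝 0) := by
    simpa using (tendsto_pow_atTop_nhds_zero_of_lt_one (by norm_num : (0 : ℝ) ≤ 1 / 2)
      (by norm_num)).const_mul (σ / 2)
  have hp0 : ∀ N : ℕ, 0 < σ / 2 * (1 / 2 : ℝ) ^ N := fun N => by positivity
  have hanti : Antitone fun N => sInf (S N) + σ / 2 * (1 / 2 : ℝ) ^ N := fun N M h => by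
    have h1 := pow_le_pow_of_le_one (by norm_num : (0 : ℝ) ≤ 1 / 2) (by norm_num) h
    have h2 := csInf_le_csInf (hSb M) ⟨_, hSn N⟩ (hSm N M h)
    simp only; gcongr
  refine ⟨r, hr0, lt_of_le_of_lt (min_le_right _ _) (by linarith),
    fun N => sInf (S N) + σ / 2 * (1 / 2) ^ N, hanti, ?_, ?_, ?_, ?_⟩
  · simpa using hinft.add hpt
  · exact fun N => add_pos_of_nonneg_of_pos (hinf0 N) (hp0 N)
  · intro N
    refine (hanti (Nat.zero_le N)).trans ?_
    have := csInf_le (hSb 0) hS0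
    simp only [pow_zero, mul_one]; linarith
  · intro N
    obtain ⟨κ, hκ, hlt⟩ := exists_lt_of_csInf_lt ⟨_, hSn N⟩
      (lt_add_of_pos_right (sInf (S N)) (hp0 N))
    exact hP _ _ _ _ hκ.1 hlt.le le_rfl hκ.2

lemma two_le_smooth : (2 : WithTop ℕ∞) ≤ ∞ := by
  exact WithTop.coe_le_coe.2 le_top

section Surgery

variable {E : Type} [NormedAddCommGroup E] [InnerProductSpace ℝ E] [FiniteDimensional ℝ E]
variable [MeasurableSpace E] [BorelSpace E] (μ : Measure E) [μ.IsAddHaarMeasure]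

/-- The quadratic polynomial with jet `(a, p, A)` at `x`. -/
noncomputable def quadPoly (x : E) (a : ℝ) (p : E →L[ℝ] ℝ) (A : E →L[ℝ] E →L[ℝ] ℝ) (y : E) : ℝ :=
  a + p (y - x) + 1 / 2 * A (y - x) (y - x)

omit [FiniteDimensional ℝ E] [MeasurableSpace E] [BorelSpace E] in
lemma contDiff_quadPoly (x : E) (a : ℝ) (p : E →L[ℝ] ℝ) (A : E →L[ℝ] E →L[ℝ] ℝ) :
    ContDiff ℝ ∞ (quadPoly x a p A) := by
  unfold quadPoly; fun_prop

lemma exists_norm_iteratedFDeriv_moll_le_two : ∃ C : ℝ, 0 ≤ C ∧ ∀ k ≤ 2, ∀ (u : E → ℝ),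
    Continuous u → ∀ s > 0, ∀ y B, (∀ y', ‖y' - y‖ < s → |u y'| ≤ B) →
      ‖iteratedFDeriv ℝ k (moll μ s u) y‖ ≤ C * B * (s ^ k)⁻¹ := by
  choose C hC0 hC using exists_norm_iteratedFDeriv_moll_le (E := E) μ
  refine ⟨C 0 + C 1 + C 2, by linarith [hC0 0, hC0 1, hC0 2], fun k hk u hu s hs y B hB => ?_⟩
  have hB0 : 0 ≤ B := (abs_nonneg _).trans (hB y (by simpa using hs))
  refine (hC k u hu s hs y B hB).trans ?_
  have : C k ≤ C 0 + C 1 + C 2 := by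
    interval_cases k <;> linarith [hC0 0, hC0 1, hC0 2]
  gcongr

lemma exists_jetBound_moll_sub_quadPoly : ∃ C : ℝ, 0 ≤ C ∧ ∀ (f : E → ℝ), Continuous f →
    ∀ (x : E) (p : E →L[ℝ] ℝ) (A : E →L[ℝ] E →L[ℝ] ℝ) (R : ℝ), 0 ≤ R →
    (∀ v, |A v v| ≤ R * ‖v‖ ^ 2) → ∀ r κ : ℝ, 0 < r → 0 < κ → κ ≤ 1 →
    (∀ v, ‖v‖ < 4 * r → |f (x + v) - f x - p v - 1 / 2 * A v v| ≤ κ ^ 4 * ‖v‖ ^ 2) →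
    ∀ y, ‖y - x‖ < 2 * r →
      JetBound (fun y => moll μ (κ * r) f y - quadPoly x (f x) p A y) y r
        ((C + R) * κ ^ 2 * r ^ 2) := by
  obtain ⟨C, hC0, hC⟩ := exists_norm_iteratedFDeriv_moll_le_two (E := E) μ
  refine ⟨9 * C, by positivity, fun f hf x p A R hR0 hR r κ hr hκ hκ1 hrem y hy => ?_⟩
  have hs : 0 < κ * r := by positivity
  obtain ⟨c, hc, hmq⟩ := exists_moll_quadratic_eq μ (f x) p A hR0 hR x (κ * r)
  have hqc := (contDiff_quadPoly x (f x) p A).continuous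
  have heq : (fun y => moll μ (κ * r) f y - quadPoly x (f x) p A y) =
      fun y => moll μ (κ * r) (fun z => f z - quadPoly x (f x) p A z) y + c := by
    funext z
    rw [moll_sub μ hf hqc]
    have : moll μ (κ * r) (quadPoly x (f x) p A) z = quadPoly x (f x) p A z + c := hmq z
    rw [this]; ring
  rw [heq]
  have hfq : Continuous fun z => f z - quadPoly x (f x) p A z := hf.sub hqc
  have h1 : JetBound (moll μ (κ * r) fun z => f z - quadPoly x (f x) p A z) y r
      (9 * C * κ ^ 2 * r ^ 2) := by
    intro k hk
    have hb := hC k hk _ hfq (κ * r) hs y (κ ^ 4 * (3 * r) ^ 2) fun y' hy' => by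
      have hκr : κ * r ≤ r := by nlinarith
      have h3 : ‖y' - x‖ < 3 * r := by
        calc ‖y' - x‖ = ‖(y' - y) + (y - x)‖ := by congr 1; abel
          _ ≤ _ := norm_add_le _ _
          _ < 3 * r := by linarith
      have := hrem (y' - x) (by linarith)
      rw [add_sub_cancel] at this
      rw [quadPoly, show f y' - (f x + p (y' - x) + 1 / 2 * A (y' - x) (y' - x)) =
        f y' - f x - p (y' - x) - 1 / 2 * A (y' - x) (y' - x) by ring]
      refine this.trans ?_
      gcongr
    calc _ ≤ C * (κ ^ 4 * (3 * r) ^ 2) * ((κ * r) ^ k)⁻¹ * r ^ k := by gcongr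
      _ = 9 * C * (κ ^ 4 * (κ ^ k)⁻¹) * r ^ 2 := by rw [mul_pow κ r k]; field_simp; ring
      _ ≤ 9 * C * κ ^ 2 * r ^ 2 := by
        have : κ ^ 4 * (κ ^ k)⁻¹ ≤ κ ^ 2 := by
          rw [mul_inv_le_iff₀ (by positivity)]
          have h2 : κ ^ 2 ≤ κ ^ k := pow_le_pow_of_le_one hκ.le hκ1 hk
          calc κ ^ 4 = κ ^ 2 * κ ^ 2 := by ring
            _ ≤ _ := by gcongr
        gcongr
  have h2 : JetBound (fun _ : E => c) y r (R * κ ^ 2 * r ^ 2) := by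
    intro k hk
    rcases Nat.eq_zero_or_pos k with rfl | hk0
    · rw [norm_iteratedFDeriv_zero, Real.norm_eq_abs]; simp only [pow_zero, mul_one]; nlinarith
    · rw [iteratedFDeriv_const_of_ne hk0.ne']; simp; positivity
  refine (h1.add hr.le ((contDiff_moll μ hfq hs).of_le two_le_smooth)
    contDiff_const h2).mono (le_of_eq (by ring))

lemma exists_jetBound_cutoff : ∃ C : ℝ, 0 ≤ C ∧ ∀ K : Set E, ∀ r > 0, ∃ ζ : E → ℝ,
    ContDiff ℝ ∞ ζ ∧ (∀ y, infDist y K < r / 2 → ζ y = 1) ∧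
    (∀ y, 3 / 4 * r < infDist y K → ζ y = 0) ∧ ∀ y, JetBound ζ y r C := by
  obtain ⟨C, hC0, hC⟩ := exists_norm_iteratedFDeriv_moll_le_two (E := E) Measure.addHaar
  refine ⟨256 * C, by positivity, fun K r hr => ?_⟩
  set u : E → ℝ := fun y => max 0 (min 1 ((11 / 16 * r - infDist y K) / (r / 8))) with hu
  have huc : Continuous u := by
    have := continuous_infDist_pt K
    fun_prop
  have hs : 0 < r / 16 := by positivity
  refine ⟨moll Measure.addHaar (r / 16) u, contDiff_moll Measure.addHaar huc hs, fun y hy => ?_, fun y hy => ?_,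
    fun y k hk => ?_⟩
  · have := abs_moll_sub_le Measure.addHaar huc hs (y := y) (c := 1) (e := 0) fun y' hy' => by
      have h1 := infDist_le_infDist_add_dist (x := y') (y := y) (s := K)
      rw [dist_eq_norm] at h1
      have h2 : 1 ≤ (11 / 16 * r - infDist y' K) / (r / 8) := by
        rw [le_div_iff₀ (by positivity)]; linarith
      simp only [hu]
      rw [min_eq_left h2]; simp
    linarith [abs_nonpos_iff.1 this]
  · have := abs_moll_sub_le Measure.addHaar huc hs (y := y) (c := 0) (e := 0) fun y' hy' => by
      have h1 := infDist_le_infDist_add_dist (x := y) (y := y') (s := K)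
      rw [dist_eq_norm, norm_sub_rev] at h1
      have h2 : (11 / 16 * r - infDist y' K) / (r / 8) ≤ 0 :=
        div_nonpos_of_nonpos_of_nonneg (by linarith) (by positivity)
      simp only [hu]
      rw [max_eq_left ((min_le_right _ _).trans h2)]; simp
    linarith [abs_nonpos_iff.1 this]
  · have hb := hC k hk u huc _ hs y 1 fun y' _ => by
      rw [abs_of_nonneg (le_max_left _ _)]
      exact max_le zero_le_one (min_le_left _ _)
    calc _ ≤ C * 1 * ((r / 16) ^ k)⁻¹ * r ^ k := by gcongr
      _ = C * 16 ^ k := by rw [div_pow]; field_simp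
      _ ≤ C * 16 ^ 2 := by gcongr; norm_num
      _ = _ := by ring

end Surgery

section Surgery

variable {E : Type} [NormedAddCommGroup E] [InnerProductSpace ℝ E] [FiniteDimensional ℝ E]
variable [MeasurableSpace E] [BorelSpace E] (μ : Measure E) [μ.IsAddHaarMeasure]

/-- A continuous function with uniform second order expansions on a compact set `K` can be modified
near `K`, starting from a mollification, to a `C²` function which agrees with it on `K`. -/
theorem exists_contDiff_two_eqOn {f : E → ℝ} (hf : Continuous f) {K : Set E} (hK : IsCompact K)
    {R : ℝ} {p : E → E →L[ℝ] ℝ} {A : E → E →L[ℝ] E →L[ℝ] ℝ}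
    (hA : ∀ x ∈ K, ∀ v, |A x v v| ≤ R * ‖v‖ ^ 2)
    (hrem : ∀ e > 0, ∃ δ > 0, ∀ x ∈ K, ∀ v, ‖v‖ < δ →
      |f (x + v) - f x - p x v - 1 / 2 * A x v v| ≤ e * ‖v‖ ^ 2) {σ : ℝ} (hσ : 0 < σ) :
    ∃ (s : ℝ) (h : E → ℝ), 0 < s ∧ s < σ ∧ ContDiff ℝ 2 h ∧ (∀ x ∈ K, h x = f x) ∧
      (∀ y, y ∉ thickening σ K → h y = moll μ s f y) ∧
      ∀ k ≤ 2, ∀ y, ‖iteratedFDeriv ℝ k (fun y => h y - moll μ s f y) y‖ ≤ σ := by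
  rcases K.eq_empty_or_nonempty with rfl | hKn
  · refine ⟨σ / 2, moll μ (σ / 2) f, by positivity, by linarith,
      (contDiff_moll μ hf (by positivity)).of_le two_le_smooth, by simp, fun _ _ => rfl,
      fun k hk y => ?_⟩
    simp only [sub_self]
    rcases Nat.eq_zero_or_pos k with rfl | hk0
    · simpa using hσ.le
    · rw [iteratedFDeriv_const_of_ne hk0.ne']; simpa using hσ.le
  obtain ⟨C₁, hC₁, hstar⟩ := exists_jetBound_moll_sub_quadPoly (E := E) μ
  obtain ⟨C₂, hC₂, hcut⟩ := exists_jetBound_cutoff (E := E)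
  set B := C₁ + max R 0 with hB
  have hB0 : 0 ≤ B := add_nonneg hC₁ (le_max_right _ _)
  set D := 2 * B + 8 * C₂ * B + 1 with hD
  have hD0 : 0 < D := by positivity
  set σ' := min (1 / 2) (σ / D) with hσ'
  have hσ'0 : 0 < σ' := lt_min (by norm_num) (by positivity)
  have hσ'1 : σ' ≤ 1 := (min_le_left _ _).trans (by norm_num)
  have hDσ : D * σ' ^ 2 ≤ σ := by
    have h1 : D * σ' ≤ σ := by
      rw [mul_comm, ← le_div_iff₀ hD0]; exact min_le_right _ _
    nlinarith
  obtain ⟨r₀, hr₀, hr₀1, κ, hκanti, hκt, hκ0, hκσ, hκP⟩ :=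
    exists_antitone_scale (P := fun κ r => ∀ x ∈ K, ∀ v, ‖v‖ < 4 * r →
      |f (x + v) - f x - p x v - 1 / 2 * A x v v| ≤ κ ^ 4 * ‖v‖ ^ 2)
      (fun κ r κ' r' hκ hκ' hr h x hx v hv => (h x hx v (by linarith)).trans (by gcongr))
      (fun κ hκ => by
        obtain ⟨δ, hδ, h⟩ := hrem (κ ^ 4) (by positivity)
        exact ⟨δ / 4, by positivity, fun x hx v hv => h x hx v (by linarith)⟩)
      hσ'0 (lt_min one_pos hσ)
  set r : ℕ → ℝ := fun N => r₀ * (1 / 2) ^ N with hr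
  have hr0 : ∀ N, 0 < r N := fun N => by simp only [hr]; positivity
  have hrs : ∀ N, r (N + 1) = r N / 2 := fun N => by simp only [hr, pow_succ]; ring
  have hranti : Antitone r := antitone_nat_of_succ_le fun N => by
    rw [hrs]; linarith [hr0 N]
  have hr00 : r 0 = r₀ := by simp [hr]
  have hr1 : ∀ N, r N ≤ 1 := fun N => (hranti (Nat.zero_le N)).trans
    (by rw [hr00]; exact hr₀1.le.trans (min_le_left _ _))
  have hκ1 : ∀ N, κ N ≤ 1 := fun N => (hκσ N).trans hσ'1
  set F : ℕ → E → ℝ := fun N => moll μ (κ N * r N) f with hF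
  have hFc : ∀ N, ContDiff ℝ 2 (F N) := fun N =>
    (contDiff_moll μ hf (mul_pos (hκ0 N) (hr0 N))).of_le two_le_smooth
  set T : E → E → ℝ := fun x => quadPoly x (f x) (p x) (A x) with hT
  have hTc : ∀ x, ContDiff ℝ 2 (T x) := fun x => (contDiff_quadPoly _ _ _ _).of_le two_le_smooth
  have hS : ∀ N, ∀ x ∈ K, ∀ y, ‖y - x‖ < 2 * r N →
      JetBound (fun y => F N y - T x y) y (r N) (B * κ N ^ 2 * r N ^ 2) :=
    fun N x hx y hy => hstar f hf x (p x) (A x) (max R 0) (le_max_right _ _)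
      (fun v => (hA x hx v).trans (by gcongr; exact le_max_left _ _)) (r N) (κ N) (hr0 N)
      (hκ0 N) (hκ1 N) (hκP N x hx) y hy
  choose ζ hζc hζ1 hζ0 hζJ using fun N => hcut K (r N) (hr0 N)
  have hζc2 : ∀ N, ContDiff ℝ 2 (ζ N) := fun N => (hζc N).of_le two_le_smooth
  let G : ℕ → E → ℝ := fun N =>
    Nat.rec (F 0) (fun N g y => g y + ζ N y * (F (N + 1) y - F N y)) N
  have hG0 : G 0 = F 0 := rfl
  have hGs : ∀ N y, G (N + 1) y = G N y + ζ N y * (F (N + 1) y - F N y) := fun N y => rfl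
  have hGc : ∀ N, ContDiff ℝ 2 (G N) := fun N => by
    induction N with
    | zero => exact hFc 0
    | succ N ih => exact ih.add ((hζc2 N).mul ((hFc (N + 1)).sub (hFc N)))
  have hGF : ∀ N y, infDist y K < r N → G N y = F N y := fun N => by
    induction N with
    | zero => exact fun y _ => rfl
    | succ N ih =>
      intro y hy
      rw [hGs, ih y (hy.trans_le (hranti (Nat.le_succ N))), hζ1 N y (by rw [← hrs]; exact hy)]
      ring
  have hGstay : ∀ m M, m ≤ M → ∀ y, 3 / 4 * r m < infDist y K → G M y = G m y := by
    intro m M hmM y hy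
    induction M, hmM using Nat.le_induction with
    | base => rfl
    | succ M hM ih => rw [hGs, ih, hζ0 M y (by linarith [hranti hM]), zero_mul, add_zero]
  have hdc := continuous_infDist_pt K
  have hGFe : ∀ N y, infDist y K < r N → G N =ᶠ[𝓝 y] F N := fun N y hy =>
    (hdc.continuousAt.eventually_lt_const hy).mono fun z hz => hGF N z hz
  have hnear : ∀ y e, infDist y K < e → ∃ x ∈ K, ‖y - x‖ < e := fun y e he => by
    obtain ⟨x, hx, hxe⟩ := (infDist_lt_iff hKn).1 he
    exact ⟨x, hx, by rwa [dist_eq_norm] at hxe⟩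
  -- the difference of two consecutive mollifications
  have hw : ∀ m y, infDist y K < r m →
      JetBound (fun y => ζ m y * (F (m + 1) y - F m y)) y (r m)
        (8 * C₂ * B * κ m ^ 2 * r m ^ 2) := by
    intro m y hy
    obtain ⟨x, hx, hxy⟩ := hnear y _ hy
    have h1 := hS m x hx y (by linarith [hr0 m])
    have h2 := hS (m + 1) x hx y (by rw [hrs]; linarith)
    rw [hrs] at h2
    have h3 := (h2.of_half).sub (hr0 m).le ((hFc (m + 1)).sub (hTc x))
      ((hFc m).sub (hTc x)) h1
    have h4 : JetBound (fun y => F (m + 1) y - F m y) y (r m) (2 * B * κ m ^ 2 * r m ^ 2) := by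
      refine (h3.congr (Eventually.of_forall fun z => ?_)).mono ?_
      · simp only [sub_sub_sub_cancel_right]
      · have : κ (m + 1) ^ 2 ≤ κ m ^ 2 :=
          pow_le_pow_left₀ (hκ0 _).le (hκanti (Nat.le_succ m)) 2
        have h5 : B * κ (m + 1) ^ 2 * r m ^ 2 ≤ B * κ m ^ 2 * r m ^ 2 := by gcongr
        linarith
    exact ((hζJ m y).mul (hr0 m).le (hζc2 m) ((hFc (m + 1)).sub (hFc m)) h4).mono
      (le_of_eq (by ring))
  have hκsq : ∀ N M, N ≤ M → κ M ^ 2 ≤ κ N ^ 2 := fun N M h =>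
    pow_le_pow_left₀ (hκ0 _).le (hκanti h) 2
  have hbd : ∀ N M, N ≤ M → ∀ k ≤ 2, ∀ y,
      ‖iteratedFDeriv ℝ k (fun x => G M x - G N x) y‖ ≤ D * κ N ^ 2 := by
    intro N M hNM k hk y
    have hk' : (k : WithTop ℕ∞) ≤ 2 := by exact_mod_cast hk
    -- mollifications at different scales
    have hFF : ∀ m, N ≤ m → infDist y K < r m →
        ‖iteratedFDeriv ℝ k (fun x => F m x - F N x) y‖ ≤ 2 * B * κ N ^ 2 := by
      intro m hm hy
      obtain ⟨x, hx, hxy⟩ := hnear y _ hy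
      have h1 := (hS m x hx y (by linarith [hr0 m])).norm_le (hr0 m) (hr1 m) (by positivity) hk
      have h2 := (hS N x hx y (by linarith [hr0 m, hranti hm])).norm_le (hr0 N) (hr1 N)
        (by positivity) hk
      have heq : (fun x => F m x - F N x) = fun z => (F m z - T x z) - (F N z - T x z) := by
        funext z; ring
      rw [heq, fun_iteratedFDeriv_sub_apply
        (((hFc m).sub (hTc x)).contDiffAt.of_le hk') (((hFc N).sub (hTc x)).contDiffAt.of_le hk')]
      refine (norm_sub_le _ _).trans ?_
      have h3 : B * κ m ^ 2 ≤ B * κ N ^ 2 := mul_le_mul_of_nonneg_left (hκsq _ _ hm) hB0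
      linarith
    have hNN : 0 ≤ κ N ^ 2 := sq_nonneg _
    have hCB : 0 ≤ 8 * C₂ * B * κ N ^ 2 := by positivity
    have hDe : D * κ N ^ 2 = 2 * B * κ N ^ 2 + 8 * C₂ * B * κ N ^ 2 + κ N ^ 2 := by
      rw [hD]; ring
    rcases lt_or_ge (infDist y K) (r N) with hyN | hyN
    · rcases lt_or_ge (infDist y K) (r M) with hyM | hyM
      · have he : (fun x => G M x - G N x) =ᶠ[𝓝 y] fun x => F M x - F N x :=
          (hGFe M y hyM).sub (hGFe N y hyN)
        rw [(he.iteratedFDeriv ℝ k).eq_of_nhds]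
        linarith [hFF M hNM hyM]
      · obtain ⟨m, hNm, hmM, hym, hym'⟩ : ∃ m, N ≤ m ∧ m < M ∧ infDist y K < r m ∧
            r (m + 1) ≤ infDist y K := by
          by_contra! hcon
          have : ∀ m, N ≤ m → m ≤ M → infDist y K < r m := by
            intro m hm
            induction m, hm using Nat.le_induction with
            | base => exact fun _ => hyN
            | succ m hm ih => exact fun h => hcon m hm (by omega) (ih (by omega))
          exact absurd (this M hNM le_rfl) (not_lt.2 hyM)
        have he1 : G M =ᶠ[𝓝 y] G (m + 1) := by
          have : 3 / 4 * r (m + 1) < infDist y K := by linarith [hr0 (m + 1)]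
          exact (hdc.continuousAt.eventually_const_lt this).mono fun z hz =>
            hGstay _ _ hmM z hz
        have he2 : G (m + 1) =ᶠ[𝓝 y] fun z => F m z + ζ m z * (F (m + 1) z - F m z) :=
          (hGFe m y hym).mono fun z hz => by rw [hGs, hz]
        have he : (fun x => G M x - G N x) =ᶠ[𝓝 y]
            fun x => (F m x - F N x) + ζ m x * (F (m + 1) x - F m x) :=
          ((he1.trans he2).sub (hGFe N y hyN)).mono fun z hz => by
            simp only [Pi.sub_apply] at hz ⊢
            rw [hz]; ring
        rw [(he.iteratedFDeriv ℝ k).eq_of_nhds, fun_iteratedFDeriv_add_apply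
          (((hFc m).sub (hFc N)).contDiffAt.of_le hk')
          (((hζc2 m).mul ((hFc (m + 1)).sub (hFc m))).contDiffAt.of_le hk')]
        refine (norm_add_le _ _).trans ?_
        have h1 := hFF m hNm hym
        have h2 := (hw m y hym).norm_le (hr0 m) (hr1 m) (by positivity) hk
        have h3 : 8 * C₂ * B * κ m ^ 2 ≤ 8 * C₂ * B * κ N ^ 2 :=
          mul_le_mul_of_nonneg_left (hκsq _ _ hNm) (by positivity)
        linarith
    · have he : (fun x => G M x - G N x) =ᶠ[𝓝 y] fun _ => (0 : ℝ) := by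
        have : 3 / 4 * r N < infDist y K := by linarith [hr0 N]
        exact (hdc.continuousAt.eventually_const_lt this).mono fun z hz =>
          sub_eq_zero.2 (hGstay _ _ hNM z hz)
      rw [(he.iteratedFDeriv ℝ k).eq_of_nhds]
      rcases Nat.eq_zero_or_pos k with rfl | hk0
      · simp; positivity
      · rw [iteratedFDeriv_const_of_ne hk0.ne']; simp; positivity
  have hκ2t : Tendsto (fun N => κ N ^ 2) atTop (𝓝 0) := by simpa using hκt.pow 2
  have hDt : Tendsto (fun N => D * κ N ^ 2) atTop (𝓝 0) := by simpa using hκ2t.const_mul D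
  obtain ⟨h, hhc, hht, hhb⟩ := exists_contDiff_two_limit hGc hDt hbd
  have hκr : κ 0 * r 0 < σ := by
    have h1 : r 0 < σ := by rw [hr00]; exact hr₀1.trans_le (min_le_right _ _)
    nlinarith [hκ1 0, hr0 0, hκ0 0]
  refine ⟨κ 0 * r 0, h, mul_pos (hκ0 0) (hr0 0), hκr, hhc, fun x hx => ?_, fun y hy => ?_,
    fun k hk y => (hhb k hk y).trans ?_⟩
  · have h1 : Tendsto (fun N => G N x) atTop (𝓝 (f x)) := by
      rw [tendsto_iff_dist_tendsto_zero]
      have h2 : Tendsto (fun N => B * κ N ^ 2) atTop (𝓝 0) := by simpa using hκ2t.const_mul B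
      refine squeeze_zero (fun _ => dist_nonneg) (fun N => ?_) h2
      have hxN : infDist x K < r N := by rw [infDist_zero_of_mem hx]; exact hr0 N
      have h3 := (hS N x hx x (by simpa using hr0 N)).norm_le (hr0 N) (hr1 N) (by positivity)
        (Nat.zero_le 2)
      rw [norm_iteratedFDeriv_zero] at h3
      rw [hGF N x hxN, dist_eq_norm]
      simpa [hT, quadPoly] using h3
    exact tendsto_nhds_unique (hht x) h1
  · rw [mem_thickening_iff_infDist_lt hKn, not_lt] at hy
    have h1 : 3 / 4 * r 0 < infDist y K := by
      have : r 0 < σ := by rw [hr00]; exact hr₀1.trans_le (min_le_right _ _)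
      linarith [hr0 0]
    refine tendsto_nhds_unique (hht y) (tendsto_const_nhds.congr fun N => ?_)
    rw [hGstay 0 N (Nat.zero_le N) y h1, hG0]
  · have : κ 0 ^ 2 ≤ σ' ^ 2 := pow_le_pow_left₀ (hκ0 0).le (hκσ 0) 2
    nlinarith

end Surgery

section SecondDiff

/-- The lower symmetric second derivative of `φ` at `y` is at least `b`. -/
def SecondDiffGE {E : Type} [NormedAddCommGroup E] (φ : E → ℝ) (b : ℝ) (y : E) : Prop :=
  ∀ e > 0, ∀ᶠ v in 𝓝 (0 : E), (b - e) * ‖v‖ ^ 2 ≤ φ (y + v) + φ (y - v) - 2 * φ y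

lemma SecondDiffGE.add {E : Type} [NormedAddCommGroup E] {φ ψ : E → ℝ} {b c : ℝ} {y : E} (h : SecondDiffGE φ b y)
    (h' : SecondDiffGE ψ c y) : SecondDiffGE (fun x => φ x + ψ x) (b + c) y := fun e he => by
  filter_upwards [h (e / 2) (by positivity), h' (e / 2) (by positivity)] with v h1 h2
  nlinarith

lemma SecondDiffGE.mono {E : Type} [NormedAddCommGroup E] {φ : E → ℝ} {b c : ℝ} {y : E} (h : SecondDiffGE φ b y) (hcb : c ≤ b) :
    SecondDiffGE φ c y := fun e he => by
  filter_upwards [h e he] with v h1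
  refine le_trans ?_ h1
  gcongr

variable {E : Type} [NormedAddCommGroup E] [InnerProductSpace ℝ E]

lemma secondDiffGE_norm_sq (c : ℝ) (y : E) : SecondDiffGE (fun x => c * ‖x‖ ^ 2) (2 * c) y :=
  fun e he => Eventually.of_forall fun v => by
    have := parallelogram_law_with_norm ℝ y v
    have h0 : 0 ≤ e * ‖v‖ ^ 2 := by positivity
    have h1 := congrArg (c * ·) this
    simp only at h1 ⊢
    linarith

lemma convexOn_of_secondDiffGE {W : Set E} (hW : Convex ℝ W) {φ : E → ℝ}
    (hφ : ContinuousOn φ W) (h : ∀ y ∈ W, SecondDiffGE φ 0 y) : ConvexOn ℝ W φ := by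
  refine ⟨hW, fun x hx y hy a b ha hb hab => ?_⟩
  by_contra! hlt
  have hmem : ∀ t ∈ Icc (0 : ℝ) 1, x + t • (y - x) ∈ W := fun t ht =>
    hW.add_smul_sub_mem hx hy ht
  set d := φ (a • x + b • y) - (a * φ x + b * φ y) with hd
  have hd0 : 0 < d := by simp only [smul_eq_mul] at hlt; linarith
  set u : ℝ → ℝ := fun t => φ (x + t • (y - x)) - ((1 - t) * φ x + t * φ y) + d * t * (t - 1)
    with hu
  have huc : ContinuousOn u (Icc 0 1) := by
    have h1 : ContinuousOn (fun t : ℝ => φ (x + t • (y - x))) (Icc 0 1) :=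
      hφ.comp (by fun_prop) hmem
    exact (h1.sub (by fun_prop)).add (by fun_prop)
  obtain ⟨t, ht, htmax⟩ := isCompact_Icc.exists_isMaxOn (nonempty_Icc.2 zero_le_one) huc
  have hub : 0 < u b := by
    have hb1 : b ≤ 1 := by linarith
    have h1 : x + b • (y - x) = a • x + b • y := by
      rw [← eq_sub_iff_add_eq] at hab; rw [hab]; module
    have h2 : u b = d + d * b * (b - 1) := by
      simp only [hu]; rw [h1, hd, ← hab]; ring
    have h3 : 0 < 1 - b + b ^ 2 := by nlinarith [sq_nonneg (b - 1 / 2)]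
    rw [h2]; nlinarith [mul_pos hd0 h3]
  have hut : 0 < u t := hub.trans_le (htmax ⟨hb, by linarith⟩)
  have h0 : u 0 = 0 := by simp [hu]
  have h1 : u 1 = 0 := by simp [hu]
  have ht0 : 0 < t := lt_of_le_of_ne ht.1 (by rintro rfl; linarith)
  have ht1 : t < 1 := lt_of_le_of_ne ht.2 (by rintro rfl; linarith)
  have hN : 0 < ‖y - x‖ ^ 2 + 1 := by positivity
  have hev := h _ (hmem t ht) (d / (‖y - x‖ ^ 2 + 1)) (by positivity)
  have htend : Tendsto (fun s : ℝ => s • (y - x)) (𝓝[>] 0) (𝓝 0) := by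
    have : Continuous fun s : ℝ => s • (y - x) := by fun_prop
    exact (this.tendsto' 0 _ (by simp)).mono_left nhdsWithin_le_nhds
  have hsmall : ∀ᶠ s : ℝ in 𝓝[>] 0, s < min t (1 - t) :=
    nhdsWithin_le_nhds (eventually_lt_nhds (lt_min ht0 (by linarith)))
  obtain ⟨s, ⟨hs, hslt⟩, hs0⟩ := ((htend.eventually hev).and hsmall).and
    (self_mem_nhdsWithin) |>.exists
  have hs0 : 0 < s := hs0
  have hst := hslt.trans_le (min_le_left _ _)
  have hst' := hslt.trans_le (min_le_right _ _)
  have hp : u (t + s) ≤ u t := htmax ⟨by linarith, by linarith⟩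
  have hm : u (t - s) ≤ u t := htmax ⟨by linarith, by linarith⟩
  have e1 : x + (t + s) • (y - x) = x + t • (y - x) + s • (y - x) := by module
  have e2 : x + (t - s) • (y - x) = x + t • (y - x) - s • (y - x) := by module
  simp only [hu] at hp hm
  rw [e1] at hp
  rw [e2] at hm
  rw [norm_smul, mul_pow, Real.norm_eq_abs, sq_abs] at hs
  have h5 : d / (‖y - x‖ ^ 2 + 1) * (s ^ 2 * ‖y - x‖ ^ 2) ≤ d * s ^ 2 := by
    rw [div_mul_eq_mul_div, div_le_iff₀ hN]
    nlinarith [mul_pos hd0 (sq_pos_of_pos hs0)]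
  have h6 : 0 < d * s ^ 2 := by positivity
  nlinarith

lemma strongConvexOn_of_secondDiffGE {W : Set E} (hW : Convex ℝ W) {φ : E → ℝ} {b : ℝ}
    (hφ : ContinuousOn φ W) (h : ∀ y ∈ W, SecondDiffGE φ b y) : StrongConvexOn W b φ := by
  rw [strongConvexOn_iff_convex]
  refine convexOn_of_secondDiffGE hW (hφ.sub (by fun_prop)) fun y hy => ?_
  have := (h y hy).add (secondDiffGE_norm_sq (-(b / 2)) y)
  simp only [neg_mul, ← sub_eq_add_neg] at this
  exact this.mono (by linarith)

lemma StrongConvexOn.add_le_add {W : Set E} {f : E → ℝ} {c : ℝ} (hf : StrongConvexOn W c f)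
    {p q : E} (hp : p ∈ W) (hq : q ∈ W) :
    2 * f ((1 / 2 : ℝ) • (p + q)) + c / 4 * ‖p - q‖ ^ 2 ≤ f p + f q := by
  have := hf.2 hp hq (show (0 : ℝ) ≤ 1 / 2 by norm_num)
    (show (0 : ℝ) ≤ 1 / 2 by norm_num) (by norm_num)
  rw [← smul_add] at this
  simp only [smul_eq_mul] at this
  linarith

end SecondDiff

section SecondDiffC2

variable {E : Type} [NormedAddCommGroup E] [NormedSpace ℝ E]

lemma ContDiffAt.eventually_abs_second_diff_le {w : E → ℝ} {y : E} (hw : ContDiffAt ℝ 2 w y)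
    {e : ℝ} (he : 0 < e) : ∀ᶠ v in 𝓝 (0 : E),
      |w (y + v) + w (y - v) - 2 * w y| ≤ (‖iteratedFDeriv ℝ 2 w y‖ + e) * ‖v‖ ^ 2 := by
  set D := ‖iteratedFDeriv ℝ 2 w y‖ with hD
  have hd1 : ∀ᶠ x in 𝓝 y, DifferentiableAt ℝ w x := by
    filter_upwards [hw.eventually (by simp)] with x hx using hx.differentiableAt (by simp)
  have hd2 : DifferentiableAt ℝ (fderiv ℝ w) y :=
    (hw.fderiv_right (m := 1) (by norm_num)).differentiableAt (by simp)
  have hDn : ‖fderiv ℝ (fderiv ℝ w) y‖ = D := by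
    rw [hD, ← norm_iteratedFDeriv_fderiv (n := 1), ← norm_iteratedFDeriv_fderiv (n := 0),
      norm_iteratedFDeriv_zero]
  have hlo := (hasFDerivAt_iff_isLittleO_nhds_zero.1 hd2.hasFDerivAt).def (half_pos he)
  have h0 : Tendsto (fun v : E => y + v) (𝓝 0) (𝓝 y) := by
    have : Continuous fun v : E => y + v := by fun_prop
    exact this.tendsto' 0 _ (by simp)
  obtain ⟨δ, hδ, hball⟩ := Metric.eventually_nhds_iff_ball.1 (hlo.and (h0.eventually hd1))
  filter_upwards [ball_mem_nhds (0 : E) hδ] with v hv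
  rw [mem_ball_zero_iff] at hv
  have hsm : ∀ t ∈ Icc (0 : ℝ) 1, ‖t • v‖ < δ := fun t ht => by
    rw [norm_smul, Real.norm_of_nonneg ht.1]
    nlinarith [norm_nonneg v, ht.1, ht.2]
  have hin : ∀ t ∈ Icc (0 : ℝ) 1, t • v ∈ ball (0 : E) δ ∧ -(t • v) ∈ ball (0 : E) δ :=
    fun t ht => by simpa using hsm t ht
  set θ : ℝ → ℝ := fun t => w (y + t • v) + w (y + -(t • v)) - 2 * w y with hθ
  have hder : ∀ t ∈ Icc (0 : ℝ) 1, HasDerivAt θ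
      (fderiv ℝ w (y + t • v) v + fderiv ℝ w (y + -(t • v)) (-v)) t := fun t ht => by
    have l1 : HasDerivAt (fun t : ℝ => y + t • v) v t := by
      simpa using ((hasDerivAt_id t).smul_const v).const_add y
    have l2 : HasDerivAt (fun t : ℝ => y + -(t • v)) (-v) t := by
      simpa using (((hasDerivAt_id t).smul_const v).neg).const_add y
    exact (((hball _ (hin t ht).1).2.hasFDerivAt.comp_hasDerivAt t l1).add
      ((hball _ (hin t ht).2).2.hasFDerivAt.comp_hasDerivAt t l2)).sub_const _
  have key := image_norm_le_of_norm_deriv_right_le_deriv_boundary (f := θ)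
    (B := fun t => (D + e) * ‖v‖ ^ 2 * t ^ 2) (B' := fun t => (D + e) * ‖v‖ ^ 2 * (2 * t))
    (a := 0) (b := 1)
    (fun t ht => (hder t ht).continuousAt.continuousWithinAt)
    (fun t ht => (hder t ⟨ht.1, ht.2.le⟩).hasDerivWithinAt) (by simp [hθ]; ring_nf)
    (fun t => by simpa using (hasDerivAt_pow 2 t).const_mul ((D + e) * ‖v‖ ^ 2))
    (fun t ht => by
      have ht' : t ∈ Icc (0 : ℝ) 1 := ⟨ht.1, ht.2.le⟩
      have b1 := (hball _ (hin t ht').1).1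
      have b2 := (hball _ (hin t ht').2).1
      rw [norm_neg] at b2
      set a₁ := fderiv ℝ w (y + t • v)
      set a₂ := fderiv ℝ w (y + -(t • v))
      set H := fderiv ℝ (fderiv ℝ w) y
      have h1 : a₁ v + a₂ (-v) = ((a₁ - fderiv ℝ w y - H (t • v)) -
          (a₂ - fderiv ℝ w y - H (-(t • v))) + (2 : ℝ) • H (t • v)) v := by
        simp; ring
      rw [h1]
      refine (ContinuousLinearMap.le_opNorm _ _).trans ?_
      have hnt : ‖t • v‖ = t * ‖v‖ := by rw [norm_smul, Real.norm_of_nonneg ht.1]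
      have h2 : ‖(2 : ℝ) • H (t • v)‖ ≤ 2 * (D * (t * ‖v‖)) := by
        rw [norm_smul, Real.norm_of_nonneg zero_le_two, ← hDn, ← hnt]
        gcongr; exact H.le_opNorm _
      rw [hnt] at b1 b2
      have h3 := (norm_add_le ((a₁ - fderiv ℝ w y - H (t • v)) -
          (a₂ - fderiv ℝ w y - H (-(t • v)))) ((2 : ℝ) • H (t • v)))
      have h4 := norm_sub_le (a₁ - fderiv ℝ w y - H (t • v)) (a₂ - fderiv ℝ w y - H (-(t • v)))
      calc _ ≤ (e / 2 * (t * ‖v‖) + e / 2 * (t * ‖v‖) + 2 * (D * (t * ‖v‖))) * ‖v‖ := by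
            gcongr; linarith
        _ ≤ _ := by
          have : 0 ≤ e * t * ‖v‖ ^ 2 := by have := ht.1; positivity
          nlinarith)
  have := key (right_mem_Icc.2 zero_le_one)
  simpa [hθ, ← sub_eq_add_neg] using this

end SecondDiffC2

lemma exists_continuous_eqOn {X : Type} [TopologicalSpace X] [NormalSpace X] {f : X → ℝ} {C : Set X}
    (hC : IsClosed C) (hf : ContinuousOn f C) : ∃ F : X → ℝ, Continuous F ∧ EqOn F f C := by
  obtain ⟨g, hg⟩ := ContinuousMap.exists_restrict_eq hC ⟨C.domRestrict f, hf.domRestrict⟩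
  exact ⟨g, g.continuous, fun x hx => congrArg (fun h : C(C, ℝ) => h ⟨x, hx⟩) hg⟩

section VariableScale

variable {E : Type} [NormedAddCommGroup E] [InnerProductSpace ℝ E] [FiniteDimensional ℝ E]
variable [MeasurableSpace E] [BorelSpace E] (μ : Measure E) [μ.IsAddHaarMeasure]

/-- At the scale `t`, the function `f` is strongly convex and Lipschitz around `y`, with constants
good enough for a perturbation of size `t` to keep the lower bound `b` on the second derivative. -/
structure GoodScale (U : Set E) (f : E → ℝ) (b ε : ℝ) (y : E) (t c L : ℝ) : Prop where
  pos : 0 < t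
  le_one : t ≤ 1
  subset : ball y (2 * t) ⊆ U
  c_nonneg : 0 ≤ c
  L_nonneg : 0 ≤ L
  convex : StrongConvexOn (ball y (2 * t)) c f
  lipschitz : ∀ p ∈ ball y (2 * t), ∀ q ∈ ball y (2 * t), |f p - f q| ≤ L * ‖p - q‖
  le_sub : b ≤ c - t * (c + L + 1)
  lt_eps : t * (L + 1) < ε

variable {U : Set E} {f : E → ℝ} {b ε : ℝ} {y : E} {t c L : ℝ}

omit [FiniteDimensional ℝ E] [MeasurableSpace E] [BorelSpace E] in
lemma GoodScale.continuousOn (h : GoodScale U f b ε y t c L) : ContinuousOn f (ball y (2 * t)) := by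
  have : LipschitzOnWith L.toNNReal f (ball y (2 * t)) :=
    LipschitzOnWith.of_dist_le_mul fun p hp q hq => by
      rw [Real.dist_eq, dist_eq_norm, Real.coe_toNNReal _ h.L_nonneg]
      exact h.lipschitz p hp q hq
  exact this.continuousOn

omit [FiniteDimensional ℝ E] [MeasurableSpace E] [BorelSpace E] in
lemma GoodScale.exists_continuous (h : GoodScale U f b ε y t c L) :
    ∃ F : E → ℝ, Continuous F ∧ EqOn F f (ball y (3 / 2 * t)) := by
  obtain ⟨F, hF, hFf⟩ := exists_continuous_eqOn (isClosed_closedBall (x := y) (ε := 3 / 2 * t))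
    (h.continuousOn.mono (closedBall_subset_ball (by linarith [h.pos])))
  exact ⟨F, hF, hFf.mono ball_subset_closedBall⟩

lemma GoodScale.moll_eventuallyEq (h : GoodScale U f b ε y t c L) {F : E → ℝ}
    (hFf : EqOn F f (ball y (3 / 2 * t))) {r : E → ℝ} (hr : ContinuousAt r y) (hr0 : 0 < r y)
    (hrt : r y ≤ t) : (fun y => moll μ (r y) f y) =ᶠ[𝓝 y] fun y => moll μ (r y) F y := by
  have ht := h.pos
  filter_upwards [hr.eventually_const_lt hr0,
    hr.eventually_lt_const (show r y < 2 * t by linarith), ball_mem_nhds y (half_pos ht)]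
    with z hz0 hz hzy
  refine moll_congr μ hz0 fun y' hy' => (hFf ?_).symm
  rw [mem_ball, dist_eq_norm] at hzy ⊢
  calc ‖y' - y‖ = ‖(y' - z) + (z - y)‖ := by congr 1; abel
    _ ≤ _ := norm_add_le _ _
    _ < _ := by linarith

lemma GoodScale.contDiffAt_moll (h : GoodScale U f b ε y t c L) {r : E → ℝ}
    (hr : ContDiffAt ℝ 2 r y) (hr0 : 0 < r y) (hrt : r y ≤ t) :
    ContDiffAt ℝ 2 (fun y => moll μ (r y) f y) y := by
  obtain ⟨F, hF, hFf⟩ := h.exists_continuous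
  refine ContDiffAt.congr_of_eventuallyEq ?_
    (h.moll_eventuallyEq μ hFf hr.continuousAt hr0 hrt)
  have h1 : ContDiffAt ℝ 2 (fun q : ℝ × E => moll μ q.1 F q.2) (r y, y) :=
    ((contDiffOn_moll_uncurry μ hF).contDiffAt ((isOpen_Ioi.prod isOpen_univ).mem_nhds
      (show (r y, y) ∈ Ioi (0 : ℝ) ×ˢ univ from ⟨hr0, mem_univ _⟩))).of_le two_le_smooth
  exact ContDiffAt.comp (f := fun y => (r y, y)) y h1 (hr.prodMk contDiffAt_id)

lemma GoodScale.abs_moll_sub_le (h : GoodScale U f b ε y t c L) {r : ℝ} (hr0 : 0 < r)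
    (hrt : r ≤ t) : |moll μ r f y - f y| ≤ L * t := by
  obtain ⟨F, hF, hFf⟩ := h.exists_continuous
  have ht := h.pos
  have h1 : moll μ r f y = moll μ r F y := moll_congr μ hr0 fun y' hy' => (hFf (by
    rw [mem_ball, dist_eq_norm]; linarith)).symm
  rw [h1]
  refine _root_.abs_moll_sub_le μ hF hr0 fun y' hy' => ?_
  rw [hFf (by rw [mem_ball, dist_eq_norm]; linarith)]
  refine (h.lipschitz y' (by rw [mem_ball, dist_eq_norm]; linarith) y
    (mem_ball_self (by linarith))).trans ?_
  have := h.L_nonneg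
  gcongr
  linarith

omit [FiniteDimensional ℝ E] [MeasurableSpace E] [BorelSpace E] in
lemma GoodScale.second_diff_le (h : GoodScale U f b ε y t c L) {rp rm r0 e : ℝ} {v z : E}
    (hp0 : 0 < rp) (hp2 : rp < 2 * t) (hm0 : 0 < rm) (hm2 : rm < 2 * t) (hr0 : 0 < r0)
    (hryt : r0 ≤ t) (he0 : 0 < e) (he1 : e ≤ 1) (hv : ‖v‖ < t / 4) (hz : ‖z‖ < 1 / 2)
    (hsd : |rp + rm - 2 * r0| ≤ (t + e) * ‖v‖ ^ 2) (hdiff : |rp - rm| ≤ 2 * (t + e) * ‖v‖) :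
    (y + v - rp • z ∈ ball y (3 / 2 * t) ∧ y - v - rm • z ∈ ball y (3 / 2 * t) ∧
      y - r0 • z ∈ ball y (3 / 2 * t)) ∧
    (c - t * (c + L) - e * (c + L)) * ‖v‖ ^ 2 ≤
      f (y + v - rp • z) + f (y - v - rm • z) - 2 * f (y - r0 • z) := by
  have ht := h.pos
  have hL := h.L_nonneg
  have hc := h.c_nonneg
  set x := t + e with hx
  set P := y + v - rp • z with hP
  set Q := y - v - rm • z with hQ
  set M := y - r0 • z with hM
  have hnp : ‖rp • z‖ ≤ t := by
    rw [norm_smul, Real.norm_of_nonneg hp0.le]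
    nlinarith [norm_nonneg z]
  have hnm : ‖rm • z‖ ≤ t := by
    rw [norm_smul, Real.norm_of_nonneg hm0.le]
    nlinarith [norm_nonneg z]
  have hn0 : ‖r0 • z‖ ≤ t := by
    rw [norm_smul, Real.norm_of_nonneg hr0.le]
    nlinarith [norm_nonneg z]
  have hPb : P ∈ ball y (3 / 2 * t) := by
    rw [mem_ball, dist_eq_norm, show P - y = v - rp • z by rw [hP]; abel]
    linarith [norm_sub_le v (rp • z)]
  have hQb : Q ∈ ball y (3 / 2 * t) := by
    rw [mem_ball, dist_eq_norm, show Q - y = -(v + rm • z) by rw [hQ]; abel, norm_neg]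
    linarith [norm_add_le v (rm • z)]
  have hMb : M ∈ ball y (3 / 2 * t) := by
    rw [mem_ball, dist_eq_norm, show M - y = -(r0 • z) by rw [hM]; abel, norm_neg]
    linarith
  have hNb : (1 / 2 : ℝ) • (P + Q) ∈ ball y (3 / 2 * t) := by
    rw [smul_add]
    exact (convex_ball y _) hPb hQb (by norm_num) (by norm_num) (by norm_num)
  have hsubset : ball y (3 / 2 * t) ⊆ ball y (2 * t) := ball_subset_ball (by linarith)
  refine ⟨⟨hPb, hQb, hMb⟩, ?_⟩
  have h1 := h.convex.add_le_add (hsubset hPb) (hsubset hQb)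
  have h2 := h.lipschitz _ (hsubset hNb) _ (hsubset hMb)
  have h3 : ‖(1 / 2 : ℝ) • (P + Q) - M‖ ≤ x * ‖v‖ ^ 2 / 4 := by
    have : (1 / 2 : ℝ) • (P + Q) - M = (-(1 / 2) * (rp + rm - 2 * r0)) • z := by
      rw [hP, hQ, hM]; module
    rw [this, norm_smul, norm_mul, Real.norm_eq_abs, Real.norm_eq_abs]
    have h4 : |(-(1 / 2) : ℝ)| = 1 / 2 := by norm_num
    rw [h4]
    have h5 := mul_le_mul hsd hz.le (norm_nonneg z) (by positivity)
    linarith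
  have h4 : (2 - x) * ‖v‖ ≤ ‖P - Q‖ := by
    have h5 : P - Q = (2 : ℝ) • v - (rp - rm) • z := by rw [hP, hQ]; module
    have h6 := norm_sub_norm_le ((2 : ℝ) • v) ((rp - rm) • z)
    rw [← h5, norm_smul, norm_smul, Real.norm_of_nonneg zero_le_two, Real.norm_eq_abs] at h6
    have h7 := mul_le_mul hdiff hz.le (norm_nonneg z) (by positivity)
    linarith
  have hx2 : 0 ≤ 2 - x := by linarith [h.le_one]
  have h5 : 4 * (1 - x) * ‖v‖ ^ 2 ≤ ‖P - Q‖ ^ 2 := by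
    have h6 := pow_le_pow_left₀ (by positivity) h4 2
    have h7 : 0 ≤ x ^ 2 * ‖v‖ ^ 2 := by positivity
    nlinarith
  have h7 := (abs_le.1 h2).1
  have h8 : L * ‖(1 / 2 : ℝ) • (P + Q) - M‖ ≤ L * (x * ‖v‖ ^ 2 / 4) := by gcongr
  have h9 : c / 4 * (4 * (1 - x) * ‖v‖ ^ 2) ≤ c / 4 * ‖P - Q‖ ^ 2 := by gcongr
  have h11 : 0 ≤ L * x * ‖v‖ ^ 2 := by positivity
  have h12 : c - t * (c + L) - e * (c + L) = c * (1 - x) - L * x := by rw [hx]; ring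
  rw [h12]
  linarith

lemma GoodScale.secondDiffGE_moll (h : GoodScale U f b ε y t c L) {r : E → ℝ}
    (hr : ContDiffAt ℝ 2 r y) (hr0 : 0 < r y) (hrt : ∀ k ≤ 2, ‖iteratedFDeriv ℝ k r y‖ ≤ t) :
    SecondDiffGE (fun y => moll μ (r y) f y) (c - t * (c + L)) y := by
  have ht := h.pos
  have hL := h.L_nonneg
  have hc := h.c_nonneg
  have hryt : r y ≤ t := by
    have := hrt 0 (by norm_num)
    rw [norm_iteratedFDeriv_zero, Real.norm_of_nonneg hr0.le] at this
    exact this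
  have hDr : ‖fderiv ℝ r y‖ ≤ t := by
    have := hrt 1 (by norm_num)
    rwa [← norm_iteratedFDeriv_fderiv (n := 0), norm_iteratedFDeriv_zero] at this
  obtain ⟨F, hF, hFf⟩ := h.exists_continuous
  have hev := h.moll_eventuallyEq μ hFf hr.continuousAt hr0 hryt
  intro e he
  have hcL : 0 < c + L + 1 := by linarith
  set e' := min 1 (e / (c + L + 1)) with he'
  have he'0 : 0 < e' := lt_min one_pos (by positivity)
  have he'1 : e' ≤ 1 := min_le_left _ _
  have he'2 : e' * (c + L) ≤ e := by
    have : e' * (c + L + 1) ≤ e := by rw [← le_div_iff₀ hcL]; exact min_le_right _ _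
    linarith
  have hadd : Tendsto (fun v : E => y + v) (𝓝 0) (𝓝 y) := by
    have : Continuous fun v : E => y + v := by fun_prop
    exact this.tendsto' 0 _ (by simp)
  have hsub : Tendsto (fun v : E => y - v) (𝓝 0) (𝓝 y) := by
    have : Continuous fun v : E => y - v := by fun_prop
    exact this.tendsto' 0 _ (by simp)
  have hneg : Tendsto (fun v : E => -v) (𝓝 0) (𝓝 0) := by
    have : Continuous fun v : E => -v := by fun_prop
    exact this.tendsto' 0 _ (by simp)
  have hlo := (hasFDerivAt_iff_isLittleO_nhds_zero.1
    (hr.differentiableAt (by simp)).hasFDerivAt).def he'0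
  have hr1 := hr.continuousAt.eventually_const_lt hr0
  have hr2 := hr.continuousAt.eventually_lt_const (show r y < 2 * t by linarith)
  filter_upwards [hr.eventually_abs_second_diff_le he'0, hlo, hneg.eventually hlo,
    hadd.eventually (hr1.and (hr2.and hev)), hsub.eventually (hr1.and (hr2.and hev)),
    ball_mem_nhds (0 : E) (show 0 < t / 4 by positivity)]
    with v hsd hlo1 hlo2 ⟨hp0, hp2, hpe⟩ ⟨hm0, hm2, hme⟩ hv
  rw [mem_ball_zero_iff] at hv
  rw [hpe, hme, hev.eq_of_nhds]
  set rp := r (y + v)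
  set rm := r (y - v)
  set r0 := r y
  set x := t + e' with hx
  have hsd' : |rp + rm - 2 * r0| ≤ x * ‖v‖ ^ 2 :=
    hsd.trans (mul_le_mul_of_nonneg_right (by have := hrt 2 le_rfl; linarith) (sq_nonneg _))
  have hdiff : |rp - rm| ≤ 2 * x * ‖v‖ := by
    rw [norm_neg, ← sub_eq_add_neg] at hlo2
    have h1 : ‖fderiv ℝ r y v‖ ≤ t * ‖v‖ :=
      ((fderiv ℝ r y).le_opNorm v).trans (by gcongr)
    rw [Real.norm_eq_abs] at h1 hlo1 hlo2
    rw [map_neg] at hlo2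
    rw [abs_le] at h1 hlo1 hlo2 ⊢
    constructor <;> linarith
  have hpt : ∀ z, mollKernel μ z * ((c - t * (c + L) - e) * ‖v‖ ^ 2) ≤
      mollKernel μ z * F (y + v - rp • z) + mollKernel μ z * F (y - v - rm • z) -
        2 * (mollKernel μ z * F (y - r0 • z)) := by
    intro z
    rcases eq_or_ne (mollKernel μ z) 0 with hk | hk
    · simp [hk]
    have hz := norm_lt_of_mollKernel_ne_zero μ hk
    obtain ⟨⟨hPb, hQb, hMb⟩, h5⟩ := h.second_diff_le hp0 hp2 hm0 hm2 hr0 hryt he'0 he'1 hv hz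
      hsd' hdiff
    rw [hFf hPb, hFf hQb, hFf hMb]
    set P := y + v - rp • z
    set Q := y - v - rm • z
    set M := y - r0 • z
    have h6 : (c - t * (c + L) - e) * ‖v‖ ^ 2 ≤ f P + f Q - 2 * f M := by
      refine le_trans ?_ h5
      gcongr
    have hk0 := mollKernel_nonneg μ z
    calc _ ≤ mollKernel μ z * (f P + f Q - 2 * f M) := by gcongr
      _ = _ := by ring
  have i1 := integrable_moll μ hF rp (y + v)
  have i2 := integrable_moll μ hF rm (y - v)
  have i3 := integrable_moll μ hF r0 y
  have hbound := integral_mono ((integrable_mollKernel μ).mul_const _)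
    ((i1.add i2).sub (i3.const_mul 2)) hpt
  rw [integral_mul_const, integral_mollKernel, one_mul] at hbound
  refine hbound.trans (le_of_eq ?_)
  have e1 := integral_sub (i1.add i2) (i3.const_mul 2)
  have e2 := integral_add i1 i2
  simp only [Pi.add_apply] at e1
  simp only [moll]
  refine e1.trans ?_
  rw [e2, integral_const_mul]

/-- A small `C²` perturbation of a variable scale mollification keeps the lower bound on the second
derivative. -/
lemma GoodScale.perturb (h : GoodScale U f b ε y t c L) {r w : E → ℝ}
    (hr : ContDiffAt ℝ 2 r y) (hr0 : 0 < r y) (hrt : ∀ k ≤ 2, ‖iteratedFDeriv ℝ k r y‖ ≤ t)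
    (hw : ContDiffAt ℝ 2 w y) (hwt : ∀ k ≤ 2, ‖iteratedFDeriv ℝ k w y‖ ≤ t) :
    ContDiffAt ℝ 2 (fun y => moll μ (r y) f y + w y) y ∧
      SecondDiffGE (fun y => moll μ (r y) f y + w y) b y ∧
      |f y - (moll μ (r y) f y + w y)| < ε := by
  have hryt : r y ≤ t := by
    have := hrt 0 (by norm_num)
    rw [norm_iteratedFDeriv_zero, Real.norm_of_nonneg hr0.le] at this
    exact this
  refine ⟨(h.contDiffAt_moll μ hr hr0 hryt).add hw, ?_, ?_⟩
  · have h1 : SecondDiffGE w (-t) y := fun e he => by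
      filter_upwards [hw.eventually_abs_second_diff_le he] with v hv
      have h2 := hwt 2 le_rfl
      have h3 := (abs_le.1 hv).1
      have h4 : (‖iteratedFDeriv ℝ 2 w y‖ + e) * ‖v‖ ^ 2 ≤ (t + e) * ‖v‖ ^ 2 := by gcongr
      linarith
    refine ((h.secondDiffGE_moll μ hr hr0 hrt).add h1).mono ?_
    have := h.le_sub
    linarith
  · have h1 := h.abs_moll_sub_le μ hr0 hryt
    have h2 := hwt 0 (by norm_num)
    rw [norm_iteratedFDeriv_zero, Real.norm_eq_abs] at h2
    have h3 := h.lt_eps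
    rw [abs_le] at h1 h2
    rw [abs_lt]
    constructor <;> linarith

end VariableScale

section Sums

variable {E : Type} [NormedAddCommGroup E] [NormedSpace ℝ E]

lemma iteratedFDeriv_eq_zero_of_isClosed {φ : E → ℝ} {C : Set E} (hC : IsClosed C)
    (h : ∀ y ∉ C, φ y = 0) (k : ℕ) {y : E} (hy : y ∉ C) : iteratedFDeriv ℝ k φ y = 0 := by
  have he : φ =ᶠ[𝓝 y] fun _ => (0 : ℝ) := by
    filter_upwards [hC.isOpen_compl.mem_nhds hy] with z hz using h z hz
  rw [(he.iteratedFDeriv ℝ k).eq_of_nhds]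
  simp

lemma exists_norm_iteratedFDeriv_le_of_isCompact {φ : E → ℝ} (hφ : ContDiff ℝ 2 φ) {C : Set E}
    (hC : IsCompact C) (h : ∀ y ∉ C, φ y = 0) :
    ∃ M > 0, ∀ k ≤ 2, ∀ y, ‖iteratedFDeriv ℝ k φ y‖ ≤ M := by
  have hex : ∀ k : ℕ, ∃ M, k ≤ 2 → ∀ y, ‖iteratedFDeriv ℝ k φ y‖ ≤ M := fun k => by
    by_cases hk : k ≤ 2
    · obtain ⟨M, hM⟩ := hC.exists_bound_of_continuousOn
        (hφ.continuous_iteratedFDeriv (m := k) (by exact_mod_cast hk)).continuousOn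
      refine ⟨max M 0, fun _ y => ?_⟩
      by_cases hy : y ∈ C
      · exact (hM y hy).trans (le_max_left _ _)
      · rw [iteratedFDeriv_eq_zero_of_isClosed hC.isClosed h k hy, norm_zero]
        exact le_max_right _ _
    · exact ⟨0, fun h => absurd h hk⟩
  choose M hM using hex
  refine ⟨max 1 (max (M 0) (max (M 1) (M 2))), lt_max_of_lt_left one_pos, fun k hk y => ?_⟩
  refine (hM k hk y).trans ?_
  interval_cases k <;> simp

lemma hasSum_half_pow_succ (a : ℝ) : HasSum (fun i : ℕ => (1 / 2) ^ (i + 1) * a) a := by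
  have := hasSum_geometric_two' a
  refine this.congr_fun fun i => ?_
  rw [pow_succ, one_div, inv_pow]; field_simp

/-- A sum of small compactly supported `C²` functions is `C²`, with the expected bounds. -/
lemma contDiff_two_tsum {U : Set E} {τ : E → ℝ} (hτ : ∀ y ∈ U, 0 ≤ τ y) {C : ℕ → Set E}
    (hC : ∀ i, IsClosed (C i)) {θ : ℕ → ℝ} (hθ1 : ∀ i, θ i ≤ (1 / 2) ^ (i + 1))
    (hθτ : ∀ i, ∀ y ∈ C i, θ i ≤ (1 / 2) ^ (i + 1) * τ y) {φ : ℕ → E → ℝ}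
    (hφ : ∀ i, ContDiff ℝ 2 (φ i)) (hφC : ∀ i, ∀ y ∉ C i, φ i y = 0)
    (hφθ : ∀ i, ∀ k ≤ 2, ∀ y, ‖iteratedFDeriv ℝ k (φ i) y‖ ≤ θ i) :
    ContDiff ℝ 2 (fun y => ∑' i, φ i y) ∧ (∀ y, Summable fun i => φ i y) ∧
      ∀ k ≤ 2, ∀ y ∈ U, ‖iteratedFDeriv ℝ k (fun y => ∑' i, φ i y) y‖ ≤ τ y := by
  have hs : Summable fun i : ℕ => ((1 : ℝ) / 2) ^ (i + 1) := by
    simpa using (hasSum_half_pow_succ 1).summable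
  have hb : ∀ (k i : ℕ) (x : E), (k : ℕ∞) ≤ 2 →
      ‖iteratedFDeriv ℝ k (φ i) x‖ ≤ (1 / 2) ^ (i + 1) := fun k i x hk =>
    (hφθ i k (by exact_mod_cast hk) x).trans (hθ1 i)
  refine ⟨contDiff_tsum (N := 2) (v := fun _ i => (1 / 2) ^ (i + 1)) hφ (fun _ _ => hs) hb,
    fun y => ?_, fun k hk y hy => ?_⟩
  · refine Summable.of_norm_bounded hs fun i => ?_
    have := hb 0 i y (by norm_num)
    rwa [norm_iteratedFDeriv_zero] at this
  · rw [iteratedFDeriv_tsum_apply (N := 2) (v := fun _ i => (1 / 2) ^ (i + 1)) hφ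
      (fun _ _ => hs) hb (by exact_mod_cast hk)]
    refine tsum_of_norm_bounded (hasSum_half_pow_succ (τ y)) fun i => ?_
    by_cases hyC : y ∈ C i
    · exact (hφθ i k hk y).trans (hθτ i y hyC)
    · rw [iteratedFDeriv_eq_zero_of_isClosed (hC i) (hφC i) k hyC, norm_zero]
      exact mul_nonneg (by positivity) (hτ y hy)

end Sums

section FiniteDim

variable {E : Type} [NormedAddCommGroup E] [NormedSpace ℝ E] [FiniteDimensional ℝ E]

lemma exists_contDiff_two_eq_one {K O : Set E} (hK : IsClosed K) (hO : IsOpen O) (hKO : K ⊆ O) :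
    ∃ ξ : E → ℝ, ContDiff ℝ 2 ξ ∧ (∀ y, 0 ≤ ξ y) ∧ (∀ y ∈ K, ξ y = 1) ∧ ∀ y ∉ O, ξ y = 0 := by
  obtain ⟨a, ha, hac, har⟩ := hO.exists_contDiff_support_eq (n := 2)
  obtain ⟨b, hb, hbc, hbr⟩ := hK.isOpen_compl.exists_contDiff_support_eq (n := 2)
  have ha0 : ∀ y, 0 ≤ a y := fun y => (har (mem_range_self y)).1
  have hb0 : ∀ y, 0 ≤ b y := fun y => (hbr (mem_range_self y)).1
  have hne : ∀ y, a y + b y ≠ 0 := fun y h => by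
    have h1 : a y = 0 := by linarith [ha0 y, hb0 y]
    have h2 : b y = 0 := by linarith [ha0 y, hb0 y]
    have h3 : y ∉ Function.support a := by simpa using h1
    have h4 : y ∉ Function.support b := by simpa using h2
    rw [ha] at h3
    rw [hb, notMem_compl_iff] at h4
    exact h3 (hKO h4)
  refine ⟨fun y => a y / (a y + b y), hac.div (hac.add hbc) hne,
    fun y => div_nonneg (ha0 y) (add_nonneg (ha0 y) (hb0 y)), fun y hy => ?_, fun y hy => ?_⟩
  · have : b y = 0 := by
      rw [← Function.notMem_support, hb]; simpa using hy
    have h2 := hne y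
    simp only [this, add_zero] at h2 ⊢
    exact div_self h2
  · have : a y = 0 := by rwa [← Function.notMem_support, ha]
    simp [this]

lemma exists_compact_exhaustion {U : Set E} (hU : IsOpen U) : ∃ C : ℕ → Set E,
    (∀ i, IsCompact (C i)) ∧ (∀ i, C i ⊆ interior (C (i + 1))) ∧ ⋃ i, C i = U ∧ C 0 = ∅ := by
  have := hU.locallyCompactSpace
  obtain ⟨A⟩ : Nonempty (CompactExhaustion U) := ⟨CompactExhaustion.choice U⟩
  refine ⟨fun i => Nat.casesOn i ∅ fun j => Subtype.val '' A j, fun i => ?_, fun i => ?_, ?_, rfl⟩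
  · cases i with
    | zero => exact isCompact_empty
    | succ j => exact (A.isCompact j).image continuous_subtype_val
  · cases i with
    | zero => exact empty_subset _
    | succ j =>
      refine (image_mono (A.subset_interior_succ j)).trans ?_
      exact hU.isOpenEmbedding_subtypeVal.isOpenMap.image_interior_subset _
  · ext x
    rw [mem_iUnion]
    constructor
    · rintro ⟨i, hi⟩
      cases i with
      | zero => exact absurd hi (notMem_empty x)
      | succ j => obtain ⟨z, -, rfl⟩ := hi; exact z.2
    · intro hx
      obtain ⟨j, hj⟩ := mem_iUnion.1 (A.iUnion_eq ▸ mem_univ (⟨x, hx⟩ : U))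
      exact ⟨j + 1, ⟨x, hx⟩, hj, rfl⟩

end FiniteDim

section Local

variable {E : Type} [NormedAddCommGroup E] [InnerProductSpace ℝ E] [FiniteDimensional ℝ E]

omit [InnerProductSpace ℝ E] [FiniteDimensional ℝ E] in
lemma exists_continuousOn_mem_of_local_const {U : Set E} (P : E → ℝ → Prop)
    (hP : ∀ y ∈ U, ∀ t t', 0 < t' → t' ≤ t → P y t → P y t')
    (hpos : ∀ y ∈ U, ∀ t, P y t → 0 < t)
    (hloc : ∀ x ∈ U, ∃ t, ∃ ρ > 0, ∀ y ∈ ball x ρ, y ∈ U → P y t) :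
    ∃ τ : E → ℝ, ContinuousOn τ U ∧ ∀ y ∈ U, P y (τ y) := by
  obtain ⟨g, hg⟩ := exists_continuous_forall_mem_convex_of_local_const (X := U)
    (t := fun y => {t | P y t})
    (fun y => Set.OrdConnected.convex ⟨fun a ha b hb t ht =>
      hP y y.2 b t ((hpos y y.2 a ha).trans_le ht.1) ht.2 hb⟩)
    (fun x => by
      obtain ⟨t, ρ, hρ, h⟩ := hloc x x.2
      refine ⟨t, ?_⟩
      filter_upwards [ball_mem_nhds x hρ] with y hy using h y hy y.2)
  classical
  refine ⟨fun y => if h : y ∈ U then g ⟨y, h⟩ else 0, ?_, fun y hy => ?_⟩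
  · rw [continuousOn_iff_continuous_domRestrict]
    refine g.continuous.congr fun y => ?_
    simp [Set.domRestrict]
  · simpa [hy] using hg ⟨y, hy⟩

omit [FiniteDimensional ℝ E] in
lemma GoodScale.mono {U : Set E} {f : E → ℝ} {b ε : ℝ} {y : E} {t t' c L : ℝ}
    (h : GoodScale U f b ε y t c L) (ht' : 0 < t') (htt : t' ≤ t) :
    GoodScale U f b ε y t' c L := by
  have hsub : ball y (2 * t') ⊆ ball y (2 * t) := ball_subset_ball (by linarith)
  have hc := h.c_nonneg
  have hL := h.L_nonneg
  have h1 : t' * (c + L + 1) ≤ t * (c + L + 1) := by gcongr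
  have h2 : t' * (L + 1) ≤ t * (L + 1) := by gcongr
  exact ⟨ht', htt.trans h.le_one, hsub.trans h.subset, hc, hL,
    ⟨convex_ball _ _, fun p hp q hq => h.convex.2 (hsub hp) (hsub hq)⟩,
    fun p hp q hq => h.lipschitz p (hsub hp) q (hsub hq), by linarith [h.le_sub],
    by linarith [h.lt_eps]⟩

omit [FiniteDimensional ℝ E] in
lemma StrongConvexOn.convexOn' {W : Set E} {f : E → ℝ} {c : ℝ} (hc : 0 ≤ c)
    (h : StrongConvexOn W c f) : ConvexOn ℝ W f := strongConvexOn_zero.1 (h.mono hc)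

lemma exists_goodScale {U : Set E} {f b ε : E → ℝ} (hU : IsOpen U)
    (hε : ContinuousOn ε U) (hε0 : ∀ x ∈ U, 0 < ε x)
    (H : ∀ x ∈ U, ∃ ρ > 0, ∃ c ≥ 0, ∃ γ > 0, ball x ρ ⊆ U ∧ StrongConvexOn (ball x ρ) c f ∧
      ∀ y ∈ ball x ρ, b y + γ ≤ c) :
    ∃ τ : E → ℝ, ContinuousOn τ U ∧
      ∀ y ∈ U, ∃ c L, GoodScale U f (b y) (ε y) y (τ y) c L := by
  refine exists_continuousOn_mem_of_local_const
    (P := fun y t => ∃ c L, GoodScale U f (b y) (ε y) y t c L)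
    (fun y _ t t' ht' htt ⟨c, L, h⟩ => ⟨c, L, h.mono ht' htt⟩)
    (fun y _ t ⟨c, L, h⟩ => h.pos) fun x hx => ?_
  obtain ⟨ρ, hρ, c, hc, γ, hγ, hρU, hconv, hb⟩ := H x hx
  obtain ⟨L, V, hV, hVL⟩ := (hconv.convexOn' hc).locallyLipschitzOn isOpen_ball
    (mem_ball_self hρ)
  rw [isOpen_ball.nhdsWithin_eq (mem_ball_self hρ)] at hV
  obtain ⟨ρ₁, hρ₁, hρ₁V⟩ := Metric.mem_nhds_iff.1 hV
  have hεx := (hε.continuousAt (hU.mem_nhds hx)).eventually_const_lt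
    (half_lt_self (hε0 x hx))
  obtain ⟨ρ₂, hρ₂, hρ₂ε⟩ := Metric.eventually_nhds_iff_ball.1 hεx
  have hL0 : (0 : ℝ) ≤ L := L.2
  set t := min (min 1 (min (ρ / 4) (ρ₁ / 4)))
    (min (γ / (c + L + 1)) (ε x / 2 / (L + 1))) with ht
  have hεp : 0 < ε x / 2 := half_pos (hε0 x hx)
  have ht0 : 0 < t := by
    refine lt_min (lt_min one_pos (lt_min ?_ ?_)) (lt_min ?_ ?_) <;> positivity
  have t1 : t ≤ 1 := (min_le_left _ _).trans (min_le_left _ _)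
  have t2 : t ≤ ρ / 4 := (min_le_left _ _).trans ((min_le_right _ _).trans (min_le_left _ _))
  have t3 : t ≤ ρ₁ / 4 := (min_le_left _ _).trans ((min_le_right _ _).trans (min_le_right _ _))
  have t4 : t * (c + L + 1) ≤ γ := by
    rw [← le_div_iff₀ (by positivity)]; exact (min_le_right _ _).trans (min_le_left _ _)
  have t5 : t * (L + 1) ≤ ε x / 2 := by
    rw [← le_div_iff₀ (by positivity)]; exact (min_le_right _ _).trans (min_le_right _ _)
  refine ⟨t, min (ρ / 2) (min (ρ₁ / 2) ρ₂), by positivity, fun y hy _ => ⟨c, L, ?_⟩⟩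
  rw [mem_ball, lt_min_iff, lt_min_iff] at hy
  have s1 : ball y (2 * t) ⊆ ball x ρ := ball_subset_ball' (by linarith)
  have s2 : ball y (2 * t) ⊆ V := (ball_subset_ball' (by linarith)).trans hρ₁V
  refine ⟨ht0, t1, s1.trans hρU, hc, hL0,
    ⟨convex_ball _ _, fun p hp q hq => hconv.2 (s1 hp) (s1 hq)⟩, fun p hp q hq => ?_, ?_, ?_⟩
  · have := hVL.dist_le_mul p (s2 hp) q (s2 hq)
    rwa [Real.dist_eq, dist_eq_norm] at this
  · linarith [hb y (by rw [mem_ball]; linarith)]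
  · exact t5.trans_lt (hρ₂ε y hy.2.2)

end Local

section AE

variable {E : Type} [NormedAddCommGroup E] [InnerProductSpace ℝ E] [FiniteDimensional ℝ E]
variable [MeasurableSpace E] [BorelSpace E] (μ : Measure E) [μ.IsAddHaarMeasure]

lemma ae_second_order_of_locally_convexOn {U : Set E} {f : E → ℝ}
    (H : ∀ x ∈ U, ∃ ρ > 0, ConvexOn ℝ (ball x ρ) f) :
    ∀ᵐ x ∂μ, x ∈ U → ∃ (p : E →L[ℝ] ℝ) (A : E →L[ℝ] E →L[ℝ] ℝ),
      (fun v => f (x + v) - f x - p v - 1 / 2 * A v v) =o[𝓝 0] fun v => ‖v‖ ^ 2 := by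
  rw [ae_iff]
  refine measure_null_of_locally_null _ fun x hx => ?_
  simp only [mem_ofPred_eq, Classical.not_imp] at hx
  obtain ⟨ρ, hρ, hc⟩ := H x hx.1
  have h := hc.ae_second_order μ isOpen_ball
  rw [ae_iff] at h
  refine ⟨_, inter_mem_nhdsWithin _ (ball_mem_nhds x hρ), measure_mono_null ?_ h⟩
  rintro y ⟨hy1, hy2⟩ hcon
  exact hy1 fun _ => hcon hy2

end AE

section Gluing

variable {E : Type} [NormedAddCommGroup E] [InnerProductSpace ℝ E] [FiniteDimensional ℝ E]

lemma measure_sdiff_iUnion_lt {X : Type} [MeasurableSpace X] {ν : Measure X} {C K : ℕ → Set X} {U : Set X}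
    (hCU : ⋃ i, C i = U) (hC0 : C 0 = ∅) {δ : ENNReal} {ε : ℕ → ENNReal} (hε : ∑' i, ε i < δ)
    (h : ∀ i, ν ((C (i + 1) \ C i) \ K i) < ε i) : ν (U \ ⋃ i, K i) < δ := by
  refine lt_of_le_of_lt ?_ hε
  calc ν (U \ ⋃ i, K i) ≤ ν (⋃ i, (C (i + 1) \ C i) \ K i) := by
        refine measure_mono ?_
        rintro x ⟨hx, hxK⟩
        classical
        have hex : ∃ i, x ∈ C i := by rw [← hCU] at hx; exact mem_iUnion.1 hx
        have h0 : Nat.find hex ≠ 0 := fun h0 => by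
          have := Nat.find_spec hex
          rw [h0, hC0] at this
          exact this
        obtain ⟨i, hi⟩ := Nat.exists_eq_succ_of_ne_zero h0
        refine mem_iUnion.2 ⟨i, ⟨?_, ?_⟩, fun hx => hxK (mem_iUnion.2 ⟨i, hx⟩)⟩
        · have := Nat.find_spec hex
          rwa [hi] at this
        · exact Nat.find_min hex (by omega)
    _ ≤ ∑' i, ν ((C (i + 1) \ C i) \ K i) := measure_iUnion_le _
    _ ≤ ∑' i, ε i := ENNReal.tsum_le_tsum fun i => (h i).le

section Approximants

variable [MeasurableSpace E] [BorelSpace E] (μ : Measure E) [μ.IsAddHaarMeasure]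

lemma exists_local_approximants {U : Set E} {f : E → ℝ} (hf : ContinuousOn f U)
    (hae : ∀ᵐ x ∂μ, x ∈ U → ∃ (p : E →L[ℝ] ℝ) (A : E →L[ℝ] E →L[ℝ] ℝ),
      (fun v => f (x + v) - f x - p v - 1 / 2 * A v v) =o[𝓝 0] fun v => ‖v‖ ^ 2)
    {C : ℕ → Set E} (hC : ∀ i, IsCompact (C i)) (hCi : ∀ i, C i ⊆ interior (C (i + 1)))
    (hCU : ⋃ i, C i = U) (hC0 : C 0 = ∅) {δ : ENNReal} (hδ : δ ≠ 0) :
    ∃ (K : ℕ → Set E) (F : ℕ → E → ℝ), (∀ i, IsCompact (K i)) ∧ (∀ i, K i ⊆ C (i + 1) \ C i) ∧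
      (∀ i, EqOn (F i) f (C (i + 2))) ∧ μ (U \ ⋃ i, K i) < δ ∧
      ∀ i, ∀ σ > 0, ∃ (s : ℝ) (h : E → ℝ), 0 < s ∧ s < σ ∧ (∀ x ∈ K i, h x = F i x) ∧
        ContDiff ℝ 2 (fun y => h y - moll μ s (F i) y) ∧
        (∀ y, y ∉ thickening σ (K i) → h y - moll μ s (F i) y = 0) ∧
        ∀ k ≤ 2, ∀ y, ‖iteratedFDeriv ℝ k (fun y => h y - moll μ s (F i) y) y‖ ≤ σ := by
  have hsub : ∀ i, C i ⊆ U := fun i => hCU ▸ subset_iUnion C i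
  choose F hFc hF using fun i => exists_continuous_eqOn (hC (i + 2)).isClosed (hf.mono (hsub (i + 2)))
  obtain ⟨ε, hε0, hε⟩ := ENNReal.exists_pos_sum_of_countable' hδ ℕ
  have haeF : ∀ i, ∀ᵐ x ∂μ, x ∈ C (i + 1) \ C i → ∃ (p : E →L[ℝ] ℝ) (A : E →L[ℝ] E →L[ℝ] ℝ),
      (fun v => F i (x + v) - F i x - p v - 1 / 2 * A v v) =o[𝓝 0] fun v => ‖v‖ ^ 2 := by
    intro i
    filter_upwards [hae] with x hx hxC
    obtain ⟨p, A, h⟩ := hx (hsub _ hxC.1)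
    refine ⟨p, A, h.congr' ?_ EventuallyEq.rfl⟩
    have hn : C (i + 2) ∈ 𝓝 (x + 0) := by
      rw [add_zero]; exact mem_interior_iff_mem_nhds.1 (hCi (i + 1) hxC.1)
    have ht : Tendsto (fun v : E => x + v) (𝓝 0) (𝓝 (x + 0)) := by
      exact (continuous_const.add continuous_id).tendsto 0
    filter_upwards [ht hn] with v hv
    rw [hF i hv, hF i (interior_subset (hCi (i + 1) hxC.1))]
  choose K hKD hK hKm R p A hA hrem using fun i =>
    exists_isCompact_uniform_second_order μ (hFc i) (hC (i + 1)) sdiff_subset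
      ((hC (i + 1)).isClosed.measurableSet.diff (hC i).isClosed.measurableSet) (haeF i) (hε0 i).ne'
  refine ⟨K, F, hK, hKD, hF, measure_sdiff_iUnion_lt hCU hC0 hε hKm, fun i σ hσ => ?_⟩
  obtain ⟨s, h, hs, hsσ, hh, hhK, hht, hhd⟩ := exists_contDiff_two_eqOn μ (hFc i) (hK i) (hA i) (hrem i) hσ
  exact ⟨s, h, hs, hsσ, hhK, hh.sub ((contDiff_moll μ (hFc i) hs).of_le two_le_smooth),
    fun y hy => by rw [hht y hy, sub_self], hhd⟩

end Approximants

lemma exists_separating_open_sets {X : Type} [TopologicalSpace X] [T2Space X] {U : Set X} {C K : ℕ → Set X}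
    (hCi : ∀ i, C i ⊆ interior (C (i + 1))) (hCU : ⋃ i, C i = U)
    (hK : ∀ i, IsCompact (K i)) (hKD : ∀ i, K i ⊆ C (i + 1) \ C i) :
    ∃ O W : ℕ → Set X, (∀ i, IsOpen (O i)) ∧ (∀ i, IsOpen (W i)) ∧ (∀ i, K i ⊆ O i) ∧
      (∀ i, O i ⊆ C (i + 2)) ∧ (∀ i, W i ⊆ C (i + 2)) ∧ (∀ i j, j ≠ i → ∀ x ∈ K j, x ∉ O i) ∧
      (∀ i j, ∀ x ∈ K j, x ∉ W i) ∧ ∀ x ∈ U, (∀ j, x ∉ K j) → ∃ i, x ∈ W i := by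
  have hm : Monotone C := monotone_nat_of_le_succ fun i => (hCi i).trans interior_subset
  have hKm : ∀ {i j x}, i ≤ j → x ∈ K j → x ∉ C i := fun hij hx hxC => (hKD _ hx).2 (hm hij hxC)
  refine ⟨fun i => interior (C (i + 2)) \ ⋃ j ∈ (Finset.range (i + 2)).erase i, K j,
    fun i => interior (C i) \ ⋃ j ∈ Finset.range i, K j, fun i => ?_, fun i => ?_, fun i x hx => ?_,
    fun i => sdiff_subset.trans interior_subset,
    fun i => sdiff_subset.trans (interior_subset.trans (hm (by omega))), ?_, ?_, ?_⟩
  · exact isOpen_interior.sdiff (isClosed_biUnion_finset fun j _ => (hK j).isClosed)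
  · exact isOpen_interior.sdiff (isClosed_biUnion_finset fun j _ => (hK j).isClosed)
  · refine ⟨hCi _ (hKD i hx).1, fun hx' => ?_⟩
    obtain ⟨j, hj, hxj⟩ := mem_iUnion₂.1 hx'
    rcases lt_trichotomy i j with h | h | h
    · exact (hKm h hxj) (hKD i hx).1
    · exact (Finset.mem_erase.1 hj).1 h.symm
    · exact (hKm h hx) (hKD j hxj).1
  · intro i j hij x hx hxO
    by_cases h : j < i + 2
    · exact hxO.2 (mem_iUnion₂.2 ⟨j, by simp [hij, h], hx⟩)
    · exact hKm (not_lt.1 h) hx (interior_subset hxO.1)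
  · intro i j x hx hxW
    by_cases h : j < i
    · exact hxW.2 (mem_iUnion₂.2 ⟨j, by simp [h], hx⟩)
    · exact hKm (not_lt.1 h) hx (interior_subset hxW.1)
  · intro x hx hxK
    rw [← hCU] at hx
    obtain ⟨i, hi⟩ := mem_iUnion.1 hx
    refine ⟨i + 1, hCi i hi, fun h => ?_⟩
    obtain ⟨j, -, hj⟩ := mem_iUnion₂.1 h
    exact hxK j hj

omit [InnerProductSpace ℝ E] [FiniteDimensional ℝ E] in
lemma exists_weight {U : Set E} {τ : E → ℝ} (hτ : ContinuousOn τ U) (hτ0 : ∀ y ∈ U, 0 < τ y) {C : Set E}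
    (hC : IsCompact C) (hCU : C ⊆ U) {a : ℝ} (ha : 0 < a) :
    ∃ θ > 0, θ ≤ a ∧ ∀ y ∈ C, θ ≤ a * τ y := by
  rcases C.eq_empty_or_nonempty with rfl | hne
  · exact ⟨a, ha, le_rfl, by simp⟩
  obtain ⟨x, hx, hmin⟩ := hC.exists_isMinOn hne (hτ.mono hCU)
  refine ⟨min a (a * τ x), lt_min ha (mul_pos ha (hτ0 x (hCU hx))), min_le_left _ _, fun y hy => ?_⟩
  exact (min_le_right _ _).trans (mul_le_mul_of_nonneg_left (hmin hy) ha.le)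

lemma exists_contDiff_two_support {K O W C : Set E} (hK : IsClosed K) (hO : IsOpen O) (hW : IsOpen W)
    (hKO : K ⊆ O) (hOC : O ⊆ C) (hWC : W ⊆ C) (hC : IsCompact C) :
    ∃ (ξ χ : E → ℝ) (M : ℝ), 0 < M ∧ ContDiff ℝ 2 ξ ∧ ContDiff ℝ 2 χ ∧ (∀ y, 0 ≤ ξ y) ∧
      (∀ y ∈ K, ξ y = 1) ∧ (∀ y ∉ O, ξ y = 0) ∧ (∀ y, 0 ≤ χ y) ∧ (∀ y ∈ W, 0 < χ y) ∧
      (∀ y ∉ W, χ y = 0) ∧ (∀ k ≤ 2, ∀ y, ‖iteratedFDeriv ℝ k ξ y‖ ≤ M) ∧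
      ∀ k ≤ 2, ∀ y, ‖iteratedFDeriv ℝ k χ y‖ ≤ M := by
  obtain ⟨ξ, hξ, hξ0, hξ1, hξO⟩ := exists_contDiff_two_eq_one hK hO hKO
  obtain ⟨χ, hχs, hχ, hχr⟩ := hW.exists_contDiff_support_eq (n := 2)
  have hχ0 : ∀ y, 0 ≤ χ y := fun y => (hχr (mem_range_self y)).1
  have hχW : ∀ y ∉ W, χ y = 0 := fun y hy => by
    by_contra h
    exact hy (hχs ▸ Function.mem_support.2 h)
  obtain ⟨M, hM, hM'⟩ := exists_norm_iteratedFDeriv_le_of_isCompact hξ hC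
    fun y hy => hξO y fun h => hy (hOC h)
  obtain ⟨N, hN, hN'⟩ := exists_norm_iteratedFDeriv_le_of_isCompact hχ hC
    fun y hy => hχW y fun h => hy (hWC h)
  refine ⟨ξ, χ, max M N, lt_max_of_lt_left hM, hξ, hχ, hξ0, hξ1, hξO, hχ0, fun y hy => ?_, hχW,
    fun k hk y => (hM' k hk y).trans (le_max_left _ _),
    fun k hk y => (hN' k hk y).trans (le_max_right _ _)⟩
  rw [← hχs] at hy
  exact (hχ0 y).lt_of_ne (Function.mem_support.1 hy).symm

omit [FiniteDimensional ℝ E] in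
lemma norm_iteratedFDeriv_const_mul_add_const_mul_le {ξ χ : E → ℝ} (hξ : ContDiff ℝ 2 ξ) (hχ : ContDiff ℝ 2 χ)
    {a b : ℝ} (ha : 0 ≤ a) (hb : 0 ≤ b) {M : ℝ} {k : ℕ} (hk : k ≤ 2) {y : E}
    (hξM : ‖iteratedFDeriv ℝ k ξ y‖ ≤ M) (hχM : ‖iteratedFDeriv ℝ k χ y‖ ≤ M) :
    ‖iteratedFDeriv ℝ k (fun y => a * ξ y + b * χ y) y‖ ≤ (a + b) * M := by
  have hk' : (k : WithTop ℕ∞) ≤ 2 := by exact_mod_cast hk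
  have h1 := (hξ.of_le hk').contDiffAt (x := y)
  have h2 := (hχ.of_le hk').contDiffAt (x := y)
  have e : iteratedFDeriv ℝ k (fun y => a * ξ y + b * χ y) y
      = a • iteratedFDeriv ℝ k ξ y + b • iteratedFDeriv ℝ k χ y := by
    have e1 : iteratedFDeriv ℝ k (fun y => a • ξ y) y = a • iteratedFDeriv ℝ k ξ y :=
      iteratedFDeriv_const_smul_apply (a := a) h1
    have e2 : iteratedFDeriv ℝ k (fun y => b • χ y) y = b • iteratedFDeriv ℝ k χ y :=
      iteratedFDeriv_const_smul_apply (a := b) h2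
    rw [← e1, ← e2]
    exact iteratedFDeriv_add_apply (h1.const_smul a) (h2.const_smul b)
  rw [e]
  refine (norm_add_le _ _).trans ?_
  rw [norm_smul, norm_smul, Real.norm_of_nonneg ha, Real.norm_of_nonneg hb]
  nlinarith

end Gluing

section Assembly

variable {E : Type} [NormedAddCommGroup E] [InnerProductSpace ℝ E] [FiniteDimensional ℝ E]
variable [MeasurableSpace E] [BorelSpace E] (μ : Measure E) [μ.IsAddHaarMeasure]

lemma exists_scale_and_correction {U : Set E} (hU : IsOpen U) {f τ : E → ℝ} (hf : ContinuousOn f U)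
    (hae : ∀ᵐ x ∂μ, x ∈ U → ∃ (p : E →L[ℝ] ℝ) (A : E →L[ℝ] E →L[ℝ] ℝ),
      (fun v => f (x + v) - f x - p v - 1 / 2 * A v v) =o[𝓝 0] fun v => ‖v‖ ^ 2)
    (hτ : ContinuousOn τ U) (hτ0 : ∀ y ∈ U, 0 < τ y) {δ : ENNReal} (hδ : δ ≠ 0) :
    ∃ r w : E → ℝ, ContDiff ℝ 2 r ∧ ContDiff ℝ 2 w ∧ (∀ y ∈ U, 0 < r y) ∧
      (∀ k ≤ 2, ∀ y ∈ U, ‖iteratedFDeriv ℝ k r y‖ ≤ τ y) ∧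
      (∀ k ≤ 2, ∀ y ∈ U, ‖iteratedFDeriv ℝ k w y‖ ≤ τ y) ∧
      μ {x ∈ U | f x ≠ moll μ (r x) f x + w x} < δ := by
  obtain ⟨C, hC, hCi, hCU, hC0⟩ := exists_compact_exhaustion hU
  have hsub : ∀ i, C i ⊆ U := fun i => hCU ▸ subset_iUnion C i
  obtain ⟨K, F, hK, hKD, hF, hKm, hsurg⟩ := exists_local_approximants μ hf hae hC hCi hCU hC0 hδ
  obtain ⟨O, W, hO, hW, hKO, hOC, hWC, hOK, hWK, hcov⟩ := exists_separating_open_sets hCi hCU hK hKD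
  choose θ hθ0 hθ1 hθτ using fun i => exists_weight hτ hτ0 (hC (i + 2)) (hsub (i + 2))
    (a := (1 / 2 : ℝ) ^ (i + 1)) (by positivity)
  choose ξ χ M hM hξ hχ hξ0 hξ1 hξO hχ0 hχW hχW' hξM hχM using fun i =>
    exists_contDiff_two_support (hK i).isClosed (hO i) (hW i) (hKO i) (hOC i) (hWC i) (hC (i + 2))
  choose d hd hdO using fun i => (hK i).exists_thickening_subset_open (hO i) (hKO i)
  have hσ : ∀ i, 0 < min (d i) (min (θ i) (θ i / (2 * M i))) := fun i =>
    lt_min (hd i) (lt_min (hθ0 i) (div_pos (hθ0 i) (mul_pos two_pos (hM i))))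
  choose s h hs hsσ hhK hw hw0 hwd using fun i => hsurg i _ (hσ i)
  set σ : ℕ → ℝ := fun i => min (d i) (min (θ i) (θ i / (2 * M i))) with hσdef
  have hσO : ∀ i, thickening (σ i) (K i) ⊆ O i := fun i =>
    (thickening_mono (min_le_left _ _) _).trans (hdO i)
  have hwO : ∀ i, ∀ y ∉ O i, h i y - moll μ (s i) (F i) y = 0 := fun i y hy =>
    hw0 i y fun hy' => hy (hσO i hy')
  have hsM : ∀ i, s i ≤ θ i / (2 * M i) := fun i =>
    (hsσ i).le.trans ((min_le_right _ _).trans (min_le_right _ _))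
  obtain ⟨hr2, hrs, hrτ⟩ := contDiff_two_tsum (fun y hy => (hτ0 y hy).le) (C := fun i => C (i + 2))
    (fun i => (hC (i + 2)).isClosed) hθ1 hθτ
    (φ := fun i y => s i * ξ i y + θ i / (2 * M i) * χ i y)
    (fun i => (contDiff_const.mul (hξ i)).add (contDiff_const.mul (hχ i)))
    (fun i y hy => by
      rw [hξO i y fun hy' => hy (hOC i hy'), hχW' i y fun hy' => hy (hWC i hy')]; ring)
    (fun i k hk y => by
      have hM' := hM i
      have hθ' := hθ0 i
      refine (norm_iteratedFDeriv_const_mul_add_const_mul_le (hξ i) (hχ i) (hs i).le (by positivity) hk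
        (hξM i k hk y) (hχM i k hk y)).trans ?_
      calc (s i + θ i / (2 * M i)) * M i ≤ (θ i / (2 * M i) + θ i / (2 * M i)) * M i := by
            gcongr; exact hsM i
        _ = θ i := by field_simp; ring)
  obtain ⟨hw2, hws, hwτ⟩ := contDiff_two_tsum (fun y hy => (hτ0 y hy).le) (C := fun i => C (i + 2))
    (fun i => (hC (i + 2)).isClosed) hθ1 hθτ
    (φ := fun i y => h i y - moll μ (s i) (F i) y) hw
    (fun i y hy => hwO i y fun hy' => hy (hOC i hy'))
    (fun i k hk y => (hwd i k hk y).trans ((min_le_right _ _).trans (min_le_left _ _)))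
  have hrK : ∀ i, ∀ x ∈ K i, ∑' j, (s j * ξ j x + θ j / (2 * M j) * χ j x) = s i := by
    intro i x hx
    rw [tsum_eq_single i fun j hj => by
      rw [hξO j x (hOK j i hj.symm x hx), hχW' j x (hWK j i x hx)]; ring]
    rw [hξ1 i x hx, hχW' i x (hWK i i x hx)]; ring
  have hwK : ∀ i, ∀ x ∈ K i, ∑' j, (h j x - moll μ (s j) (F j) x) = h i x - moll μ (s i) (F i) x :=
    fun i x hx => tsum_eq_single i fun j hj => hwO j x (hOK j i hj.symm x hx)
  refine ⟨_, _, hr2, hw2, fun y hy => ?_, hrτ, hwτ, lt_of_le_of_lt (measure_mono ?_) hKm⟩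
  · by_cases hyK : ∃ i, y ∈ K i
    · obtain ⟨i, hi⟩ := hyK
      simp only [hrK i y hi, hs i]
    · obtain ⟨i, hi⟩ := hcov y hy (not_exists.1 hyK)
      have h0 : ∀ j, 0 ≤ s j * ξ j y + θ j / (2 * M j) * χ j y := fun j =>
        add_nonneg (mul_nonneg (hs j).le (hξ0 j y))
          (mul_nonneg (div_pos (hθ0 j) (mul_pos two_pos (hM j))).le (hχ0 j y))
      refine (hrs y).tsum_pos h0 i ?_
      exact add_pos_of_nonneg_of_pos (mul_nonneg (hs i).le (hξ0 i y))
          (mul_pos (div_pos (hθ0 i) (mul_pos two_pos (hM i))) (hχW i y hi))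
  · rintro x ⟨hxU, hx⟩
    refine ⟨hxU, fun hxK => hx ?_⟩
    obtain ⟨i, hi⟩ := mem_iUnion.1 hxK
    have hFf : ∀ y, ‖y - x‖ < s i → f y = F i y := fun y hy =>
      (hF i (hOC i (hσO i (mem_thickening_iff.2
        ⟨x, hi, by rw [dist_eq_norm]; exact hy.trans (hsσ i)⟩)))).symm
    simp only [hrK i x hi, hwK i x hi]
    rw [moll_congr μ (hs i) fun y hy => hFf y (hy.trans (half_lt_self (hs i))), hhK i x hi,
      hFf x (by simpa using hs i)]
    ring

/-- A function whose modulus of strong convexity is locally larger than a prescribed `b` agrees, off a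
set of small measure, with a `C²` function whose second differences are bounded below by `b`. -/
theorem exists_contDiffOn_two_secondDiffGE {U : Set E} (hU : IsOpen U) {f b ε : E → ℝ}
    (hε : ContinuousOn ε U) (hε0 : ∀ x ∈ U, 0 < ε x)
    (H : ∀ x ∈ U, ∃ ρ > 0, ∃ c ≥ 0, ∃ γ > 0, ball x ρ ⊆ U ∧ StrongConvexOn (ball x ρ) c f ∧
      ∀ y ∈ ball x ρ, b y + γ ≤ c) {δ : ENNReal} (hδ : δ ≠ 0) :
    ∃ g : E → ℝ, ContDiffOn ℝ 2 g U ∧ (∀ y ∈ U, SecondDiffGE g (b y) y) ∧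
      μ {x ∈ U | f x ≠ g x} < δ ∧ ∀ y ∈ U, |f y - g y| < ε y := by
  obtain ⟨τ, hτ, hscale⟩ := exists_goodScale hU hε hε0 H
  choose! c L hscale using hscale
  have hf : ContinuousOn f U := fun y hy =>
    ((hscale y hy).continuousOn.continuousAt (isOpen_ball.mem_nhds
      (mem_ball_self (mul_pos two_pos (hscale y hy).pos)))).continuousWithinAt
  have hae := ae_second_order_of_locally_convexOn μ (U := U) (f := f) fun x hx => by
    obtain ⟨ρ, hρ, c, hc, -, -, -, hs, -⟩ := H x hx
    exact ⟨ρ, hρ, hs.convexOn' hc⟩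
  obtain ⟨r, w, hr, hw, hr0, hrτ, hwτ, hm⟩ :=
    exists_scale_and_correction μ hU hf hae hτ (fun y hy => (hscale y hy).pos) hδ
  have hp := fun y hy => (hscale y hy).perturb μ hr.contDiffAt (hr0 y hy) (fun k hk => hrτ k hk y hy)
    hw.contDiffAt fun k hk => hwτ k hk y hy
  exact ⟨fun y => moll μ (r y) f y + w y, fun y hy => (hp y hy).1.contDiffWithinAt,
    fun y hy => (hp y hy).2.1, hm, fun y hy => (hp y hy).2.2⟩

end Assembly

section Main

variable {n : ℕ} {U : Set (EuclideanSpace ℝ (Fin n))} {f : EuclideanSpace ℝ (Fin n) → ℝ}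

lemma stronglyConvexOnSet_iff {η : ℝ} : StronglyConvexOnSet η U f ↔ StrongConvexOn U η f :=
  strongConvexOn_iff_convex.symm

/-- A continuous positive modulus of strong convexity on a neighbourhood of every point. -/
lemma LocallyStronglyConvexOn.exists_modulus (hf : LocallyStronglyConvexOn U f) :
    ∃ b : EuclideanSpace ℝ (Fin n) → ℝ, ContinuousOn b U ∧ ∀ y ∈ U, 0 < b y ∧
      ∃ ρ > 0, ball y ρ ⊆ U ∧ StrongConvexOn (ball y ρ) (2 * b y) f := by
  refine exists_continuousOn_mem_of_local_const (fun y t => 0 < t ∧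
    ∃ ρ > 0, ball y ρ ⊆ U ∧ StrongConvexOn (ball y ρ) (2 * t) f) ?_ (fun y _ t h => h.1) ?_
  · rintro y - t t' ht' htt ⟨-, ρ, hρ, hs, hc⟩
    exact ⟨ht', ρ, hρ, hs, hc.mono (by linarith)⟩
  · intro x hx
    obtain ⟨ρ, hρ, hs, η, hη, hc⟩ := hf x hx
    refine ⟨η / 2, ρ / 2, by positivity, fun y hy _ => ⟨by positivity, ρ / 2, by positivity, ?_, ?_⟩⟩
    · exact (ball_subset_ball' (by linarith [mem_ball.1 hy])).trans hs
    · rw [mul_div_cancel₀ _ two_ne_zero]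
      have hb : ball y (ρ / 2) ⊆ ball x ρ := ball_subset_ball' (by linarith [mem_ball.1 hy])
      have hc' := stronglyConvexOnSet_iff.1 hc
      exact ⟨convex_ball _ _, fun a ha b hb' => hc'.2 (hb ha) (hb hb')⟩

lemma locallyStronglyConvexOn_of_secondDiffGE (hU : IsOpen U) {b g : EuclideanSpace ℝ (Fin n) → ℝ}
    (hb : ContinuousOn b U) (hb0 : ∀ x ∈ U, 0 < b x) (hg : ContinuousOn g U)
    (h : ∀ y ∈ U, SecondDiffGE g (b y) y) : LocallyStronglyConvexOn U g := by
  intro x hx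
  have hn : ∀ᶠ y in 𝓝 x, y ∈ U ∧ b x / 2 < b y :=
    (hU.eventually_mem hx).and ((hb.continuousAt (hU.mem_nhds hx)).eventually_const_lt (half_lt_self (hb0 x hx)))
  obtain ⟨ρ, hρ, hball⟩ := Metric.eventually_nhds_iff_ball.1 hn
  refine ⟨ρ, hρ, fun y hy => (hball y hy).1, b x / 2, half_pos (hb0 x hx), stronglyConvexOnSet_iff.2 ?_⟩
  exact strongConvexOn_of_secondDiffGE (convex_ball x ρ) (hg.mono fun y hy => (hball y hy).1)
    fun y hy => (h y (hball y hy).1).mono (hball y hy).2.le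

end Main

end Auxiliary


/-- **Theorem 2.** A locally strongly convex `f : U → ℝ` admits, for every `ε₀ > 0` and every
continuous `ε : U → (0,1]`, a locally strongly convex `g ∈ C²(U)` with `|{f ≠ g}| < ε₀` and
`|f − g| < ε` on `U`; moreover, if `f` is `η`-strongly convex then for every `η̃ ∈ (0,η)` the
function `g` can be taken `η̃`-strongly convex. -/
theorem locally_strongly_convex_lusin_C2 (n : ℕ) (U : Set (EuclideanSpace ℝ (Fin n)))
    (hUo : IsOpen U) (hUc : Convex ℝ U) (f : EuclideanSpace ℝ (Fin n) → ℝ)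
    (hf : LocallyStronglyConvexOn U f)
    (ε₀ : ℝ) (hε₀ : 0 < ε₀) (ε : EuclideanSpace ℝ (Fin n) → ℝ)
    (hεcont : ContinuousOn ε U) (hεrange : ∀ x ∈ U, 0 < ε x ∧ ε x ≤ 1) :
    (∃ g : EuclideanSpace ℝ (Fin n) → ℝ,
      LocallyStronglyConvexOn U g ∧ ContDiffOn ℝ 2 g U ∧
      volume {x ∈ U | f x ≠ g x} < ENNReal.ofReal ε₀ ∧
      ∀ x ∈ U, |f x - g x| < ε x) ∧
    (∀ η : ℝ, 0 < η → StronglyConvexOnSet η U f →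
      ∀ η' : ℝ, 0 < η' → η' < η →
        ∃ g : EuclideanSpace ℝ (Fin n) → ℝ,
          StronglyConvexOnSet η' U g ∧ ContDiffOn ℝ 2 g U ∧
          volume {x ∈ U | f x ≠ g x} < ENNReal.ofReal ε₀ ∧
          ∀ x ∈ U, |f x - g x| < ε x) := by
  have hδ : ENNReal.ofReal ε₀ ≠ 0 := (ENNReal.ofReal_pos.2 hε₀).ne'
  have hε0 : ∀ x ∈ U, 0 < ε x := fun x hx => (hεrange x hx).1
  constructor
  · obtain ⟨b, hb, hbf⟩ := hf.exists_modulus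
    obtain ⟨g, hg, hgb, hgm, hgε⟩ := exists_contDiffOn_two_secondDiffGE volume hUo (f := f) (b := b)
      hεcont hε0 (fun x hx => by
        obtain ⟨h0, ρ, hρ, hs, hc⟩ := hbf x hx
        have hn : ∀ᶠ y in nhds x, b y < 3 / 2 * b x :=
          (hb.continuousAt (hUo.mem_nhds hx)).eventually_lt_const (by linarith)
        obtain ⟨ρ', hρ', hball⟩ := Metric.eventually_nhds_iff_ball.1 hn
        have hsub : Metric.ball x (min ρ ρ') ⊆ Metric.ball x ρ := Metric.ball_subset_ball (min_le_left _ _)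
        refine ⟨min ρ ρ', lt_min hρ hρ', 2 * b x, by positivity, b x / 2, by positivity, hsub.trans hs,
          ⟨convex_ball _ _, fun u hu v hv => hc.2 (hsub hu) (hsub hv)⟩, fun y hy => ?_⟩
        have := hball y (Metric.ball_subset_ball (min_le_right _ _) hy)
        linarith) hδ
    exact ⟨g, locallyStronglyConvexOn_of_secondDiffGE hUo hb (fun x hx => (hbf x hx).1) hg.continuousOn hgb,
      hg, hgm, hgε⟩
  · intro η hη hfη η' hη' hηη
    have hfη := stronglyConvexOnSet_iff.1 hfη
    obtain ⟨g, hg, hgb, hgm, hgε⟩ := exists_contDiffOn_two_secondDiffGE volume hUo (f := f)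
      (b := fun _ => η') hεcont hε0 (fun x hx => by
        obtain ⟨ρ, hρ, hs⟩ := Metric.isOpen_iff.1 hUo x hx
        exact ⟨ρ, hρ, η, hη.le, η - η', sub_pos.2 hηη, hs,
          ⟨convex_ball _ _, fun u hu v hv => hfη.2 (hs hu) (hs hv)⟩, fun y _ => by linarith⟩) hδ
    exact ⟨g, stronglyConvexOnSet_iff.2 (strongConvexOn_of_secondDiffGE hUc hg.continuousOn hgb),
      hg, hgm, hgε⟩
end

section
/- Assume −∞ < α < β < γ < ∞ and let f : [α,γ] → ℝ be convex and L-Lipschitz. If g : [α,γ] → ℝ is convex and satisfies f(α) = g(α), f(β) = g(β), and f(γ) = g(γ), then sup over x ∈ [α,γ] of |f(x) − g(x)| is at most 2L(γ − α). -/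
open Set

/-- If the secants of a convex function on `[a, c]` from an interior point `b` to both endpoints
have slope at most `L` in absolute value, then so have all secants from `b`. -/
theorem ConvexOn.abs_sub_le_of_endpoints {a b c L : ℝ} {h : ℝ → ℝ} (hh : ConvexOn ℝ (Icc a c) h)
    (hab : a < b) (hbc : b < c) (ha : |h a - h b| ≤ L * |a - b|) (hc : |h c - h b| ≤ L * |c - b|)
    {x : ℝ} (hx : x ∈ Icc a c) : |h x - h b| ≤ L * |x - b| := by
  rcases eq_or_ne x b with rfl | hxb
  · simp
  have hb : b ∈ Icc a c := ⟨hab.le, hbc.le⟩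
  have hac : a ≤ c := (hab.trans hbc).le
  have hleft := hh.secant_mono hb (left_mem_Icc.2 hac) hx hab.ne hxb hx.1
  have hright := hh.secant_mono hb hx (right_mem_Icc.2 hac) hxb hbc.ne' hx.2
  rw [← div_le_iff₀ (abs_pos.2 (sub_ne_zero.2 hab.ne)), ← abs_div] at ha
  rw [← div_le_iff₀ (abs_pos.2 (sub_ne_zero.2 hbc.ne')), ← abs_div] at hc
  rw [← div_le_iff₀ (abs_pos.2 (sub_ne_zero.2 hxb)), ← abs_div]
  exact abs_le.2 ⟨(abs_le.1 ha).1.trans hleft, hright.trans (abs_le.1 hc).2⟩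

/-- **Lemma 7.** If `f : [α,γ] → ℝ` is convex and `L`-Lipschitz, `α < β < γ`, and a convex
`g : [α,γ] → ℝ` agrees with `f` at `α`, `β`, `γ`, then `|f − g| ≤ 2L(γ − α)` on `[α,γ]`. -/
theorem convex_interpolation_sup_bound (α β γ L : ℝ) (hαβ : α < β) (hβγ : β < γ)
    (f g : ℝ → ℝ) (hf : ConvexOn ℝ (Icc α γ) f)
    (hLip : ∀ x ∈ Icc α γ, ∀ y ∈ Icc α γ, |f x - f y| ≤ L * |x - y|)
    (hg : ConvexOn ℝ (Icc α γ) g)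
    (hα : f α = g α) (hβ : f β = g β) (hγ : f γ = g γ) :
    ∀ x ∈ Icc α γ, |f x - g x| ≤ 2 * L * (γ - α) := by
  intro x hx
  have hαγ : α < γ := hαβ.trans hβγ
  have hαm : α ∈ Icc α γ := left_mem_Icc.2 hαγ.le
  have hβm : β ∈ Icc α γ := ⟨hαβ.le, hβγ.le⟩
  have hγm : γ ∈ Icc α γ := right_mem_Icc.2 hαγ.le
  have hL : 0 ≤ L :=
    nonneg_of_mul_nonneg_left ((abs_nonneg _).trans (hLip α hαm γ hγm))
      (abs_pos.2 (sub_ne_zero.2 hαγ.ne))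
  have hgx : |g x - f β| ≤ L * |x - β| := by
    rw [hβ]
    exact hg.abs_sub_le_of_endpoints hαβ hβγ (hα ▸ hβ ▸ hLip α hαm β hβm)
      (hγ ▸ hβ ▸ hLip γ hγm β hβm) hx
  calc |f x - g x| ≤ |f x - f β| + |f β - g x| := abs_sub_le _ _ _
    _ ≤ L * |x - β| + L * |x - β| :=
      add_le_add (hLip x hx β hβm) (abs_sub_comm (f β) (g x) ▸ hgx)
    _ = 2 * L * |x - β| := by ring
    _ ≤ 2 * L * (γ - α) := by
      gcongr
      exact abs_sub_le_of_le_of_le hx.1 hx.2 hβm.1 hβm.2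
end

section
/- Suppose −∞ < α < β < γ < δ < ∞, f : [α,δ] → ℝ is convex, the restriction of f to [α,β] is of class C²([α,β]), and the restriction of f to [γ,δ] is of class C²([γ,δ]). Then for any ε > 0 with β − ε > α and γ + ε < δ, there exists a convex function g of class C²([α,δ]) such that g = f on [α, β−ε] ∪ [γ+ε, δ]. -/
open Set

lemma contDiff_two_of_hasDerivAt {h h₁ h₂ : ℝ → ℝ} (hh : ∀ x, HasDerivAt h (h₁ x) x)
    (hh₁ : ∀ x, HasDerivAt h₁ (h₂ x) x) (hc : Continuous h₂) : ContDiff ℝ 2 h := by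
  have e₁ : deriv h = h₁ := funext fun x => (hh x).deriv
  have e₂ : deriv h₁ = h₂ := funext fun x => (hh₁ x).deriv
  rw [show (2 : WithTop ℕ∞) = 1 + 1 from (one_add_one_eq_two).symm, contDiff_succ_iff_deriv, e₁]
  refine ⟨fun x => (hh x).differentiableAt, by simp, ?_⟩
  rw [contDiff_one_iff_deriv, e₂]
  exact ⟨fun x => (hh₁ x).differentiableAt, hc⟩

lemma convexOn_univ_of_hasDerivAt_two {h h₁ h₂ : ℝ → ℝ} (hh : ∀ x, HasDerivAt h (h₁ x) x)
    (hh₁ : ∀ x, HasDerivAt h₁ (h₂ x) x) (hn : ∀ x, 0 ≤ h₂ x) : ConvexOn ℝ univ h :=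
  convexOn_of_hasDerivWithinAt2_nonneg convex_univ
    (fun x _ => (hh x).continuousAt.continuousWithinAt)
    (fun x _ => (hh x).hasDerivWithinAt) (fun x _ => (hh₁ x).hasDerivWithinAt) fun x _ => hn x

/-- A continuous function has a second antiderivative with prescribed initial data. -/
lemma exists_second_antideriv {φ : ℝ → ℝ} (hφ : Continuous φ) (x₀ a c : ℝ) :
    ∃ h h₁ : ℝ → ℝ, (∀ x, HasDerivAt h (h₁ x) x) ∧ (∀ x, HasDerivAt h₁ (φ x) x) ∧
      h x₀ = a ∧ h₁ x₀ = c := by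
  have key : ∀ (ψ : ℝ → ℝ) (_ : Continuous ψ) (a x : ℝ),
      HasDerivAt (fun y => a + ∫ t in x₀..y, ψ t) (ψ x) x := fun ψ hψ a x =>
    (intervalIntegral.integral_hasDerivAt_right (hψ.intervalIntegrable _ _)
      hψ.aestronglyMeasurable.stronglyMeasurableAtFilter hψ.continuousAt).const_add a
  have hc : Continuous fun y => c + ∫ t in x₀..y, φ t :=
    continuous_iff_continuousAt.2 fun x => (key φ hφ c x).continuousAt
  exact ⟨_, _, key _ hc a, key φ hφ c, by simp, by simp⟩

lemma eqOn_of_hasDerivWithinAt {s : Set ℝ} (hs : Convex ℝ s) {u v w : ℝ → ℝ}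
    (hu : ∀ x ∈ s, HasDerivWithinAt u (w x) s x) (hv : ∀ x ∈ s, HasDerivWithinAt v (w x) s x)
    {x₀ : ℝ} (hx₀ : x₀ ∈ s) (h₀ : u x₀ = v x₀) : EqOn u v s := by
  intro x hx
  have := hs.norm_image_sub_le_of_norm_hasDerivWithin_le (C := 0) (f := fun y => u y - v y)
    (fun y hy => (hu y hy).sub (hv y hy)) (by simp) hx₀ hx
  simp only [h₀, sub_self, sub_zero, zero_mul, norm_le_zero_iff] at this
  linarith

lemma eqOn_of_hasDerivAt_two {s : Set ℝ} (hs : Convex ℝ s) {u u₁ v v₁ w z : ℝ → ℝ}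
    (hu : ∀ x, HasDerivAt u (u₁ x) x) (hu₁ : ∀ x, HasDerivAt u₁ (w x) x)
    (hv : ∀ x, HasDerivAt v (v₁ x) x) (hv₁ : ∀ x, HasDerivAt v₁ (z x) x) (hwz : EqOn w z s)
    {x₀ : ℝ} (hx₀ : x₀ ∈ s) (h₀ : u x₀ = v x₀) (h₁ : u₁ x₀ = v₁ x₀) : EqOn u v s := by
  have e : EqOn u₁ v₁ s := eqOn_of_hasDerivWithinAt hs (fun x _ => (hu₁ x).hasDerivWithinAt)
    (fun x hx => by rw [hwz hx]; exact (hv₁ x).hasDerivWithinAt) hx₀ h₁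
  exact eqOn_of_hasDerivWithinAt hs (fun x _ => (hu x).hasDerivWithinAt)
    (fun x hx => by rw [e hx]; exact (hv x).hasDerivWithinAt) hx₀ h₀

lemma tangent_le_of_hasDerivAt_two {D D₁ D₂ : ℝ → ℝ} (hD : ∀ x, HasDerivAt D (D₁ x) x)
    (hD₁ : ∀ x, HasDerivAt D₁ (D₂ x) x) (hn : ∀ x, 0 ≤ D₂ x) (x y : ℝ) :
    D x + D₁ x * (y - x) ≤ D y := by
  have hc := convexOn_univ_of_hasDerivAt_two hD hD₁ hn
  rcases lt_trichotomy x y with h | rfl | h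
  · have := hc.le_slope_of_hasDerivAt (mem_univ x) (mem_univ y) h (hD x)
    rw [slope_def_field, le_div_iff₀ (by linarith)] at this
    linarith
  · simp
  · have := hc.slope_le_of_hasDerivAt (mem_univ y) (mem_univ x) h (hD x)
    rw [slope_def_field, div_le_iff₀ (by linarith)] at this
    linarith

/-- A convex `C²` function on a compact interval extends to one on the line. -/
lemma exists_convex_C2_extension {α β : ℝ} (hαβ : α < β) {f : ℝ → ℝ}
    (hf : ConvexOn ℝ (Icc α β) f) (hf2 : ContDiffOn ℝ 2 f (Icc α β)) :
    ∃ F F₁ F₂ : ℝ → ℝ, (∀ x, HasDerivAt F (F₁ x) x) ∧ (∀ x, HasDerivAt F₁ (F₂ x) x) ∧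
      Continuous F₂ ∧ (∀ x, 0 ≤ F₂ x) ∧ EqOn F f (Icc α β) := by
  have hu := uniqueDiffOn_Icc hαβ
  have hd := hf2.differentiableOn (by norm_num)
  have h1 : ContDiffOn ℝ 1 (derivWithin f (Icc α β)) (Icc α β) :=
    hf2.derivWithin hu (by norm_num)
  have hd1 := h1.differentiableOn (by norm_num)
  have h2 := h1.continuousOn_derivWithin hu le_rfl
  have hm := hf.monotoneOn_derivWithin hd
  set f₁ := derivWithin f (Icc α β)
  set f₂ := derivWithin f₁ (Icc α β)
  let F₂ : ℝ → ℝ := IccExtend hαβ.le ((Icc α β).domRestrict f₂)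
  have hF₂ : Continuous F₂ := h2.domRestrict.Icc_extend'
  have e₂ : EqOn F₂ f₂ (Icc α β) := fun x hx => IccExtend_of_mem hαβ.le _ hx
  have hα : α ∈ Icc α β := left_mem_Icc.2 hαβ.le
  obtain ⟨F, F₁, hF, hF₁, a, c⟩ := exists_second_antideriv hF₂ α (f α) (f₁ α)
  have e₁ : EqOn F₁ f₁ (Icc α β) := eqOn_of_hasDerivWithinAt (convex_Icc α β)
    (fun x _ => (hF₁ x).hasDerivWithinAt)
    (fun x hx => by rw [e₂ hx]; exact (hd1 x hx).hasDerivWithinAt) hα c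
  refine ⟨F, F₁, F₂, hF, hF₁, hF₂, fun x => hm.derivWithin_nonneg, ?_⟩
  exact eqOn_of_hasDerivWithinAt (convex_Icc α β) (fun x _ => (hF x).hasDerivWithinAt)
    (fun x hx => by rw [e₁ hx]; exact (hd x hx).hasDerivWithinAt) hα a

/-- A convex `C²` function on `[α, β]` can be modified on `[b, β]` so as to become affine to the
right of `β`, the affine function being squeezed at `b` and `β` by the tangent at `β`. -/
lemma exists_convex_C2_affine_right {α b β d : ℝ} (hb : α < b) (hbβ : b < β) {f : ℝ → ℝ}
    (hf : ConvexOn ℝ (Icc α β) f) (hf2 : ContDiffOn ℝ 2 f (Icc α β))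
    (hd : HasDerivWithinAt f d (Icc α β) β) :
    ∃ (h : ℝ → ℝ) (p s : ℝ), ContDiff ℝ 2 h ∧ ConvexOn ℝ univ h ∧ EqOn h f (Icc α b) ∧
      (∀ x, β ≤ x → h x = p + s * (x - β)) ∧ p ≤ f β ∧ s ≤ d ∧
      f β + d * (b - β) ≤ p + s * (b - β) := by
  have hαβ := hb.trans hbβ
  obtain ⟨F, F₁, F₂, hF, hF₁, hF₂, hn, e⟩ := exists_convex_C2_extension hαβ hf hf2
  have hβ : β ∈ Icc α β := right_mem_Icc.2 hαβ.le
  have hdβ : F₁ β = d := (uniqueDiffOn_Icc hαβ β hβ).eq_deriv _ (hF β).hasDerivWithinAt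
    (hd.congr (fun x hx => e hx) (e hβ))
  let χ : ℝ → ℝ := fun x => max 0 (min 1 ((β - x) / (β - b)))
  have hχc : Continuous χ := by fun_prop
  have hχ0 : ∀ x, 0 ≤ χ x := fun x => le_max_left _ _
  have hχ1 : ∀ x, χ x ≤ 1 := fun x => max_le zero_le_one (min_le_left _ _)
  have hχb : ∀ x ≤ b, χ x = 1 := fun x hx => by
    have : 1 ≤ (β - x) / (β - b) := by rw [le_div_iff₀ (by linarith)]; linarith
    simp [χ, min_eq_left this]
  have hχβ : ∀ x, β ≤ x → χ x = 0 := fun x hx => by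
    have : (β - x) / (β - b) ≤ 0 := div_nonpos_of_nonpos_of_nonneg (by linarith) (by linarith)
    exact max_eq_left ((min_le_right _ _).trans this)
  obtain ⟨h, h₁, hh, hh₁, a, c⟩ := exists_second_antideriv (hF₂.mul hχc) b (F b) (F₁ b)
  have hn' : ∀ x, 0 ≤ F₂ x * χ x := fun x => mul_nonneg (hn x) (hχ0 x)
  have hD : ∀ x, HasDerivAt (fun y => F y - h y) (F₁ x - h₁ x) x := fun x => (hF x).sub (hh x)
  have hD₁ : ∀ x, HasDerivAt (fun y => F₁ y - h₁ y) (F₂ x - F₂ x * χ x) x :=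
    fun x => (hF₁ x).sub (hh₁ x)
  have hDn : ∀ x, 0 ≤ F₂ x - F₂ x * χ x := fun x => by nlinarith [hn x, hχ1 x]
  have t₁ := tangent_le_of_hasDerivAt_two hD hD₁ hDn b β
  have t₂ := tangent_le_of_hasDerivAt_two hD hD₁ hDn β b
  have t₃ : F₁ b - h₁ b ≤ F₁ β - h₁ β :=
    monotone_of_hasDerivAt_nonneg hD₁ hDn hbβ.le
  simp only [a, c, sub_self, zero_mul, add_zero] at t₁ t₂ t₃
  refine ⟨h, h β, h₁ β, contDiff_two_of_hasDerivAt hh hh₁ (hF₂.mul hχc),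
    convexOn_univ_of_hasDerivAt_two hh hh₁ hn', ?_, ?_, ?_, ?_, ?_⟩
  · intro x hx
    rw [← e ⟨hx.1, hx.2.trans hbβ.le⟩]
    exact eqOn_of_hasDerivAt_two (convex_Iic b) hh hh₁ hF hF₁
      (fun y hy => by simp [hχb y hy]) (mem_Iic.2 le_rfl) a c (mem_Iic.2 hx.2)
  · intro x hx
    refine eqOn_of_hasDerivAt_two (convex_Ici β) hh hh₁ (v := fun x => h β + h₁ β * (x - β))
      (v₁ := fun _ => h₁ β) (z := fun _ => 0) (fun x => ?_) (fun x => hasDerivAt_const _ _)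
      (fun y hy => by simp [hχβ y hy]) (mem_Ici.2 le_rfl) (by simp) rfl hx
    simpa using (((hasDerivAt_id x).sub_const β).const_mul (h₁ β)).const_add (h β)
  · rw [← e hβ]; linarith
  · linarith
  · rw [← e hβ, ← hdβ]; linarith

/-- Mirror image of `exists_convex_C2_affine_right`. -/
lemma exists_convex_C2_affine_left {γ c δ d : ℝ} (hγc : γ < c) (hc : c < δ) {f : ℝ → ℝ}
    (hf : ConvexOn ℝ (Icc γ δ) f) (hf2 : ContDiffOn ℝ 2 f (Icc γ δ))
    (hd : HasDerivWithinAt f d (Icc γ δ) γ) :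
    ∃ (h : ℝ → ℝ) (p s : ℝ), ContDiff ℝ 2 h ∧ ConvexOn ℝ univ h ∧ EqOn h f (Icc c δ) ∧
      (∀ x, x ≤ γ → h x = p + s * (x - γ)) ∧ p ≤ f γ ∧ d ≤ s ∧
      f γ + d * (c - γ) ≤ p + s * (c - γ) := by
  have hmap : MapsTo (fun x : ℝ => -x) (Icc (-δ) (-γ)) (Icc γ δ) :=
    fun x hx => ⟨by linarith [hx.2], by linarith [hx.1]⟩
  have hpre : (fun x : ℝ => -x) ⁻¹' Icc γ δ = Icc (-δ) (-γ) := by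
    ext x; simp only [mem_preimage, mem_Icc]; constructor <;> intro h <;> constructor <;> linarith
  have hcx : ConvexOn ℝ (Icc (-δ) (-γ)) (fun x => f (-x)) := by
    have := hf.comp_linearMap (-LinearMap.id)
    rw [← hpre]; exact this
  have hd' : HasDerivWithinAt (fun x => f (-x)) (-d) (Icc (-δ) (-γ)) (-γ) := by
    have h1 : HasDerivWithinAt f d (Icc γ δ) (-(-γ)) := by simpa using hd
    have h2 := h1.scomp (-γ) (hasDerivAt_neg (-γ)).hasDerivWithinAt hmap
    rw [neg_one_smul] at h2
    exact h2
  obtain ⟨h, p, s, h1, h2, h3, h4, h5, h6, h7⟩ := exists_convex_C2_affine_right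
    (neg_lt_neg hc) (neg_lt_neg hγc) hcx (hf2.comp contDiff_neg.contDiffOn hmap) hd'
  simp only [neg_neg] at h5 h7
  refine ⟨fun x => h (-x), p, -s, h1.comp contDiff_neg, ?_, ?_, ?_, h5, by linarith, by linarith⟩
  · exact h2.comp_linearMap (-LinearMap.id)
  · intro x hx
    simpa using h3 (x := -x) ⟨by linarith [hx.2], by linarith [hx.1]⟩
  · intro x hx
    simp only [h4 (-x) (by linarith)]; ring

/-- There is a convex `C²` function joining `0` to a nondecreasing linear function. -/
lemma exists_convex_C2_corner {m r : ℝ} (hm : 0 ≤ m) (hr : 0 < r) (x₀ : ℝ) :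
    ∃ S : ℝ → ℝ, ContDiff ℝ 2 S ∧ ConvexOn ℝ univ S ∧ (∀ x ≤ x₀ - r, S x = 0) ∧
      ∀ x, x₀ + r ≤ x → S x = m * (x - x₀) := by
  obtain ⟨q, q₁, hq, hq₁, a, c⟩ :=
    exists_second_antideriv (φ := fun x => max 0 (6 * x)) (by fun_prop) 0 0 0
  have hneg : ∀ x ≤ 0, q x = 0 := fun x hx =>
    eqOn_of_hasDerivAt_two (convex_Iic 0) hq hq₁ (v := fun _ => 0) (v₁ := fun _ => 0)
      (z := fun _ => 0) (fun x => hasDerivAt_const _ _) (fun x => hasDerivAt_const _ _)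
      (fun y (hy : y ≤ 0) => max_eq_left (by linarith)) (mem_Iic.2 le_rfl) a c hx
  have hpos : ∀ x, 0 ≤ x → q x = x ^ 3 := fun x hx =>
    eqOn_of_hasDerivAt_two (convex_Ici 0) hq hq₁ (v := fun x => x ^ 3) (v₁ := fun x => 3 * x ^ 2)
      (z := fun x => 6 * x) (fun x => by simpa using hasDerivAt_pow 3 x)
      (fun x => by
        have := (hasDerivAt_pow 2 x).const_mul 3
        norm_num [← mul_assoc] at this
        exact this)
      (fun y (hy : 0 ≤ y) => max_eq_right (by linarith)) (mem_Ici.2 le_rfl) (by simpa using a)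
      (by simpa using c) hx
  have hcomb : ∀ (u v : ℝ → ℝ) (_ : ∀ x, HasDerivAt u (v x) x) (x : ℝ),
      HasDerivAt (fun x => m / (6 * r ^ 2) * (u (x - x₀ + r) - 2 * u (x - x₀) + u (x - x₀ - r)))
        (m / (6 * r ^ 2) * (v (x - x₀ + r) - 2 * v (x - x₀) + v (x - x₀ - r))) x := by
    intro u v huv x
    have hs : HasDerivAt (fun x : ℝ => x - x₀) 1 x := (hasDerivAt_id x).sub_const x₀
    have i₁ := (huv (x - x₀ + r)).comp x (hs.add_const r)
    have i₂ := (huv (x - x₀)).comp x hs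
    have i₃ := (huv (x - x₀ - r)).comp x (hs.sub_const r)
    rw [mul_one] at i₁ i₂ i₃
    exact ((i₁.sub (i₂.const_mul 2)).add i₃).const_mul _
  have hm' : 0 ≤ m / (6 * r ^ 2) := by positivity
  refine ⟨_, contDiff_two_of_hasDerivAt (hcomb _ _ hq) (hcomb _ _ hq₁) (by fun_prop),
    convexOn_univ_of_hasDerivAt_two (hcomb _ _ hq) (hcomb _ _ hq₁) (fun x => ?_), ?_, ?_⟩
  · refine mul_nonneg hm' ?_
    have l₁ := le_max_left 0 (6 * (x - x₀ + r))
    have l₂ := le_max_right 0 (6 * (x - x₀ + r))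
    have l₃ := le_max_left 0 (6 * (x - x₀ - r))
    have l₄ := le_max_right 0 (6 * (x - x₀ - r))
    rcases max_cases 0 (6 * (x - x₀)) with h | h <;> linarith
  · intro x hx
    simp only [hneg (x - x₀ + r) (by linarith), hneg (x - x₀) (by linarith),
      hneg (x - x₀ - r) (by linarith)]
    ring
  · intro x hx
    simp only [hpos (x - x₀ + r) (by linarith), hpos (x - x₀) (by linarith),
      hpos (x - x₀ - r) (by linarith)]
    field_simp
    ring

open Filter in
lemma ConvexOn.leftDeriv_mul_le {S : Set ℝ} {f : ℝ → ℝ} (hf : ConvexOn ℝ S f) {w x y d : ℝ}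
    (hw : w ∈ S) (hx : x ∈ S) (hy : y ∈ S) (hwx : w < x) (hxy : x < y)
    (hd : HasDerivWithinAt f d (Iio x) x) : d * (y - x) ≤ f y - f x := by
  rw [← le_div_iff₀ (by linarith)]
  apply le_of_tendsto <| (hasDerivWithinAt_iff_tendsto_slope' self_notMem_Iio).mp hd
  simp_rw [eventually_nhdsWithin_iff, slope_def_field]
  filter_upwards [eventually_gt_nhds hwx] with t ht (htx : t < x)
  exact hf.secant_mono hx (hf.1.ordConnected.out hw hx ⟨ht.le, htx.le⟩) hy htx.ne hxy.ne'
    (htx.trans hxy).le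

open Filter in
lemma ConvexOn.le_rightDeriv_mul {S : Set ℝ} {f : ℝ → ℝ} (hf : ConvexOn ℝ S f) {w x y d : ℝ}
    (hw : w ∈ S) (hx : x ∈ S) (hy : y ∈ S) (hxw : x < w) (hyx : y < x)
    (hd : HasDerivWithinAt f d (Ioi x) x) : f x - f y ≤ d * (x - y) := by
  rw [← div_le_iff₀ (by linarith), ← neg_div_neg_eq, neg_sub, neg_sub]
  apply ge_of_tendsto <| (hasDerivWithinAt_iff_tendsto_slope' self_notMem_Ioi).mp hd
  simp_rw [eventually_nhdsWithin_iff, slope_def_field]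
  filter_upwards [eventually_lt_nhds hxw] with t ht (hxt : x < t)
  exact hf.secant_mono hx hy (hf.1.ordConnected.out hx hw ⟨hxt.le, ht.le⟩) hyx.ne hxt.ne'
    (hyx.trans hxt).le

/-- An affine function going from nonpositive to nonnegative values is `m * (x - x₀)` with
`0 ≤ m` and `x₀` in between. -/
lemma exists_root_of_affine {A B b c : ℝ} (hbc : b < c) (hb : A + B * b ≤ 0)
    (hc : 0 ≤ A + B * c) : 0 ≤ B ∧ ∃ x₀ ∈ Icc b c, ∀ x, A + B * x = B * (x - x₀) := by
  have hB : 0 ≤ B := by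
    by_contra! h
    nlinarith
  refine ⟨hB, ?_⟩
  rcases hB.eq_or_lt with rfl | hB
  · exact ⟨b, ⟨le_rfl, hbc.le⟩, fun x => by linarith⟩
  · refine ⟨-A / B, ⟨?_, ?_⟩, fun x => by field_simp; ring⟩
    · rw [le_div_iff₀ hB]; linarith
    · rw [div_le_iff₀ hB]; linarith

/-- **Lemma 6.** Suppose `α < β < γ < δ`, `f : [α,δ] → ℝ` is convex, `f ∈ C²([α,β])` and
`f ∈ C²([γ,δ])`. Then for any `ε > 0` (with `β − ε > α` and `γ + ε < δ`) there is a convex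
`g ∈ C²([α,δ])` with `g = f` on `[α, β−ε] ∪ [γ+ε, δ]`. -/
theorem convex_C2_gluing (α β γ δ ε : ℝ) (hαβ : α < β) (hβγ : β < γ) (hγδ : γ < δ)
    (f : ℝ → ℝ) (hf : ConvexOn ℝ (Icc α δ) f)
    (hf1 : ContDiffOn ℝ 2 f (Icc α β)) (hf2 : ContDiffOn ℝ 2 f (Icc γ δ))
    (hε : 0 < ε) (hε1 : α < β - ε) (hε2 : γ + ε < δ) :
    ∃ g : ℝ → ℝ,
      ConvexOn ℝ (Icc α δ) g ∧
      ContDiffOn ℝ 2 g (Icc α δ) ∧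
      EqOn f g (Icc α (β - ε) ∪ Icc (γ + ε) δ) := by
  have hd := (hf1.differentiableOn (by norm_num) β (right_mem_Icc.2 hαβ.le)).hasDerivWithinAt
  have he := (hf2.differentiableOn (by norm_num) γ (left_mem_Icc.2 hγδ.le)).hasDerivWithinAt
  set d := derivWithin f (Icc α β) β
  set e := derivWithin f (Icc γ δ) γ
  have hα : α ∈ Icc α δ := ⟨le_rfl, by linarith⟩
  have hβ : β ∈ Icc α δ := ⟨by linarith, by linarith⟩
  have hγ : γ ∈ Icc α δ := ⟨by linarith, by linarith⟩
  have hδ : δ ∈ Icc α δ := ⟨by linarith, le_rfl⟩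
  have k₁ : d * (γ - β) ≤ f γ - f β := hf.leftDeriv_mul_le hα hβ hγ hαβ hβγ
    (hd.mono_of_mem_nhdsWithin (Icc_mem_nhdsLT hαβ))
  have k₂ : f γ - f β ≤ e * (γ - β) := hf.le_rightDeriv_mul hδ hγ hβ hγδ hβγ
    (he.mono_of_mem_nhdsWithin (Icc_mem_nhdsGT hγδ))
  have hde : d ≤ e := le_of_mul_le_mul_right (k₁.trans k₂) (by linarith)
  obtain ⟨h, p, s, h1, h2, h3, h4, h5, h6, h7⟩ := exists_convex_C2_affine_right
    (b := β - ε / 2) (by linarith) (by linarith)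
    (hf.subset (Icc_subset_Icc le_rfl hβ.2) (convex_Icc _ _)) hf1 hd
  obtain ⟨k, p', s', j1, j2, j3, j4, j5, j6, j7⟩ := exists_convex_C2_affine_left
    (c := γ + ε / 2) (by linarith) (by linarith)
    (hf.subset (Icc_subset_Icc hγ.1 le_rfl) (convex_Icc _ _)) hf2 he
  obtain ⟨hm, x₀, hx₀, hA⟩ := exists_root_of_affine (A := p' - s' * γ - (p - s * β)) (B := s' - s)
    (b := β - ε / 2) (c := γ + ε / 2) (by linarith)
    (by nlinarith [mul_nonneg (sub_nonneg.2 j6) (show 0 ≤ γ - β + ε / 2 by linarith),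
          mul_nonneg (sub_nonneg.2 hde) hε.le])
    (by nlinarith [mul_nonneg (sub_nonneg.2 h6) (show 0 ≤ γ - β + ε / 2 by linarith),
          mul_nonneg (sub_nonneg.2 hde) hε.le])
  obtain ⟨S, S1, S2, S3, S4⟩ := exists_convex_C2_corner hm (half_pos hε) x₀
  have hlin : ConvexOn ℝ univ fun x => -(p' + s' * (x - γ)) :=
    convexOn_univ_of_hasDerivAt_two (h₁ := fun _ => -s') (h₂ := fun _ => 0)
      (fun x => by
        have := ((((hasDerivAt_id x).sub_const γ).const_mul s').const_add p').neg
        rw [mul_one] at this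
        exact this)
      (fun x => hasDerivAt_const _ _) fun _ => le_rfl
  refine ⟨fun x => h x + k x + -(p' + s' * (x - γ)) + S x,
    (((h2.add j2).add hlin).add S2).subset (subset_univ _) (convex_Icc _ _), ?_, ?_⟩
  · exact ContDiff.contDiffOn (by fun_prop)
  · rintro x (hx | hx)
    · simp only [h3 (x := x) ⟨hx.1, by linarith [hx.2]⟩, j4 x (by linarith [hx.2]),
        S3 x (by linarith [hx.2, hx₀.1])]
      ring
    · simp only [j3 (x := x) ⟨by linarith [hx.1], hx.2⟩, h4 x (by linarith [hx.1]),
        S4 x (by linarith [hx.1, hx₀.2])]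
      linarith [hA x]
end

section
/- Let c > 0 and let h : [0,c] → [0,∞) be integrable with P := ∫₀^c h(t) dt > 0. Define τ ∈ (0,c) by P·τ = ∫₀^c t·h(t) dt, and let ε := max( sup over x ∈ (0,c] of (1/x)∫₀^x h(t) dt, sup over x ∈ (0,c] of (1/x)∫_{c−x}^c h(t) dt ). Then: if τ ≤ c/2 one has P/τ ≤ 4ε, and if τ ≥ c/2 one has P/(c−τ) ≤ 4ε. In particular P / min(τ, c−τ) ≤ 4ε. -/
open MeasureTheory Set intervalIntegral

/-- If all averages of `h ≥ 0` over the intervals `[0, x]` are at most `ε`, then the first moment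
of `h` is at least `(∫ h)² / (4ε)`: half of the mass lies to the right of `(∫ h) / (2ε)`. -/
theorem sq_integral_le_mul_first_moment {c ε : ℝ} (hc : 0 < c) {h : ℝ → ℝ}
    (hint : IntervalIntegrable h volume 0 c) (hpos : ∀ t ∈ Icc 0 c, 0 ≤ h t)
    (hP : 0 < ∫ t in (0:ℝ)..c, h t)
    (hε : ∀ x ∈ Ioc 0 c, (1 / x) * ∫ t in (0:ℝ)..x, h t ≤ ε) :
    (∫ t in (0:ℝ)..c, h t) ^ 2 ≤ 4 * ε * ∫ t in (0:ℝ)..c, t * h t := by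
  have havg : ∀ x ∈ Ioc 0 c, ∫ t in (0:ℝ)..x, h t ≤ ε * x := fun x hx => by
    have := hε x hx
    rwa [one_div, inv_mul_eq_div, div_le_iff₀ hx.1] at this
  set P := ∫ t in (0:ℝ)..c, h t
  have hPc : P ≤ ε * c := havg c ⟨hc, le_rfl⟩
  have hε0 : 0 < ε := pos_of_mul_pos_left (hP.trans_le hPc) hc.le
  obtain ⟨x, hxdef⟩ : ∃ x, x = P / (2 * ε) := ⟨_, rfl⟩
  have hx0 : 0 < x := by rw [hxdef]; positivity
  have hxP : 2 * ε * x = P := by rw [hxdef]; field_simp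
  have hxc : x ≤ c := by
    rw [hxdef, div_le_iff₀ (by positivity)]
    nlinarith
  have hx : x ∈ uIcc 0 c := by rw [uIcc_of_le hc.le]; exact ⟨hx0.le, hxc⟩
  have h0x : IntervalIntegrable h volume 0 x := hint.mono_set (uIcc_subset_uIcc_left hx)
  have hxc' : IntervalIntegrable h volume x c := hint.mono_set (uIcc_subset_uIcc_right hx)
  have hsplit : (∫ t in (0:ℝ)..x, h t) + ∫ t in x..c, h t = P :=
    integral_add_adjacent_intervals h0x hxc'
  have hmsplit : (∫ t in (0:ℝ)..x, t * h t) + ∫ t in x..c, t * h t =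
      ∫ t in (0:ℝ)..c, t * h t :=
    integral_add_adjacent_intervals (h0x.continuousOn_mul continuousOn_id)
      (hxc'.continuousOn_mul continuousOn_id)
  have hleft : 0 ≤ ∫ t in (0:ℝ)..x, t * h t :=
    integral_nonneg hx0.le fun t ht => mul_nonneg ht.1 (hpos t ⟨ht.1, ht.2.trans hxc⟩)
  have hright : x * ∫ t in x..c, h t ≤ ∫ t in x..c, t * h t := by
    rw [← intervalIntegral.integral_const_mul]
    exact integral_mono_on hxc (hxc'.const_mul x) (hxc'.continuousOn_mul continuousOn_id)
      fun t ht => mul_le_mul_of_nonneg_right ht.1 (hpos t ⟨hx0.le.trans ht.1, ht.2⟩)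
  have hhalf : P / 2 ≤ ∫ t in x..c, h t := by
    have := havg x ⟨hx0, hxc⟩
    linarith
  calc P ^ 2 = 4 * ε * (x * (P / 2)) := by rw [← hxP]; ring
    _ ≤ 4 * ε * ∫ t in (0:ℝ)..c, t * h t := by
      gcongr
      linarith [mul_le_mul_of_nonneg_left hhalf hx0.le]

/-- **Lemma 5 (key estimate).** Let `h ≥ 0` be integrable on `[0,c]` with
`P = ∫₀ᶜ h > 0`, and let `τ ∈ (0,c)` satisfy `P·τ = ∫₀ᶜ t·h(t) dt`. If `ε` bounds all the
one-sided averages `(1/x)∫₀ˣ h` and `(1/x)∫_{c−x}ᶜ h`, `x ∈ (0,c]`, then `P/τ ≤ 4ε`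
when `τ ≤ c/2`, `P/(c−τ) ≤ 4ε` when `τ ≥ c/2`; in particular `P / min(τ, c−τ) ≤ 4ε`. -/
theorem height_bound (c P τ ε : ℝ) (hc : 0 < c) (h : ℝ → ℝ)
    (hint : IntegrableOn h (Icc 0 c))
    (hpos : ∀ t ∈ Icc 0 c, 0 ≤ h t)
    (hP : P = ∫ t in (0:ℝ)..c, h t) (hPpos : 0 < P)
    (hτ : τ ∈ Ioo 0 c) (hmom : P * τ = ∫ t in (0:ℝ)..c, t * h t)
    (hε₁ : ∀ x ∈ Ioc 0 c, (1 / x) * ∫ t in (0:ℝ)..x, h t ≤ ε)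
    (hε₂ : ∀ x ∈ Ioc 0 c, (1 / x) * ∫ t in (c - x)..c, h t ≤ ε) :
    (τ ≤ c / 2 → P / τ ≤ 4 * ε) ∧
    (c / 2 ≤ τ → P / (c - τ) ≤ 4 * ε) ∧
    P / min τ (c - τ) ≤ 4 * ε := by
  have hI : IntervalIntegrable h volume 0 c :=
    (intervalIntegrable_iff_integrableOn_Icc_of_le hc.le).2 hint
  have hleft : P / τ ≤ 4 * ε := by
    have key := sq_integral_le_mul_first_moment hc hI hpos (hP ▸ hPpos) hε₁
    rw [← hP, ← hmom] at key
    rw [div_le_iff₀ hτ.1]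
    exact le_of_mul_le_mul_left (by linarith) hPpos
  have hright : P / (c - τ) ≤ 4 * ε := by
    have hIr : IntervalIntegrable (fun t => h (c - t)) volume 0 c := by
      simpa using (hI.comp_sub_left c).symm
    have hPr : ∫ t in (0:ℝ)..c, h (c - t) = P := by
      simp [hP]
    have hmr : ∫ t in (0:ℝ)..c, t * h (c - t) = P * (c - τ) := by
      have hsub := intervalIntegral.integral_comp_sub_left (a := 0) (b := c)
        (fun t => (c - t) * h t) c
      simp only [sub_sub_cancel, sub_self, sub_zero] at hsub
      simp only [hsub, sub_mul]
      rw [intervalIntegral.integral_sub (hI.const_mul c) (hI.continuousOn_mul (continuousOn_id' _)),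
        intervalIntegral.integral_const_mul, ← hP, ← hmom]
      ring
    have key := sq_integral_le_mul_first_moment (ε := ε) hc hIr
      (fun t ht => hpos _ ⟨sub_nonneg.2 ht.2, sub_le_self _ ht.1⟩) (hPr.symm ▸ hPpos)
      (fun x hx => by simpa using hε₂ x hx)
    rw [hPr, hmr] at key
    rw [div_le_iff₀ (sub_pos.2 hτ.2)]
    exact le_of_mul_le_mul_left (by linarith) hPpos
  refine ⟨fun _ => hleft, fun _ => hright, ?_⟩
  rcases min_choice τ (c - τ) with hm | hm <;> rw [hm] <;> assumption
end

section
/- Let c > 0, P > 0, and τ ∈ (0,c). Then there exists a continuous, nonnegative, piecewise linear function h₁ : [0,c] → [0,∞) such that h₁(0) = h₁(c) = 0, ∫₀^c h₁(t) dt = P, ∫₀^c t·h₁(t) dt = P·τ, and 0 ≤ h₁(t) ≤ H for all t ∈ [0,c], where H = P/τ if τ ≤ c/2 and H = P/(c−τ) if τ ≥ c/2. (Explicitly, the graph of h₁ is an isosceles triangle of height H, area P, with center of mass at τ, supported on [0, 2τ] if τ ≤ c/2 and on [2τ−c, c] if τ ≥ c/2.) -/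
open MeasureTheory Set intervalIntegral

/-- The isosceles triangle function with apex `(m, s * w)` and half-base `w`. -/
noncomputable def triangleFun (s w m t : ℝ) : ℝ := s * max 0 (w - |t - m|)

section triangleFun

variable {s w m t : ℝ}

theorem continuous_triangleFun (s w m : ℝ) : Continuous (triangleFun s w m) := by
  unfold triangleFun
  fun_prop

theorem triangleFun_nonneg (hs : 0 ≤ s) : 0 ≤ triangleFun s w m t :=
  mul_nonneg hs (le_max_left _ _)

theorem triangleFun_le (hs : 0 ≤ s) (hw : 0 ≤ w) : triangleFun s w m t ≤ s * w :=
  mul_le_mul_of_nonneg_left (max_le hw (sub_le_self _ (abs_nonneg _))) hs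

theorem triangleFun_of_le_left (h : t ≤ m - w) : triangleFun s w m t = 0 := by
  rw [triangleFun, max_eq_left (by linarith [neg_le_abs (t - m)]), mul_zero]

theorem triangleFun_of_right_le (h : m + w ≤ t) : triangleFun s w m t = 0 := by
  rw [triangleFun, max_eq_left (by linarith [le_abs_self (t - m)]), mul_zero]

theorem triangleFun_of_mem_left (h : t ∈ Icc (m - w) m) :
    triangleFun s w m t = s * t + s * (w - m) := by
  rw [triangleFun, abs_of_nonpos (by linarith [h.2]), max_eq_right (by linarith [h.1])]
  ring

theorem triangleFun_of_mem_right (h : t ∈ Icc m (m + w)) :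
    triangleFun s w m t = -s * t + s * (w + m) := by
  rw [triangleFun, abs_of_nonneg (by linarith [h.1]), max_eq_right (by linarith [h.2])]
  ring

theorem integral_affine_mul_affine (a b p q k l : ℝ) :
    ∫ t in a..b, (p * t + q) * (k * t + l) =
      p * k * (b ^ 3 - a ^ 3) / 3 + (p * l + q * k) * (b ^ 2 - a ^ 2) / 2 + q * l * (b - a) := by
  rw [integral_eq_sub_of_hasDerivAt
    (f := fun t ↦ p * k * t ^ 3 / 3 + (p * l + q * k) * t ^ 2 / 2 + q * l * t)]
  · ring
  · intro t _
    refine (((((hasDerivAt_id t).pow 3).const_mul (p * k)).div_const 3).add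
      ((((hasDerivAt_id t).pow 2).const_mul (p * l + q * k)).div_const 2) |>.add
      ((hasDerivAt_id t).const_mul (q * l))).congr_deriv ?_
    simp only [id]
    ring
  · exact Continuous.intervalIntegrable (by fun_prop) _ _

/-- Integrating an affine function against a triangle gives the triangle's area times the value
at the apex. -/
theorem integral_affine_mul_triangleFun {a b : ℝ} (s : ℝ) (hw : 0 ≤ w) (ha : a ≤ m - w)
    (hb : m + w ≤ b) (p q : ℝ) :
    ∫ t in a..b, (p * t + q) * triangleFun s w m t = s * w ^ 2 * (p * m + q) := by
  have hi (x y : ℝ) :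
      IntervalIntegrable (fun t ↦ (p * t + q) * triangleFun s w m t) volume x y :=
    (Continuous.mul (by fun_prop) (continuous_triangleFun s w m)).intervalIntegrable x y
  have hl : ∫ t in a..(m - w), (p * t + q) * triangleFun s w m t = 0 :=
    (integral_congr (g := fun _ ↦ (0 : ℝ)) fun t ht ↦ by
      rw [uIcc_of_le ha] at ht
      simp only [triangleFun_of_le_left ht.2, mul_zero]).trans integral_zero
  have hr : ∫ t in (m + w)..b, (p * t + q) * triangleFun s w m t = 0 :=
    (integral_congr (g := fun _ ↦ (0 : ℝ)) fun t ht ↦ by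
      rw [uIcc_of_le hb] at ht
      simp only [triangleFun_of_right_le ht.1, mul_zero]).trans integral_zero
  have hml : ∫ t in (m - w)..m, (p * t + q) * triangleFun s w m t =
      ∫ t in (m - w)..m, (p * t + q) * (s * t + s * (w - m)) :=
    integral_congr fun t ht ↦ by
      rw [uIcc_of_le (by linarith)] at ht
      simp only [triangleFun_of_mem_left ht]
  have hmr : ∫ t in m..(m + w), (p * t + q) * triangleFun s w m t =
      ∫ t in m..(m + w), (p * t + q) * (-s * t + s * (w + m)) :=
    integral_congr fun t ht ↦ by
      rw [uIcc_of_le (by linarith)] at ht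
      simp only [triangleFun_of_mem_right ht]
  rw [← integral_add_adjacent_intervals (hi a (m - w)) (hi (m - w) b),
    ← integral_add_adjacent_intervals (hi (m - w) m) (hi m b),
    ← integral_add_adjacent_intervals (hi m (m + w)) (hi (m + w) b), hl, hr, hml, hmr,
    integral_affine_mul_affine, integral_affine_mul_affine]
  ring

end triangleFun

/-- **Construction of the triangle profile.** Given `c > 0`, `P > 0`, `τ ∈ (0,c)`, there is a
continuous, nonnegative, piecewise linear `h₁ : [0,c] → [0,∞)` with `h₁(0) = h₁(c) = 0`,
`∫₀ᶜ h₁ = P`, `∫₀ᶜ t·h₁(t) dt = P·τ`, and `0 ≤ h₁ ≤ H`, where `H = P/τ` if `τ ≤ c/2` and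
`H = P/(c−τ)` if `τ ≥ c/2`. -/
theorem triangle_profile_exists (c P τ H : ℝ) (hc : 0 < c) (hP : 0 < P) (hτ : τ ∈ Ioo 0 c)
    (hH1 : τ ≤ c / 2 → H = P / τ) (hH2 : c / 2 ≤ τ → H = P / (c - τ)) :
    ∃ h₁ : ℝ → ℝ,
      ContinuousOn h₁ (Icc 0 c) ∧
      (∀ t ∈ Icc 0 c, 0 ≤ h₁ t ∧ h₁ t ≤ H) ∧
      h₁ 0 = 0 ∧ h₁ c = 0 ∧
      (∫ t in (0:ℝ)..c, h₁ t) = P ∧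
      (∫ t in (0:ℝ)..c, t * h₁ t) = P * τ ∧
      -- piecewise linear with (at most) three affine pieces
      ∃ t₁ t₂ : ℝ, 0 ≤ t₁ ∧ t₁ ≤ t₂ ∧ t₂ ≤ c ∧
        (∃ m k : ℝ, ∀ t ∈ Icc 0 t₁, h₁ t = m * t + k) ∧
        (∃ m k : ℝ, ∀ t ∈ Icc t₁ t₂, h₁ t = m * t + k) ∧
        (∃ m k : ℝ, ∀ t ∈ Icc t₂ c, h₁ t = m * t + k) := by
  obtain ⟨hτ0, hτc⟩ := hτ
  obtain ⟨w, hw, hl, hr, hH, hcase⟩ : ∃ w : ℝ, 0 < w ∧ w ≤ τ ∧ τ + w ≤ c ∧ H = P / w ∧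
      (w = τ ∨ w = c - τ) := by
    rcases le_total τ (c / 2) with h | h
    · exact ⟨τ, hτ0, le_rfl, by linarith, hH1 h, .inl rfl⟩
    · exact ⟨c - τ, by linarith, by linarith, by linarith, hH2 h, .inr rfl⟩
  have hs : 0 ≤ P / w ^ 2 := by positivity
  have hint := integral_affine_mul_triangleFun (P / w ^ 2) hw.le (sub_nonneg.2 hl) hr
  have harea : P / w ^ 2 * w ^ 2 = P := div_mul_cancel₀ _ (by positivity)
  refine ⟨triangleFun (P / w ^ 2) w τ, (continuous_triangleFun _ _ _).continuousOn,
    fun t _ ↦ ⟨triangleFun_nonneg hs, ?_⟩, triangleFun_of_le_left (sub_nonneg.2 hl),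
    triangleFun_of_right_le hr, ?_, ?_, ?_⟩
  · have hheight : P / w ^ 2 * w = H := by
      rw [hH]
      field_simp
    exact hheight ▸ triangleFun_le hs hw.le
  · simpa [harea] using hint 0 1
  · simpa [harea] using hint 1 0
  · rcases hcase with rfl | rfl
    · refine ⟨w, w + w, hw.le, by linarith, hr,
        ⟨_, _, fun t ht ↦ triangleFun_of_mem_left (by simpa using ht)⟩,
        ⟨_, _, fun t ht ↦ triangleFun_of_mem_right ht⟩, ⟨0, 0, fun t ht ↦ ?_⟩⟩
      rw [triangleFun_of_right_le ht.1]
      ring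
    · refine ⟨τ - (c - τ), τ, by linarith, by linarith, hτc.le, ⟨0, 0, fun t ht ↦ ?_⟩,
        ⟨_, _, fun t ht ↦ triangleFun_of_mem_left ht⟩,
        ⟨_, _, fun t ht ↦ triangleFun_of_mem_right (by simpa using ht)⟩⟩
      rw [triangleFun_of_le_left ht.2]
      ring
end
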